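/- For every integer n ≥ 4 there exist a Ważewski dendrite X of order n and a finitely generated subgroup G of Homeo(X), dense in Homeo(X), whose commutator subgroup [G,G] is a simple group of infinite index in G. -/

import Mathlib

open Topology

/-- The set of connected components of a subset `S` of `X`. -/
def setComponents (X : Type*) [TopologicalSpace X] (S : Set X) : Set (Set X) :=
  {C | ∃ x ∈ S, C = connectedComponentIn S x}

/-- The order of a point `p` of `X`: the number of connected components of `X \ {p}`. -/
noncomputable def ptOrder (X : Type*) [TopologicalSpace X] (p : X) : ℕ :=
  (setComponents X {p}ᶜ).ncard

/-- A dendrite: a nonempty, compact, connected, locally connected metrizable space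
containing no subspace homeomorphic to the circle. -/
def IsDendrite (X : Type*) [TopologicalSpace X] : Prop :=
  Nonempty X ∧ CompactSpace X ∧ ConnectedSpace X ∧ LocallyConnectedSpace X ∧
    TopologicalSpace.MetrizableSpace X ∧
    ∀ S : Set X, IsEmpty (S ≃ₜ Circle)

/-- A Ważewski dendrite of order `n`: a dendrite all of whose points have order `1`, `2`
or `n`, and every arc (subspace homeomorphic to `[0,1]`) contains a point of order `n`. -/
def IsWazewskiDendrite (n : ℕ) (X : Type*) [TopologicalSpace X] : Prop :=
  IsDendrite X ∧
  (∀ p : X, ptOrder X p = 1 ∨ ptOrder X p = 2 ∨ ptOrder X p = n) ∧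
  ∀ A : Set X, Nonempty (A ≃ₜ unitInterval) → ∃ p ∈ A, ptOrder X p = n

/-- The group structure on self-homeomorphisms of `X`, with composition as product. -/
instance Homeomorph.instGroupSelf (X : Type*) [TopologicalSpace X] : Group (X ≃ₜ X) where
  mul f g := g.trans f
  one := Homeomorph.refl X
  inv := Homeomorph.symm
  mul_assoc _ _ _ := rfl
  one_mul _ := Homeomorph.ext fun _ => rfl
  mul_one _ := Homeomorph.ext fun _ => rfl
  inv_mul_cancel := Homeomorph.self_trans_symm

/-- The compact-open topology on the group of self-homeomorphisms of `X` (for compact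
metric `X`, this is the topology of uniform convergence). -/
instance Homeomorph.instTopSelf (X : Type*) [TopologicalSpace X] :
    TopologicalSpace (X ≃ₜ X) :=
  TopologicalSpace.induced (fun h : X ≃ₜ X => (h : C(X, X))) ContinuousMap.compactOpen

open Topology
/-! ## Part 1 : the space -/

namespace Waz

/-- Dyadic numbers. -/
def Dy (r : ℝ) : Prop := ∃ (k : ℕ) (z : ℤ), r * 2 ^ k = z

/-- Dyadic numbers strictly between `0` and `1`. -/
abbrev DD : Type := {r : ℝ // 0 < r ∧ r < 1 ∧ Dy r}

abbrev EE (m : ℕ) : Type := List (DD × Fin m)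

/-- The points of the dendrite: coherent families of coordinates. -/
structure IsPt {m : ℕ} (x : EE m → ℝ) : Prop where
  nn : ∀ e, 0 ≤ x e
  le : ∀ e, x e ≤ 1
  par : ∀ w a, x (w ++ [a]) ≠ 0 → x w = a.1
  ex : ∀ w a b, x (w ++ [a]) ≠ 0 → x (w ++ [b]) ≠ 0 → a = b

abbrev XX (m : ℕ) : Type := {x : EE m → ℝ // IsPt x}

instance : Countable DD := by
  have h : {r : ℝ | Dy r}.Countable := by
    have : {r : ℝ | Dy r} ⊆ Set.range (fun p : ℕ × ℤ => (p.2 : ℝ) / 2 ^ p.1) := by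
      rintro r ⟨k, z, h⟩
      refine ⟨(k, z), ?_⟩
      simp only
      rw [← h]; field_simp
    exact (Set.countable_range _).mono this
  have h2 : {r : ℝ | 0 < r ∧ r < 1 ∧ Dy r}.Countable := h.mono fun r hr => hr.2.2
  exact h2.to_subtype

variable {m : ℕ}

theorem continuous_coord (e : EE m) : Continuous (fun x : XX m => x.1 e) :=
  (continuous_apply e).comp continuous_subtype_val

theorem isClosed_isPt : IsClosed {x : EE m → ℝ | IsPt x} := by
  have : {x : EE m → ℝ | IsPt x} =
      (⋂ e, {x | 0 ≤ x e}) ∩ (⋂ e, {x | x e ≤ 1}) ∩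
      (⋂ w, ⋂ a : DD × Fin m, {x | x (w ++ [a]) = 0} ∪ {x | x w = (a.1 : ℝ)}) ∩
      (⋂ w, ⋂ a, ⋂ b, ⋂ (_ : a ≠ b), {x | x (w ++ [a]) = 0} ∪ {x | x (w ++ [b]) = 0}) := by
    ext x
    simp only [Set.mem_ofPred_eq, Set.mem_inter_iff, Set.mem_iInter, Set.mem_union]
    constructor
    · intro h
      refine ⟨⟨⟨h.nn, h.le⟩, fun w a => ?_⟩, fun w a b hab => ?_⟩
      · have := h.par w a; tauto
      · have := h.ex w a b; tauto
    · rintro ⟨⟨⟨h1, h2⟩, h3⟩, h4⟩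
      refine ⟨h1, h2, fun w a h => ?_, fun w a b h h' => ?_⟩
      · have := h3 w a; tauto
      · have := h4 w a b; tauto
  rw [this]
  refine IsClosed.inter (IsClosed.inter (IsClosed.inter ?_ ?_) ?_) ?_
  · exact isClosed_iInter fun e => isClosed_le continuous_const (continuous_apply e)
  · exact isClosed_iInter fun e => isClosed_le (continuous_apply e) continuous_const
  · exact isClosed_iInter fun w => isClosed_iInter fun a =>
      (isClosed_eq (continuous_apply _) continuous_const).union
        (isClosed_eq (continuous_apply _) continuous_const)
  · exact isClosed_iInter fun w => isClosed_iInter fun a => isClosed_iInter fun b =>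
      isClosed_iInter fun _ =>
      (isClosed_eq (continuous_apply _) continuous_const).union
        (isClosed_eq (continuous_apply _) continuous_const)

instance : CompactSpace (XX m) := by
  have h : IsCompact {x : EE m → ℝ | IsPt x} := by
    refine (isCompact_univ_pi (fun _ : EE m => isCompact_Icc (a := (0:ℝ)) (b := 1))).of_isClosed_subset
      isClosed_isPt ?_
    intro x hx e _
    exact ⟨hx.nn e, hx.le e⟩
  exact isCompact_iff_compactSpace.1 h

theorem metrizable_X : TopologicalSpace.MetrizableSpace (XX m) := by
  have : TopologicalSpace.MetrizableSpace (EE m → ℝ) :=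
    TopologicalSpace.PseudoMetrizableSpace.toMetrizableSpace
  exact Topology.IsEmbedding.subtypeVal.metrizableSpace

theorem isPt_zero : IsPt (fun _ : EE m => (0:ℝ)) :=
  ⟨fun _ => le_rfl, fun _ => zero_le_one, fun _ _ h => absurd rfl h, fun _ _ _ h => absurd rfl h⟩

def zeroPt (m : ℕ) : XX m := ⟨fun _ => 0, isPt_zero⟩

/-! ### Connectedness -/

noncomputable def clampf (s : ℝ) (k : ℕ) : ℝ := max 0 (min 1 (s - k))

noncomputable def path (x : XX m) (s : ℝ) : XX m :=
  ⟨fun e => x.1 e * clampf s e.length, by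
    have h0 : ∀ k, 0 ≤ clampf s k := fun k => le_max_left _ _
    have h1 : ∀ k, clampf s k ≤ 1 := fun k => max_le zero_le_one (min_le_left _ _)
    have h2 : ∀ k, clampf s (k+1) ≠ 0 → clampf s k = 1 := by
      intro k hk
      unfold clampf at *
      push_cast at *
      by_contra h
      apply hk
      have : s - k < 1 := by
        by_contra h'
        push Not at h'
        apply h
        rw [min_eq_left h']; simp
      rw [max_eq_left]
      exact (min_le_right _ _).trans (by linarith)
    refine ⟨fun e => mul_nonneg (x.2.nn e) (h0 _), fun e => ?_, fun w a h => ?_, fun w a b h h' => ?_⟩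
    · exact mul_le_one₀ (x.2.le e) (h0 _) (h1 _)
    · have hx := left_ne_zero_of_mul h
      have hc := right_ne_zero_of_mul h
      simp only [List.length_append, List.length_singleton] at hc
      show x.1 w * clampf s w.length = _
      rw [h2 _ hc, mul_one]
      exact x.2.par w a hx
    · exact x.2.ex w a b (left_ne_zero_of_mul h) (left_ne_zero_of_mul h')⟩

theorem continuous_path (x : XX m) : Continuous (path x) := by
  refine Continuous.subtype_mk (continuous_pi fun e => ?_) _
  unfold clampf
  fun_prop

theorem path_zero (x : XX m) : path x 0 = zeroPt m := by
  apply Subtype.ext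
  funext e
  show x.1 e * clampf 0 e.length = 0
  have : clampf 0 e.length = 0 := by
    unfold clampf
    rw [max_eq_left]
    refine (min_le_right _ _).trans ?_
    have : (0:ℝ) ≤ e.length := Nat.cast_nonneg _
    linarith
  rw [this, mul_zero]

theorem tendsto_path (x : XX m) : Filter.Tendsto (path x) Filter.atTop (𝓝 x) := by
  rw [tendsto_subtype_rng, tendsto_pi_nhds]
  intro e
  apply Filter.Tendsto.congr' _ tendsto_const_nhds
  filter_upwards [Filter.eventually_ge_atTop ((e.length : ℝ) + 1)] with s hs
  show x.1 e = x.1 e * clampf s e.length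
  have : clampf s e.length = 1 := by
    unfold clampf
    rw [min_eq_left (by linarith)]; simp
  rw [this, mul_one]

instance instConnX : ConnectedSpace (XX m) := by
  have h : ∀ x : XX m, x ∈ connectedComponent (zeroPt m) := by
    intro x
    have h1 : IsPreconnected (Set.range (path x)) := isPreconnected_range (continuous_path x)
    have h2 := h1.closure
    apply h2.subset_connectedComponent (subset_closure ⟨0, path_zero x⟩)
    exact mem_closure_of_tendsto (tendsto_path x) (Filter.Eventually.of_forall fun s => ⟨s, rfl⟩)
  have : connectedComponent (zeroPt m) = Set.univ := Set.eq_univ_of_forall h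
  have hp : IsPreconnected (Set.univ : Set (XX m)) := this ▸ isPreconnected_connectedComponent
  exact { toPreconnectedSpace := ⟨hp⟩, toNonempty := ⟨zeroPt m⟩ }

/-! ### Medians and convexity -/

def med (a b c : ℝ) : ℝ := max (min a b) (min (max a b) c)

theorem med_eq_of_ne {a b c : ℝ} (ha : 0 ≤ a) (hb : 0 ≤ b) (hc : 0 ≤ c) (h : med a b c ≠ 0) :
    (a ≠ 0 ∧ b ≠ 0) ∨ (a ≠ 0 ∧ c ≠ 0) ∨ (b ≠ 0 ∧ c ≠ 0) := by
  by_contra hcon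
  apply h
  unfold med
  by_cases a0 : a = 0 <;> by_cases b0 : b = 0 <;> by_cases c0 : c = 0 <;> simp_all

theorem med_aab (a c : ℝ) : med a a c = a := by
  unfold med; simp
theorem med_aba (a b : ℝ) : med a b a = a := by
  unfold med
  rcases le_total a b with h | h <;> simp [h]
theorem med_baa (a b : ℝ) : med b a a = a := by
  unfold med
  rcases le_total a b with h | h <;> simp [h]

def medX (x y z : XX m) : XX m :=
  ⟨fun e => med (x.1 e) (y.1 e) (z.1 e), by
    have key : ∀ w a, med (x.1 (w ++ [a])) (y.1 (w ++ [a])) (z.1 (w ++ [a])) ≠ 0 →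
        (x.1 (w ++ [a]) ≠ 0 ∧ y.1 (w ++ [a]) ≠ 0) ∨ (x.1 (w ++ [a]) ≠ 0 ∧ z.1 (w ++ [a]) ≠ 0) ∨
        (y.1 (w ++ [a]) ≠ 0 ∧ z.1 (w ++ [a]) ≠ 0) := fun w a h =>
      med_eq_of_ne (x.2.nn _) (y.2.nn _) (z.2.nn _) h
    refine ⟨fun e => ?_, fun e => ?_, fun w a h => ?_, fun w a b h h' => ?_⟩
    · exact le_max_of_le_left (le_min (x.2.nn e) (y.2.nn e))
    · exact max_le ((min_le_left _ _).trans (x.2.le e))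
        ((min_le_right _ _).trans (z.2.le e))
    · rcases key w a h with ⟨h1, h2⟩ | ⟨h1, h2⟩ | ⟨h1, h2⟩
      · simp only [x.2.par w a h1, y.2.par w a h2, med_aab]
      · simp only [x.2.par w a h1, z.2.par w a h2, med_aba]
      · simp only [y.2.par w a h1, z.2.par w a h2, med_baa]
    · have hx := x.2.ex w a b
      have hy := y.2.ex w a b
      have hz := z.2.ex w a b
      have h1 := key w a h
      have h2 := key w b h'
      tauto⟩

def segX (x y : XX m) : Set (XX m) :=
  {z | ∀ e, min (x.1 e) (y.1 e) ≤ z.1 e ∧ z.1 e ≤ max (x.1 e) (y.1 e)}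

theorem isPreconnected_segX (x y : XX m) : IsPreconnected (segX x y) := by
  have hc : Continuous (medX x y) := by
    refine Continuous.subtype_mk (continuous_pi fun e => ?_) _
    exact continuous_const.max (continuous_const.min (continuous_coord e))
  have : segX x y = Set.range (medX x y) := by
    ext z
    constructor
    · intro hz
      refine ⟨z, Subtype.ext (funext fun e => ?_)⟩
      show med _ _ _ = _
      unfold med
      rw [min_eq_right (hz e).2, max_eq_right (hz e).1]
    · rintro ⟨z, rfl⟩ e
      exact ⟨le_max_left _ _, max_le (min_le_max) (min_le_left _ _)⟩
  rw [this]
  exact isPreconnected_range hc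

def Cvx (S : Set (XX m)) : Prop := ∀ x ∈ S, ∀ y ∈ S, segX x y ⊆ S

theorem Cvx.isPreconnected {S : Set (XX m)} (h : Cvx S) : IsPreconnected S := by
  apply isPreconnected_of_forall_pair
  intro x hx y hy
  refine ⟨segX x y, h x hx y hy, fun e => ⟨min_le_left _ _, le_max_left _ _⟩,
    fun e => ⟨min_le_right _ _, le_max_right _ _⟩, isPreconnected_segX x y⟩

theorem cvx_coord (e : EE m) {J : Set ℝ} (hJ : J.OrdConnected) : Cvx {x : XX m | x.1 e ∈ J} := by
  intro x hx y hy z hz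
  exact hJ.uIcc_subset hx hy ⟨(hz e).1, (hz e).2⟩

theorem cvx_lt (e : EE m) (r : ℝ) : Cvx {x : XX m | x.1 e < r} := cvx_coord e Set.ordConnected_Iio
theorem cvx_gt (e : EE m) (r : ℝ) : Cvx {x : XX m | r < x.1 e} := cvx_coord e Set.ordConnected_Ioi

theorem isOpen_lt' (e : EE m) (r : ℝ) : IsOpen {x : XX m | x.1 e < r} :=
  isOpen_lt (continuous_coord e) continuous_const
theorem isOpen_gt' (e : EE m) (r : ℝ) : IsOpen {x : XX m | r < x.1 e} :=
  isOpen_lt continuous_const (continuous_coord e)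

/-- Basic convex neighbourhoods. -/
def boxN (x : XX m) (F : Finset (EE m)) (ε : ℝ) : Set (XX m) :=
  {y | ∀ e ∈ F, |y.1 e - x.1 e| < ε}

theorem cvx_boxN (x : XX m) (F : Finset (EE m)) (ε : ℝ) : Cvx (boxN x F ε) := by
  intro y hy z hz u hu e he
  have h1 := hy e he
  have h2 := hz e he
  rw [abs_lt] at *
  have h3 := hu e
  rcases le_total (y.1 e) (z.1 e) with h | h
  · rw [min_eq_left h, max_eq_right h] at h3
    constructor <;> linarith
  · rw [min_eq_right h, max_eq_left h] at h3
    constructor <;> linarith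

theorem isOpen_boxN (x : XX m) (F : Finset (EE m)) (ε : ℝ) : IsOpen (boxN x F ε) := by
  have : boxN x F ε = ⋂ e ∈ F, {y : XX m | |y.1 e - x.1 e| < ε} := by
    ext y; simp [boxN]
  rw [this]
  refine isOpen_biInter_finset fun e _ => ?_
  exact isOpen_lt (((continuous_coord e).sub continuous_const).abs) continuous_const

theorem exists_boxN {x : XX m} {U : Set (XX m)} (hU : U ∈ 𝓝 x) :
    ∃ F : Finset (EE m), ∃ ε > 0, boxN x F ε ⊆ U := by
  rw [nhds_subtype_eq_comap, Filter.mem_comap] at hU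
  obtain ⟨t, ht, htU⟩ := hU
  rw [nhds_pi, Filter.mem_pi] at ht
  obtain ⟨I, hI, s, hs, hst⟩ := ht
  have : ∀ e, ∃ ε > 0, Metric.ball (x.1 e) ε ⊆ s e := fun e => Metric.mem_nhds_iff.1 (hs e)
  choose δ hδ hδs using this
  have hε : ∃ ε > 0, ∀ e ∈ hI.toFinset, ε ≤ δ e := by
    by_cases hne : hI.toFinset.Nonempty
    · refine ⟨hI.toFinset.inf' hne δ, ?_, fun e he => Finset.inf'_le _ he⟩
      rw [gt_iff_lt, Finset.lt_inf'_iff]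
      exact fun e _ => hδ e
    · refine ⟨1, one_pos, fun e he => absurd ⟨e, he⟩ hne⟩
  obtain ⟨ε, hε0, hε⟩ := hε
  refine ⟨hI.toFinset, ε, hε0, fun y hy => htU (hst ?_)⟩
  intro e he
  apply hδs e
  rw [Metric.mem_ball, Real.dist_eq]
  exact (hy e (hI.mem_toFinset.2 he)).trans_le (hε e (hI.mem_toFinset.2 he))

theorem mem_boxN (x : XX m) (F : Finset (EE m)) {ε : ℝ} (h : 0 < ε) : x ∈ boxN x F ε := by
  intro e _; simpa using h

instance instLC : LocallyConnectedSpace (XX m) := by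
  rw [locallyConnectedSpace_iff_connected_subsets]
  intro x U hU
  obtain ⟨F, ε, hε, h⟩ := exists_boxN hU
  exact ⟨boxN x F ε, (isOpen_boxN x F ε).mem_nhds (mem_boxN x F hε),
    (cvx_boxN x F ε).isPreconnected, h⟩

end Waz

open Topology
/-! ## Part 2 : branch points and components -/

namespace Waz
variable {m : ℕ}

/-- The shift of a point along a letter. -/
def shift (a : DD × Fin m) (x : XX m) : XX m :=
  ⟨fun e => x.1 (a :: e), ⟨fun _ => x.2.nn _, fun _ => x.2.le _,
    fun w b h => x.2.par (a :: w) b h, fun w b c h h' => x.2.ex (a :: w) b c h h'⟩⟩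

theorem zero_ext (x : XX m) (u v : EE m) (h : x.1 u = 0) : x.1 (u ++ v) = 0 := by
  induction v using List.reverseRecOn with
  | nil => simpa using h
  | append_singleton v a ih =>
    by_contra hne
    rw [← List.append_assoc] at hne
    have := x.2.par _ a hne
    rw [ih] at this
    exact a.1.2.1.ne this

theorem zero_cons (x : XX m) (a : DD × Fin m) (v : EE m) (h : x.1 [a] = 0) : x.1 (a :: v) = 0 :=
  zero_ext x [a] v h

theorem par_nil (x : XX m) {a : DD × Fin m} {v : EE m} (h : x.1 (a :: v) ≠ 0) :
    x.1 [] = a.1 :=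
  x.2.par [] a fun h0 => h (zero_cons x a v h0)

theorem ex_nil (x : XX m) {a b : DD × Fin m} {v w : EE m} (h : x.1 (a :: v) ≠ 0)
    (h' : x.1 (b :: w) ≠ 0) : a = b :=
  x.2.ex [] a b (fun h0 => h (zero_cons x a v h0)) (fun h0 => h' (zero_cons x b w h0))

/-- Two points with the same nonzero coordinate at `w` agree at every word which does not strictly
extend `w`. -/
theorem det (w : EE m) : ∀ (x y : XX m), x.1 w = y.1 w → x.1 w ≠ 0 →
    ∀ v, (¬ ∃ a u, v = w ++ a :: u) → x.1 v = y.1 v := by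
  induction w with
  | nil =>
    intro x y hxy _ v hv
    cases v with
    | nil => exact hxy
    | cons a u => exact absurd ⟨a, u, rfl⟩ hv
  | cons b w ih =>
    intro x y hxy hx v hv
    have hy : y.1 (b :: w) ≠ 0 := hxy ▸ hx
    cases v with
    | nil => rw [par_nil x hx, par_nil y hy]
    | cons a u =>
      by_cases hab : a = b
      · subst hab
        refine ih (shift a x) (shift a y) hxy hx u ?_
        rintro ⟨c, u', rfl⟩
        exact hv ⟨c, u', rfl⟩
      · have h1 : x.1 (a :: u) = 0 := by
          by_contra h; exact hab (ex_nil x h hx)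
        have h2 : y.1 (a :: u) = 0 := by
          by_contra h; exact hab (ex_nil y h hy)
        rw [h1, h2]

theorem eq_of_last {x y : XX m} {w : EE m} (hxy : x.1 w = y.1 w) (h0 : x.1 w ≠ 0)
    (hx : ∀ a, x.1 (w ++ [a]) = 0) (hy : ∀ a, y.1 (w ++ [a]) = 0) : x = y := by
  apply Subtype.ext
  funext v
  by_cases hv : ∃ a u, v = w ++ a :: u
  · obtain ⟨a, u, rfl⟩ := hv
    have e : w ++ a :: u = (w ++ [a]) ++ u := by simp
    rw [e, zero_ext x _ u (hx a), zero_ext y _ u (hy a)]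
  · exact det w x y hxy h0 v hv

open Classical in
/-- Coordinates of branch points. -/
noncomputable def bco : EE m → ℝ → EE m → ℝ
  | [], r, [] => r
  | [], _, _ :: _ => 0
  | a :: _, _, [] => a.1
  | a :: w, r, b :: v => if b = a then bco w r v else 0

theorem bco_isPt (w : EE m) (r : ℝ) (h0 : 0 ≤ r) (h1 : r ≤ 1) : IsPt (bco w r) := by
  induction w with
  | nil =>
    refine ⟨fun e => ?_, fun e => ?_, fun w a h => ?_, fun w a b h h' => ?_⟩
    · cases e <;> simp [bco, h0]
    · cases e <;> simp [bco, h1]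
    · cases w <;> simp [bco] at h
    · cases w <;> simp [bco] at h
  | cons c w ih =>
    refine ⟨fun e => ?_, fun e => ?_, fun v a h => ?_, fun v a b h h' => ?_⟩
    · cases e with
      | nil => exact c.1.2.1.le
      | cons b v => simp only [bco]; split_ifs; exacts [ih.nn v, le_rfl]
    · cases e with
      | nil => exact c.1.2.2.1.le
      | cons b v => simp only [bco]; split_ifs; exacts [ih.le v, zero_le_one]
    · cases v with
      | nil =>
        simp only [List.nil_append, bco] at h ⊢
        split_ifs at h with hac
        · rw [hac]
        · exact absurd rfl h
      | cons b v =>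
        simp only [List.cons_append, bco] at h ⊢
        split_ifs at h ⊢ with hac
        · exact ih.par v a h
        · exact absurd rfl h
    · cases v with
      | nil =>
        simp only [List.nil_append, bco] at h h'
        split_ifs at h h' with h1 h2
        · rw [h1, h2]
        · exact absurd rfl h'
        · exact absurd rfl h
        · exact absurd rfl h
      | cons d v =>
        simp only [List.cons_append, bco] at h h'
        split_ifs at h h' with hac
        · exact ih.ex v a b h h'
        · exact absurd rfl h

/-- The branch point on the spine `w` at parameter `r`. -/
noncomputable def br (w : EE m) (r : DD) : XX m :=
  ⟨bco w r, bco_isPt w r r.2.1.le r.2.2.1.le⟩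

theorem bco_self (w : EE m) (r : ℝ) : bco w r w = r := by
  induction w with
  | nil => rfl
  | cons a w ih => simp [bco, ih]

theorem bco_child (w : EE m) (r : ℝ) (a : DD × Fin m) : bco w r (w ++ [a]) = 0 := by
  induction w with
  | nil => rfl
  | cons b w ih => simp [bco, ih]

theorem br_self (w : EE m) (r : DD) : (br w r).1 w = r := bco_self w r
theorem br_child (w : EE m) (r : DD) (a : DD × Fin m) : (br w r).1 (w ++ [a]) = 0 := bco_child w r a

theorem eq_br {x : XX m} {w : EE m} {r : DD} (h : x.1 w = r) (hx : ∀ i, x.1 (w ++ [(r, i)]) = 0) :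
    x = br w r := by
  refine eq_of_last (h.trans (br_self w r).symm) (by rw [h]; exact r.2.1.ne') ?_ (br_child w r)
  rintro ⟨s, i⟩
  by_cases hs : s = r
  · rw [hs]; exact hx i
  · by_contra hne
    have := x.2.par _ _ hne
    rw [h] at this
    exact hs (Subtype.ext this.symm)

/-- The components of the complement of a branch point. -/
def cmp (w : EE m) (r : DD) : Option (Option (Fin m)) → Set (XX m)
  | none => {x | x.1 w < r}
  | some none => {x | r < x.1 w}
  | some (some i) => {x | 0 < x.1 (w ++ [(r, i)])}

theorem cmp_cvx (w : EE m) (r : DD) (c) : Cvx (cmp w r c) := by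
  rcases c with _ | _ | i
  · exact cvx_lt _ _
  · exact cvx_gt _ _
  · exact cvx_gt _ _

theorem cmp_open (w : EE m) (r : DD) (c) : IsOpen (cmp w r c) := by
  rcases c with _ | _ | i
  · exact isOpen_lt' _ _
  · exact isOpen_gt' _ _
  · exact isOpen_gt' _ _

theorem hang_val {x : XX m} {w : EE m} {r : DD} {i : Fin m} (h : 0 < x.1 (w ++ [(r, i)])) :
    x.1 w = r := x.2.par w (r, i) h.ne'

theorem cmp_disj (w : EE m) (r : DD) {c d} {x : XX m} (hc : x ∈ cmp w r c) (hd : x ∈ cmp w r d) :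
    c = d := by
  rcases c with _ | _ | i <;> rcases d with _ | _ | j
  · rfl
  · have h1 : x.1 w < r := hc
    have h2 : (r : ℝ) < x.1 w := hd
    exact absurd (h1.trans h2) (lt_irrefl _)
  · exact absurd hc (by show ¬ (x.1 w < r); rw [hang_val hd]; exact lt_irrefl _)
  · have h1 : x.1 w < r := hd
    have h2 : (r : ℝ) < x.1 w := hc
    exact absurd (h1.trans h2) (lt_irrefl _)
  · rfl
  · exact absurd hc (by show ¬ (r < x.1 w); rw [hang_val hd]; exact lt_irrefl _)
  · exact absurd hd (by show ¬ (x.1 w < r); rw [hang_val hc]; exact lt_irrefl _)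
  · exact absurd hd (by show ¬ (r < x.1 w); rw [hang_val hc]; exact lt_irrefl _)
  · have := x.2.ex w (r, i) (r, j) (ne_of_gt hc) (ne_of_gt hd)
    have h2 : i = j := (Prod.ext_iff.1 this).2
    rw [h2]

theorem cmp_cover (w : EE m) (r : DD) {x : XX m} (hx : x ≠ br w r) : ∃ c, x ∈ cmp w r c := by
  rcases lt_trichotomy (x.1 w) r with h | h | h
  · exact ⟨none, h⟩
  · by_contra hcon
    push Not at hcon
    apply hx
    refine eq_br h fun i => ?_
    by_contra hne
    exact hcon (some (some i)) (lt_of_le_of_ne (x.2.nn _) (Ne.symm hne))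
  · exact ⟨some none, h⟩

theorem br_not_mem_cmp (w : EE m) (r : DD) (c) : br w r ∉ cmp w r c := by
  rcases c with _ | _ | i
  · exact fun h => absurd h (by show ¬ ((br w r).1 w < r); rw [br_self]; exact lt_irrefl _)
  · exact fun h => absurd h (by show ¬ (r < (br w r).1 w); rw [br_self]; exact lt_irrefl _)
  · exact fun h => absurd h (by show ¬ (0 < (br w r).1 _); rw [br_child]; exact lt_irrefl _)

theorem Dy.add {a b : ℝ} (ha : Dy a) (hb : Dy b) : Dy (a + b) := by
  obtain ⟨k, z, h⟩ := ha
  obtain ⟨l, y, h'⟩ := hb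
  refine ⟨k + l, z * 2 ^ l + y * 2 ^ k, ?_⟩
  push_cast
  rw [← h, ← h', pow_add]; ring

theorem Dy.neg {a : ℝ} (ha : Dy a) : Dy (-a) := by
  obtain ⟨k, z, h⟩ := ha
  exact ⟨k, -z, by push_cast; rw [← h]; ring⟩

theorem Dy.sub {a b : ℝ} (ha : Dy a) (hb : Dy b) : Dy (a - b) := by
  rw [sub_eq_add_neg]; exact ha.add hb.neg

theorem Dy.half {a : ℝ} (ha : Dy a) : Dy (a / 2) := by
  obtain ⟨k, z, h⟩ := ha
  exact ⟨k + 1, z, by rw [← h, pow_succ]; ring⟩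

theorem Dy.dbl {a : ℝ} (ha : Dy a) : Dy (2 * a) := by rw [two_mul]; exact ha.add ha

theorem Dy.one : Dy 1 := ⟨0, 1, by norm_num⟩
theorem Dy.zero : Dy 0 := ⟨0, 0, by norm_num⟩

theorem exists_DD {a b : ℝ} (h : a < b) (ha : a < 1) (hb : 0 < b) :
    ∃ r : DD, a < r ∧ (r : ℝ) < b := by
  have h' : max a 0 < min b 1 := by
    rw [max_lt_iff, lt_min_iff, lt_min_iff]
    exact ⟨⟨h, ha⟩, hb, one_pos⟩
  obtain ⟨k, hk⟩ := exists_pow_lt_of_lt_one (sub_pos.2 h') (by norm_num : (1/2:ℝ) < 1)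
  have h2 : (0:ℝ) < 2 ^ k := by positivity
  have h3 : 1 < (min b 1 - max a 0) * 2 ^ k := by
    rw [div_pow, one_pow, div_lt_iff₀ h2] at hk
    exact hk
  set z : ℤ := ⌊max a 0 * 2 ^ k⌋ + 1
  have h4 : max a 0 * 2 ^ k < z := by
    simp only [z]; push_cast; exact Int.lt_floor_add_one _
  have h5 : (z : ℝ) ≤ max a 0 * 2 ^ k + 1 := by
    simp only [z]; push_cast; linarith [Int.floor_le (max a 0 * 2 ^ k)]
  have h6 : max a 0 < z / 2 ^ k := by rwa [lt_div_iff₀ h2]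
  have h7 : (z : ℝ) / 2 ^ k < min b 1 := by
    rw [div_lt_iff₀ h2]; nlinarith
  refine ⟨⟨z / 2 ^ k, (le_max_right _ _).trans_lt h6, h7.trans_le (min_le_right _ _), k, z, ?_⟩,
    (le_max_left _ _).trans_lt h6, h7.trans_le (min_le_left _ _)⟩
  field_simp

theorem cmp_nonempty (w : EE m) (r : DD) (c) : (cmp w r c).Nonempty := by
  rcases c with _ | _ | i
  · obtain ⟨s, _, hs⟩ := exists_DD r.2.1 one_pos r.2.1
    exact ⟨br w s, by show (br w s).1 w < r; rwa [br_self]⟩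
  · obtain ⟨s, hs, _⟩ := exists_DD r.2.2.1 r.2.2.1 one_pos
    exact ⟨br w s, by show r < (br w s).1 w; rwa [br_self]⟩
  · exact ⟨br (w ++ [(r, i)]) r, by show 0 < (br _ r).1 _; rw [br_self]; exact r.2.1⟩

/-- A finite-type partition into disjoint nonempty open preconnected sets is the partition into
components. -/
theorem components_eq {Y : Type*} [TopologicalSpace Y] {ι : Type*} {S : Set Y} (K : ι → Set Y)
    (hS : ∀ x, x ∈ S ↔ ∃ c, x ∈ K c) (ho : ∀ c, IsOpen (K c)) (hp : ∀ c, IsPreconnected (K c))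
    (hd : ∀ c d x, x ∈ K c → x ∈ K d → c = d) :
    ∀ c, ∀ x ∈ K c, connectedComponentIn S x = K c := by
  intro c x hx
  apply Set.Subset.antisymm
  · have h1 : IsPreconnected (connectedComponentIn S x) := isPreconnected_connectedComponentIn
    have hxS : x ∈ S := (hS x).2 ⟨c, hx⟩
    refine h1.subset_left_of_subset_union (ho c)
      (isOpen_iUnion fun d : {d // d ≠ c} => ho d.1) ?_ ?_ ⟨x, mem_connectedComponentIn hxS, hx⟩
    · rw [Set.disjoint_left]
      intro y hy hy'
      obtain ⟨⟨d, hd'⟩, hyd⟩ := Set.mem_iUnion.1 hy'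
      exact hd' (hd d c y hyd hy)
    · intro y hy
      obtain ⟨d, hyd⟩ := (hS y).1 (connectedComponentIn_subset _ _ hy)
      by_cases hdc : d = c
      · exact Or.inl (hdc ▸ hyd)
      · exact Or.inr (Set.mem_iUnion.2 ⟨⟨d, hdc⟩, hyd⟩)
  · exact (hp c).subset_connectedComponentIn hx fun y hy => (hS y).2 ⟨c, hy⟩

theorem cmp_hS (w : EE m) (r : DD) (x : XX m) : x ∈ ({br w r}ᶜ : Set (XX m)) ↔ ∃ c, x ∈ cmp w r c := by
  constructor
  · exact fun h => cmp_cover w r h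
  · rintro ⟨c, hc⟩ h
    rw [Set.mem_singleton_iff] at h
    exact br_not_mem_cmp w r c (h ▸ hc)

theorem comp_br (w : EE m) (r : DD) (c) {x : XX m} (hx : x ∈ cmp w r c) :
    connectedComponentIn {br w r}ᶜ x = cmp w r c :=
  components_eq (cmp w r) (cmp_hS w r) (cmp_open w r) (fun c => (cmp_cvx w r c).isPreconnected)
    (fun _ _ _ h h' => cmp_disj w r h h') c x hx

theorem setComponents_br (w : EE m) (r : DD) :
    setComponents (XX m) {br w r}ᶜ = Set.range (cmp w r) := by
  ext C
  constructor
  · rintro ⟨x, hx, rfl⟩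
    obtain ⟨c, hc⟩ := (cmp_hS w r x).1 hx
    exact ⟨c, (comp_br w r c hc).symm⟩
  · rintro ⟨c, rfl⟩
    obtain ⟨x, hx⟩ := cmp_nonempty w r c
    exact ⟨x, (cmp_hS w r x).2 ⟨c, hx⟩, (comp_br w r c hx).symm⟩

theorem cmp_inj (w : EE m) (r : DD) : Function.Injective (cmp w r) := by
  intro c d h
  obtain ⟨x, hx⟩ := cmp_nonempty w r c
  exact cmp_disj w r hx (h ▸ hx)

theorem order_br (w : EE m) (r : DD) : ptOrder (XX m) (br w r) = m + 2 := by
  unfold ptOrder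
  rw [setComponents_br, ← Set.image_univ, Set.ncard_image_of_injective _ (cmp_inj w r)]
  simp [Set.ncard_univ]

theorem order_two {p : XX m} {w : EE m} (h0 : p.1 w ≠ 0) (h1 : p.1 w ≠ 1)
    (hD : ∀ r : DD, p.1 w ≠ r) : ptOrder (XX m) p = 2 := by
  let K : Bool → Set (XX m) := fun b => if b then {x | x.1 w < p.1 w} else {x | p.1 w < x.1 w}
  have hpos : 0 < p.1 w := lt_of_le_of_ne (p.2.nn w) h0.symm
  have hlt : p.1 w < 1 := lt_of_le_of_ne (p.2.le w) h1
  have hch : ∀ x : XX m, x.1 w = p.1 w → ∀ a, x.1 (w ++ [a]) = 0 := by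
    intro x hx a
    by_contra hne
    exact hD a.1 (hx.symm.trans (x.2.par w a hne))
  have hS : ∀ x, x ∈ ({p}ᶜ : Set (XX m)) ↔ ∃ c, x ∈ K c := by
    intro x
    constructor
    · intro hx
      rcases lt_trichotomy (x.1 w) (p.1 w) with h | h | h
      · exact ⟨true, h⟩
      · exfalso
        exact hx (eq_of_last h (h ▸ h0) (hch x h) (hch p rfl))
      · exact ⟨false, h⟩
    · rintro ⟨c, hc⟩ hx
      rw [Set.mem_singleton_iff] at hx
      subst hx
      cases c
      · have h : x.1 w < x.1 w := hc
        exact lt_irrefl _ h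
      · have h : x.1 w < x.1 w := hc
        exact lt_irrefl _ h
  have ho : ∀ c, IsOpen (K c) := by
    rintro (_ | _)
    · exact isOpen_gt' _ _
    · exact isOpen_lt' _ _
  have hp : ∀ c, IsPreconnected (K c) := by
    rintro (_ | _)
    · exact (cvx_gt _ _).isPreconnected
    · exact (cvx_lt _ _).isPreconnected
  have hd : ∀ c d x, x ∈ K c → x ∈ K d → c = d := by
    rintro (_ | _) (_ | _) x h h'
    · rfl
    · have h1 : p.1 w < x.1 w := h
      have h2 : x.1 w < p.1 w := h'
      exact absurd (h1.trans h2) (lt_irrefl _)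
    · have h1 : p.1 w < x.1 w := h'
      have h2 : x.1 w < p.1 w := h
      exact absurd (h1.trans h2) (lt_irrefl _)
    · rfl
  have hne : ∀ c, (K c).Nonempty := by
    rintro (_ | _)
    · obtain ⟨s, hs, _⟩ := exists_DD hlt hlt one_pos
      exact ⟨br w s, by show p.1 w < (br w s).1 w; rwa [br_self]⟩
    · obtain ⟨s, _, hs⟩ := exists_DD hpos one_pos hpos
      exact ⟨br w s, by show (br w s).1 w < p.1 w; rwa [br_self]⟩
  have hcomp := components_eq K hS ho hp hd
  have : setComponents (XX m) {p}ᶜ = Set.range K := by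
    ext C
    constructor
    · rintro ⟨x, hx, rfl⟩
      obtain ⟨c, hc⟩ := (hS x).1 hx
      exact ⟨c, (hcomp c x hc).symm⟩
    · rintro ⟨c, rfl⟩
      obtain ⟨x, hx⟩ := hne c
      exact ⟨x, (hS x).2 ⟨c, hx⟩, (hcomp c x hx).symm⟩
  have hinj : Function.Injective K := by
    intro c d h
    obtain ⟨x, hx⟩ := hne c
    exact hd c d x hx (h ▸ hx)
  unfold ptOrder
  rw [this, ← Set.image_univ, Set.ncard_image_of_injective _ hinj]
  simp [Set.ncard_univ]

theorem order_one {p : XX m} (h : ∀ x y, x ≠ p → y ≠ p → p ∉ segX x y) :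
    ptOrder (XX m) p = 1 := by
  have hc : IsPreconnected ({p}ᶜ : Set (XX m)) := by
    apply Cvx.isPreconnected
    intro x hx y hy z hz hzp
    rw [Set.mem_singleton_iff] at hzp
    exact h x y hx hy (hzp ▸ hz)
  have hne : ∃ q : XX m, q ≠ p := by
    obtain ⟨s, _, hs⟩ := exists_DD (zero_lt_one (α := ℝ)) zero_lt_one zero_lt_one
    by_cases hp : p = br [] s
    · refine ⟨zeroPt m, ?_⟩
      rw [hp]
      intro h0
      have : (zeroPt m).1 [] = (br [] s : XX m).1 [] := by rw [h0]
      rw [br_self] at this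
      exact s.2.1.ne this
    · exact ⟨_, Ne.symm hp⟩
  obtain ⟨q, hq⟩ := hne
  unfold ptOrder
  rw [Set.ncard_eq_one]
  refine ⟨{p}ᶜ, ?_⟩
  ext C
  constructor
  · rintro ⟨x, hx, rfl⟩
    exact hc.connectedComponentIn hx
  · rintro rfl
    exact ⟨q, hq, (hc.connectedComponentIn hq).symm⟩

theorem order_cases (p : XX m) :
    ptOrder (XX m) p = 1 ∨ ptOrder (XX m) p = 2 ∨ ∃ w r, p = br w r := by
  by_cases hz : p.1 [] = 0
  · left
    have hp : ∀ e, p.1 e = 0 := fun e => zero_ext p [] e hz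
    have hpos : ∀ x, x ≠ p → 0 < x.1 [] := by
      intro x hx
      refine lt_of_le_of_ne (x.2.nn _) fun h0 => hx ?_
      apply Subtype.ext
      funext e
      rw [hp e]
      exact zero_ext x [] e h0.symm
    apply order_one
    intro x y hx hy hs
    have := (hs []).1
    rw [hz] at this
    exact absurd (lt_min (hpos x hx) (hpos y hy)) (not_lt.2 this)
  by_cases hlast : ∃ w, p.1 w ≠ 0 ∧ ∀ a, p.1 (w ++ [a]) = 0
  · obtain ⟨w, hw, hch⟩ := hlast
    by_cases h1 : p.1 w = 1
    · left
      have hlt : ∀ x, x ≠ p → x.1 w < 1 := by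
        intro x hx
        refine lt_of_le_of_ne (x.2.le w) fun h => hx ?_
        refine eq_of_last (h.trans h1.symm) (by rw [h]; exact one_ne_zero) ?_ hch
        intro a
        by_contra hne
        have := x.2.par w a hne
        rw [h] at this
        exact a.1.2.2.1.ne this.symm
      apply order_one
      intro x y hx hy hs
      have := (hs w).2
      rw [h1] at this
      exact absurd (max_lt (hlt x hx) (hlt y hy)) (not_lt.2 this)
    · right
      by_cases hD : ∀ r : DD, p.1 w ≠ r
      · exact Or.inl (order_two hw h1 hD)
      · right
        push Not at hD
        obtain ⟨r, hr⟩ := hD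
        exact ⟨w, r, eq_br hr fun i => hch _⟩
  · left
    push Not at hlast
    -- every nonzero coordinate has a nonzero child
    have hk : ∀ k : ℕ, ∃ w : EE m, w.length = k ∧ p.1 w ≠ 0 := by
      intro k
      induction k with
      | zero => exact ⟨[], rfl, hz⟩
      | succ k ih =>
        obtain ⟨w, hw, h⟩ := ih
        obtain ⟨a, ha⟩ := hlast w h
        exact ⟨w ++ [a], by simp [hw], ha⟩
    have hx : ∀ x, x ≠ p → ∃ K : ℕ, ∀ w : EE m, K ≤ w.length → p.1 w ≠ 0 → x.1 w = 0 := by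
      intro x hx
      have : ∃ e, x.1 e ≠ p.1 e := by
        by_contra hcon
        push Not at hcon
        exact hx (Subtype.ext (funext hcon))
      obtain ⟨e, he⟩ := this
      refine ⟨e.length + 1, fun w hw hpw => ?_⟩
      by_contra hxw
      apply he
      -- the truncation of `w`
      obtain ⟨u, a, rfl⟩ : ∃ u a, w = u ++ [a] := by
        rcases List.eq_nil_or_concat w with h | ⟨u, a, h⟩
        · rw [h] at hw; simp at hw
        · exact ⟨u, a, by simpa using h⟩
      have h1 := x.2.par u a hxw
      have h2 := p.2.par u a hpw
      refine det u x p (h1.trans h2.symm) (by rw [h1]; exact a.1.2.1.ne') e ?_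
      rintro ⟨b, v, rfl⟩
      simp at hw
    apply order_one
    intro x y hxp hyp hs
    obtain ⟨K, hK⟩ := hx x hxp
    obtain ⟨K', hK'⟩ := hx y hyp
    obtain ⟨w, hw, hpw⟩ := hk (max K K')
    have h1 := hK w (by omega) hpw
    have h2 := hK' w (by omega) hpw
    have := (hs w).2
    rw [h1, h2, max_self] at this
    exact hpw (le_antisymm this (p.2.nn w))

theorem order_iff_br (hm : 1 ≤ m) (p : XX m) :
    ptOrder (XX m) p = m + 2 ↔ ∃ w r, p = br w r := by
  constructor
  · intro h
    rcases order_cases p with h1 | h1 | h1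
    · omega
    · omega
    · exact h1
  · rintro ⟨w, r, rfl⟩
    exact order_br w r

/-- Any preconnected set containing two points separated by the coordinate `e` contains the
branch points in between. -/
theorem mem_of_preconnected {S : Set (XX m)} (hS : IsPreconnected S) {x y : XX m} (hx : x ∈ S)
    (hy : y ∈ S) {e : EE m} {r : DD} (h1 : x.1 e < r) (h2 : (r : ℝ) < y.1 e) : br e r ∈ S := by
  by_contra hn
  have hsub : S ⊆ {br e r}ᶜ := by
    intro z hz hz'
    rw [Set.mem_singleton_iff] at hz'
    exact hn (hz' ▸ hz)
  have h := hS.subset_connectedComponentIn hx hsub hy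
  rw [comp_br e r none (x := x) h1] at h
  exact absurd (lt_trans h h2) (lt_irrefl _)

theorem exists_sep {x y : XX m} (h : x ≠ y) :
    ∃ (e : EE m) (a b : ℝ), a < b ∧ a < 1 ∧ 0 < b ∧
      ((x.1 e = a ∧ y.1 e = b) ∨ (x.1 e = b ∧ y.1 e = a)) := by
  have : ∃ e, x.1 e ≠ y.1 e := by
    by_contra hcon
    push Not at hcon
    exact h (Subtype.ext (funext hcon))
  obtain ⟨e, he⟩ := this
  rcases lt_or_gt_of_ne he with h | h
  · exact ⟨e, _, _, h, h.trans_le (y.2.le e), (x.2.nn e).trans_lt h, Or.inl ⟨rfl, rfl⟩⟩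
  · exact ⟨e, _, _, h, h.trans_le (x.2.le e), (y.2.nn e).trans_lt h, Or.inr ⟨rfl, rfl⟩⟩

theorem exists_br_mem {S : Set (XX m)} (hS : IsPreconnected S) {x y : XX m} (hx : x ∈ S)
    (hy : y ∈ S) (hxy : x ≠ y) : ∃ (e : EE m) (a b : ℝ), a < b ∧ a < 1 ∧ 0 < b ∧
      ∀ r : DD, a < r → (r : ℝ) < b → br e r ∈ S := by
  obtain ⟨e, a, b, h1, h2, h3, h | h⟩ := exists_sep hxy
  · exact ⟨e, a, b, h1, h2, h3, fun r ha hb =>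
      mem_of_preconnected hS hx hy (by rw [h.1]; exact ha) (by rw [h.2]; exact hb)⟩
  · exact ⟨e, a, b, h1, h2, h3, fun r ha hb =>
      mem_of_preconnected hS hy hx (by rw [h.2]; exact ha) (by rw [h.1]; exact hb)⟩

theorem circle_compl (p : Circle) : IsPreconnected ({p}ᶜ : Set Circle) := by
  have : ({p}ᶜ : Set Circle) = (fun t : ℝ => p * Circle.exp t) '' Set.Ioo 0 (2 * Real.pi) := by
    ext q
    constructor
    · intro hq
      obtain ⟨t, ht⟩ : ∃ t : ℝ, Circle.exp t = p⁻¹ * q := ⟨_, Circle.exp_arg _⟩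
      let t' := toIcoMod Real.two_pi_pos 0 t
      have ht' : Circle.exp t' = p⁻¹ * q := by
        rw [← ht]
        have := Circle.periodic_exp
        simp only [t', toIcoMod]
        exact this.sub_zsmul_eq _
      have hmem := toIcoMod_mem_Ico Real.two_pi_pos 0 t
      rw [zero_add] at hmem
      refine ⟨t', ⟨lt_of_le_of_ne hmem.1 fun h0 => ?_, hmem.2⟩, ?_⟩
      · apply hq
        have h0' : t' = 0 := h0.symm
        rw [h0', Circle.exp_zero] at ht'
        rw [Set.mem_singleton_iff]
        exact (inv_mul_eq_one.1 ht'.symm).symm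
      · simp only [ht']; group
    · rintro ⟨t, ht, rfl⟩ h
      rw [Set.mem_singleton_iff, mul_eq_left] at h
      have h2 : Circle.exp t = Circle.exp 0 := by rw [h, Circle.exp_zero]
      rw [Circle.exp_eq_exp] at h2
      obtain ⟨k, hk⟩ := h2
      have hp := Real.pi_pos
      rw [zero_add] at hk
      have h3 : (0:ℝ) < k := by
        by_contra hcon
        push Not at hcon
        have := ht.1
        nlinarith
      have h4 : (k:ℝ) < 1 := by
        have := ht.2
        by_contra hcon
        push Not at hcon
        nlinarith
      norm_cast at h3 h4
      omega
  rw [this]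
  exact isPreconnected_Ioo.image _ (by fun_prop)

theorem no_circle (S : Set (XX m)) : IsEmpty (S ≃ₜ Circle) := by
  constructor
  intro φ
  have hS : IsPreconnected S := by
    have : PreconnectedSpace S := by
      have h := (isPreconnected_univ (α := Circle)).image φ.symm φ.symm.continuous.continuousOn
      rw [Set.image_univ, φ.symm.surjective.range_eq] at h
      exact ⟨h⟩
    exact isPreconnected_iff_preconnectedSpace.2 this
  have hnt : ∃ p q : Circle, p ≠ q := by
    refine ⟨1, Circle.exp Real.pi, fun h => ?_⟩
    have h1 := congrArg (fun z : Circle => (z : ℂ)) h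
    simp only [Circle.coe_one, Circle.coe_exp, Complex.exp_pi_mul_I] at h1
    norm_num at h1
  obtain ⟨p, q, hpq⟩ := hnt
  obtain ⟨e, a, b, h1, h2, h3, h⟩ := exists_sep (x := (φ.symm p).1) (y := (φ.symm q).1)
    (fun h => hpq (φ.symm.injective (Subtype.ext h)))
  obtain ⟨r, hra, hrb⟩ := exists_DD h1 h2 h3
  have hmain : ∀ x ∈ S, ∀ y ∈ S, x.1 e = a → y.1 e = b → False := by
    intro x hx y hy hxa hyb
    have hbr : br e r ∈ S := mem_of_preconnected hS hx hy (by rw [hxa]; exact hra)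
      (by rw [hyb]; exact hrb)
    have hc := ((circle_compl (φ ⟨_, hbr⟩)).image φ.symm φ.symm.continuous.continuousOn).image
      (Subtype.val : S → XX m) continuous_subtype_val.continuousOn
    have hmem : ∀ z (hz : z ∈ S), z ≠ br e r →
        z ∈ Subtype.val '' (φ.symm '' ({φ ⟨_, hbr⟩}ᶜ : Set Circle)) := by
      intro z hz hne
      refine ⟨⟨z, hz⟩, ⟨φ ⟨z, hz⟩, fun h => hne ?_, by simp⟩, rfl⟩
      have := φ.injective h
      exact congrArg Subtype.val this
    have hx' := hmem x hx (fun h => by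
      rw [h, br_self] at hxa; exact hra.ne hxa.symm)
    have hy' := hmem y hy (fun h => by
      rw [h, br_self] at hyb; exact hrb.ne hyb)
    have := mem_of_preconnected hc hx' hy' (by rw [hxa]; exact hra) (by rw [hyb]; exact hrb)
    obtain ⟨z, ⟨t, ht, rfl⟩, hz⟩ := this
    apply ht
    rw [Set.mem_singleton_iff, ← φ.apply_symm_apply t]
    congr 1
    exact Subtype.ext hz
  rcases h with h | h
  · exact hmain _ (φ.symm p).2 _ (φ.symm q).2 h.1 h.2
  · exact hmain _ (φ.symm q).2 _ (φ.symm p).2 h.2 h.1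

theorem isDendrite_X : IsDendrite (XX m) :=
  ⟨⟨zeroPt m⟩, inferInstance, inferInstance, inferInstance, metrizable_X, no_circle⟩

theorem isWazewski_X : IsWazewskiDendrite (m + 2) (XX m) := by
  refine ⟨isDendrite_X, fun p => ?_, ?_⟩
  · rcases order_cases p with h | h | ⟨w, r, rfl⟩
    · exact Or.inl h
    · exact Or.inr (Or.inl h)
    · exact Or.inr (Or.inr (order_br w r))
  · rintro A ⟨φ⟩
    have hA : IsPreconnected A := by
      have : PreconnectedSpace A := by
        have h := (isPreconnected_univ (α := unitInterval)).image φ.symm φ.symm.continuous.continuousOn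
        rw [Set.image_univ, φ.symm.surjective.range_eq] at h
        exact ⟨h⟩
      exact isPreconnected_iff_preconnectedSpace.2 this
    obtain ⟨e, a, b, h1, h2, h3, h⟩ := exists_br_mem hA (φ.symm 0).2 (φ.symm 1).2
      (fun h => zero_ne_one (φ.symm.injective (Subtype.ext h)))
    obtain ⟨r, hra, hrb⟩ := exists_DD h1 h2 h3
    exact ⟨_, h r hra hrb, order_br e r⟩

end Waz

open Topology
/-! ## Part 3 : the basic homeomorphisms -/

namespace Waz
variable {m : ℕ}

/-- Data of an interval homeomorphism preserving dyadics. -/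
structure HD where
  h : ℝ → ℝ
  h' : ℝ → ℝ
  k : DD → DD
  k' : DD → DD
  ch : Continuous h
  ch' : Continuous h'
  mem : ∀ t, 0 ≤ t → t ≤ 1 → 0 ≤ h t ∧ h t ≤ 1
  mem' : ∀ t, 0 ≤ t → t ≤ 1 → 0 ≤ h' t ∧ h' t ≤ 1
  left : ∀ t, 0 ≤ t → t ≤ 1 → h' (h t) = t
  right : ∀ t, 0 ≤ t → t ≤ 1 → h (h' t) = t
  hk : ∀ r, (k r : ℝ) = h r
  hk' : ∀ r, (k' r : ℝ) = h' r

def HD.symm (d : HD) : HD :=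
  ⟨d.h', d.h, d.k', d.k, d.ch', d.ch, d.mem', d.mem, d.right, d.left, d.hk', d.hk⟩

theorem HD.kk' (d : HD) (r : DD) : d.k (d.k' r) = r :=
  Subtype.ext (by rw [d.hk, d.hk', d.right r r.2.1.le r.2.2.1.le])
theorem HD.k'k (d : HD) (r : DD) : d.k' (d.k r) = r := d.symm.kk' r

def hatC (d : HD) (x : EE m → ℝ) : EE m → ℝ
  | [] => d.h (x [])
  | a :: w => x ((d.k' a.1, a.2) :: w)

theorem hatC_isPt (d : HD) (x : XX m) : IsPt (hatC d x.1) := by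
  refine ⟨fun e => ?_, fun e => ?_, fun w a h => ?_, fun w a b h h' => ?_⟩
  · cases e with
    | nil => exact (d.mem _ (x.2.nn _) (x.2.le _)).1
    | cons a w => exact x.2.nn _
  · cases e with
    | nil => exact (d.mem _ (x.2.nn _) (x.2.le _)).2
    | cons a w => exact x.2.le _
  · cases w with
    | nil =>
      have h1 : x.1 [] = d.k' a.1 := par_nil x (a := (d.k' a.1, a.2)) (v := []) h
      show d.h (x.1 []) = _
      rw [h1, ← d.hk, d.kk']
    | cons b w => exact x.2.par ((d.k' b.1, b.2) :: w) a h
  · cases w with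
    | nil =>
      have h1 : ((d.k' a.1, a.2) : DD × Fin m) = (d.k' b.1, b.2) :=
        ex_nil x (v := []) (w := []) h h'
      have h2 : d.k' a.1 = d.k' b.1 := congrArg Prod.fst h1
      have h3 : a.2 = b.2 := (Prod.ext_iff.1 h1).2
      refine Prod.ext ?_ h3
      rw [← d.kk' a.1, h2, d.kk']
    | cons c w => exact x.2.ex ((d.k' c.1, c.2) :: w) a b h h'

def hatX (d : HD) (x : XX m) : XX m := ⟨hatC d x.1, hatC_isPt d x⟩

theorem hatX_continuous (d : HD) : Continuous (hatX (m := m) d) := by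
  refine Continuous.subtype_mk (continuous_pi fun e => ?_) _
  cases e with
  | nil => exact d.ch.comp (continuous_coord [])
  | cons a w => exact continuous_coord _

theorem hatX_left (d : HD) (x : XX m) : hatX d.symm (hatX d x) = x := by
  apply Subtype.ext; funext e
  cases e with
  | nil => exact d.left _ (x.2.nn _) (x.2.le _)
  | cons a w =>
    show x.1 ((d.k' (d.k a.1), a.2) :: w) = _
    rw [d.k'k]

def hat (d : HD) : XX m ≃ₜ XX m where
  toFun := hatX d
  invFun := hatX d.symm
  left_inv := hatX_left d
  right_inv := hatX_left d.symm
  continuous_toFun := hatX_continuous d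
  continuous_invFun := hatX_continuous d.symm

theorem hat_nil (d : HD) (x : XX m) : (hat d x).1 [] = d.h (x.1 []) := rfl
theorem hat_cons (d : HD) (x : XX m) (a w) : (hat d x).1 (a :: w) = x.1 ((d.k' a.1, a.2) :: w) := rfl
theorem hat_inv (d : HD) : (hat d : XX m ≃ₜ XX m)⁻¹ = hat d.symm := rfl

theorem hat_br_nil (d : HD) (s : DD) : hat d (br [] s : XX m) = br [] (d.k s) := by
  apply eq_br
  · rw [hat_nil, br_self, d.hk]
  · intro i
    show (hat d (br [] s : XX m)).1 ((d.k s, i) :: []) = 0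
    rw [hat_cons]
    exact br_child [] s _

theorem hat_br_cons (d : HD) (r : DD) (i : Fin m) (w : EE m) (s : DD) :
    hat d (br ((r, i) :: w) s) = br ((d.k r, i) :: w) s := by
  apply eq_br
  · rw [hat_cons, d.k'k]; exact br_self _ _
  · intro j
    show (hat d (br ((r, i) :: w) s : XX m)).1 ((d.k r, i) :: (w ++ [(s, j)])) = 0
    rw [hat_cons, d.k'k]
    exact br_child ((r, i) :: w) s _

theorem hat_fix (d : HD) {x : XX m} (h : d.h (x.1 []) = x.1 []) : hat d x = x := by
  apply Subtype.ext; funext e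
  cases e with
  | nil => exact h
  | cons a w =>
    rw [hat_cons]
    by_cases ha : x.1 [] = a.1
    · have : d.k' a.1 = a.1 := by
        apply Subtype.ext
        rw [d.hk', ← ha]
        conv_lhs => rw [← h]
        exact d.left _ (x.2.nn _) (x.2.le _)
      rw [this]
    · have h1 : x.1 (a :: w) = 0 := by
        by_contra hne; exact ha (par_nil x hne)
      have h2 : x.1 ((d.k' a.1, a.2) :: w) = 0 := by
        by_contra hne
        have h3 : x.1 [] = d.k' a.1 := par_nil x hne
        apply ha
        rw [← h, h3, ← d.hk, d.kk']
      rw [h1, h2]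

/-! ### piecewise linear maps -/

noncomputable def pl (a l x : ℝ) : ℝ := max x (min (2*x-a) (min (x+l/4) ((x+a+l)/2)))
noncomputable def pl' (a l x : ℝ) : ℝ := min x (max ((x+a)/2) (max (x-l/4) (2*x-a-l)))

theorem pl_out1 {a l x : ℝ} (h : x ≤ a) : pl a l x = x :=
  max_eq_left ((min_le_left _ _).trans (by linarith))
theorem pl_out2 {a l x : ℝ} (h : a + l ≤ x) : pl a l x = x :=
  max_eq_left ((min_le_right _ _).trans ((min_le_right _ _).trans (by linarith)))
theorem pl_1 {a l x : ℝ} (h0 : a ≤ x) (h : x ≤ a + l/4) : pl a l x = 2*x-a := by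
  unfold pl; rw [min_eq_left, max_eq_right]
  · linarith
  · exact le_min (by linarith) (by linarith)
theorem pl_2 {a l x : ℝ} (h0 : a + l/4 ≤ x) (h : x ≤ a + l/2) (hl : 0 ≤ l) : pl a l x = x+l/4 := by
  unfold pl; rw [min_eq_right (b := min _ _), min_eq_left, max_eq_right]
  · linarith
  · linarith
  · exact (min_le_left _ _).trans (by linarith)
theorem pl_3 {a l x : ℝ} (h0 : a + l/2 ≤ x) (h : x ≤ a + l) (hl : 0 ≤ l) : pl a l x = (x+a+l)/2 := by
  unfold pl; rw [min_eq_right (b := min _ _), min_eq_right, max_eq_right]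
  · linarith
  · linarith
  · exact (min_le_right _ _).trans (by linarith)

theorem pl'_out1 {a l x : ℝ} (h : x ≤ a) : pl' a l x = x :=
  min_eq_left (le_max_of_le_left (by linarith))
theorem pl'_out2 {a l x : ℝ} (h : a + l ≤ x) : pl' a l x = x :=
  min_eq_left (le_max_of_le_right (le_max_of_le_right (by linarith)))
theorem pl'_1 {a l x : ℝ} (h0 : a ≤ x) (h : x ≤ a + l/2) : pl' a l x = (x+a)/2 := by
  unfold pl'; rw [max_eq_left, min_eq_right]
  · linarith
  · exact max_le (by linarith) (by linarith)
theorem pl'_2 {a l x : ℝ} (h0 : a + l/2 ≤ x) (h : x ≤ a + 3*l/4) (hl : 0 ≤ l) :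
    pl' a l x = x-l/4 := by
  unfold pl'; rw [max_eq_right (b := max _ _), max_eq_left, min_eq_right]
  · linarith
  · linarith
  · exact le_max_of_le_left (by linarith)
theorem pl'_3 {a l x : ℝ} (h0 : a + 3*l/4 ≤ x) (h : x ≤ a + l) (hl : 0 ≤ l) :
    pl' a l x = 2*x-a-l := by
  unfold pl'; rw [max_eq_right (b := max _ _), max_eq_right, min_eq_right]
  · linarith
  · linarith
  · exact le_max_of_le_right (by linarith)

theorem pl_left {a l : ℝ} (hl : 0 ≤ l) (x : ℝ) : pl' a l (pl a l x) = x := by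
  rcases le_total x a with h | h
  · rw [pl_out1 h, pl'_out1 h]
  rcases le_total x (a + l/4) with h1 | h1
  · rw [pl_1 h h1, pl'_1 (by linarith) (by linarith)]; ring
  rcases le_total x (a + l/2) with h2 | h2
  · rw [pl_2 h1 h2 hl, pl'_2 (by linarith) (by linarith) hl]; ring
  rcases le_total x (a + l) with h3 | h3
  · rw [pl_3 h2 h3 hl, pl'_3 (by linarith) (by linarith) hl]; ring
  · rw [pl_out2 h3, pl'_out2 h3]

theorem pl_right {a l : ℝ} (hl : 0 ≤ l) (x : ℝ) : pl a l (pl' a l x) = x := by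
  rcases le_total x a with h | h
  · rw [pl'_out1 h, pl_out1 h]
  rcases le_total x (a + l/2) with h1 | h1
  · rw [pl'_1 h h1, pl_1 (by linarith) (by linarith)]; ring
  rcases le_total x (a + 3*l/4) with h2 | h2
  · rw [pl'_2 h1 h2 hl, pl_2 (by linarith) (by linarith) hl]; ring
  rcases le_total x (a + l) with h3 | h3
  · rw [pl'_3 h2 h3 hl, pl_3 (by linarith) (by linarith) hl]; ring
  · rw [pl'_out2 h3, pl_out2 h3]

theorem Dy.max {a b : ℝ} (ha : Dy a) (hb : Dy b) : Dy (max a b) := by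
  rcases max_choice a b with h | h <;> rw [h] <;> assumption
theorem Dy.min {a b : ℝ} (ha : Dy a) (hb : Dy b) : Dy (min a b) := by
  rcases min_choice a b with h | h <;> rw [h] <;> assumption

theorem Dy.quarter {a : ℝ} (ha : Dy a) : Dy (a / 4) := by
  have h := ha.half.half
  have : a / 4 = a / 2 / 2 := by ring
  rwa [this]

theorem Dy.pl {a l x : ℝ} (ha : Dy a) (hl : Dy l) (hx : Dy x) : Dy (pl a l x) :=
  hx.max ((hx.dbl.sub ha).min ((hx.add hl.quarter).min ((hx.add ha).add hl).half))
theorem Dy.pl' {a l x : ℝ} (ha : Dy a) (hl : Dy l) (hx : Dy x) : Dy (pl' a l x) :=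
  hx.min ((hx.add ha).half.max ((hx.sub hl.quarter).max ((hx.dbl.sub ha).sub hl)))

/-- Admissible parameters. -/
structure OKp (a l : ℝ) : Prop where
  ha : 0 ≤ a
  hl : 0 < l
  hal : a + l ≤ 1
  da : Dy a
  dl : Dy l

theorem pl_pos {a l x : ℝ} (hx : 0 < x) : 0 < pl a l x := lt_max_of_lt_left hx
theorem pl_lt_one {a l x : ℝ} (H : OKp a l) (hx : x < 1) : pl a l x < 1 := by
  refine max_lt hx (min_lt_of_right_lt (min_lt_of_right_lt ?_))
  linarith [H.hal]
theorem pl'_pos {a l x : ℝ} (H : OKp a l) (hx : 0 < x) : 0 < pl' a l x := by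
  refine lt_min hx (lt_max_of_lt_left ?_)
  linarith [H.ha]
theorem pl'_lt_one {a l x : ℝ} (hx : x < 1) : pl' a l x < 1 := min_lt_of_left_lt hx

noncomputable def plD {a l : ℝ} (H : OKp a l) : HD where
  h := pl a l
  h' := pl' a l
  k r := ⟨pl a l r, pl_pos r.2.1, pl_lt_one H r.2.2.1, Dy.pl H.da H.dl r.2.2.2⟩
  k' r := ⟨pl' a l r, pl'_pos H r.2.1, pl'_lt_one r.2.2.1, Dy.pl' H.da H.dl r.2.2.2⟩
  ch := by unfold pl; fun_prop
  ch' := by unfold pl'; fun_prop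
  mem t h0 h1 := ⟨le_max_of_le_left h0, max_le h1 ((min_le_right _ _).trans ((min_le_right _ _).trans
    (by linarith [H.hal])))⟩
  mem' t h0 h1 := ⟨le_min h0 (le_max_of_le_left (by linarith [H.ha])), (min_le_left _ _).trans h1⟩
  left t _ _ := pl_left H.hl.le t
  right t _ _ := pl_right H.hl.le t
  hk _ := rfl
  hk' _ := rfl

theorem pl_mono (a l : ℝ) : Monotone (pl a l) := by
  intro x y h
  unfold pl
  gcongr

theorem pl'_mono (a l : ℝ) : Monotone (pl' a l) := by
  intro x y h
  unfold pl'
  gcongr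

/-- The reflection. -/
noncomputable def flD : HD where
  h t := 1 - t
  h' t := 1 - t
  k r := ⟨1 - r, by linarith [r.2.2.1], by linarith [r.2.1], Dy.one.sub r.2.2.2⟩
  k' r := ⟨1 - r, by linarith [r.2.2.1], by linarith [r.2.1], Dy.one.sub r.2.2.2⟩
  ch := by fun_prop
  ch' := by fun_prop
  mem t h0 h1 := ⟨by linarith, by linarith⟩
  mem' t h0 h1 := ⟨by linarith, by linarith⟩
  left t _ _ := by ring
  right t _ _ := by ring
  hk _ := rfl
  hk' _ := rfl

/-! ### the swap -/

theorem Dy.of_half {a : ℝ} (h : Dy (a/2)) : Dy a := by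
  have := h.dbl
  have e : a = 2 * (a/2) := by ring
  rwa [e]

/-- one half -/
noncomputable def hf : DD := ⟨1/2, by norm_num, by norm_num, Dy.one.half⟩

noncomputable def upD (s : DD) : DD :=
  ⟨(1+s)/2, by linarith [s.2.1], by linarith [s.2.2.1], (Dy.one.add s.2.2.2).half⟩

noncomputable def dnD (s : DD) (h : hf < s) : DD :=
  ⟨2*s-1, by have h : (1/2:ℝ) < s := h
             linarith, by linarith [s.2.2.1], s.2.2.2.dbl.sub Dy.one⟩

theorem hf_lt_upD (s : DD) : hf < upD s := by
  show (1/2:ℝ) < (1+s)/2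
  linarith [s.2.1]

theorem dn_up (s : DD) (h) : dnD (upD s) h = s := by
  apply Subtype.ext; show 2*((1+(s:ℝ))/2)-1 = s; ring

theorem up_dn (s : DD) (h) : upD (dnD s h) = s := by
  apply Subtype.ext; show (1+(2*(s:ℝ)-1))/2 = s; ring

theorem upD_inj {s t : DD} (h : upD s = upD t) : s = t := by
  have : (1+(s:ℝ))/2 = (1+t)/2 := congrArg Subtype.val h
  exact Subtype.ext (by linarith)

open Classical in
noncomputable def sgC (i : Fin m) (x : EE m → ℝ) : EE m → ℝ
  | [] => min (x []) (1/2) + x [(hf, i)] / 2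
  | [a] => if a = (hf, i) then max (2 * x [] - 1) 0 else
      if h : hf < a.1 then x ((hf, i) :: [(dnD a.1 h, a.2)]) else x [a]
  | a :: b :: w => if a = (hf, i) then x ((upD b.1, b.2) :: w) else
      if h : hf < a.1 then x ((hf, i) :: (dnD a.1 h, a.2) :: b :: w) else x (a :: b :: w)

theorem sgC_nil (i : Fin m) (x : EE m → ℝ) :
    sgC i x [] = min (x []) (1/2) + x [(hf, i)] / 2 := rfl
theorem sgC_one (i : Fin m) (x : EE m → ℝ) : sgC i x [(hf, i)] = max (2 * x [] - 1) 0 := by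
  simp [sgC]
theorem sgC_two (i : Fin m) (x : EE m → ℝ) (b w) :
    sgC i x ((hf, i) :: b :: w) = x ((upD b.1, b.2) :: w) := by
  simp [sgC]
theorem sgC_up (i : Fin m) (x : EE m → ℝ) (a : DD × Fin m) (w) (h : hf < a.1) :
    sgC i x (a :: w) = x ((hf, i) :: (dnD a.1 h, a.2) :: w) := by
  have h2 : a ≠ (hf, i) := by rintro rfl; exact lt_irrefl _ h
  cases w <;> simp [sgC, h, h2]
theorem sgC_oth (i : Fin m) (x : EE m → ℝ) (a : DD × Fin m) (w) (h : ¬ hf < a.1)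
    (h2 : a ≠ (hf, i)) : sgC i x (a :: w) = x (a :: w) := by
  cases w <;> simp [sgC, h, h2]

theorem sgC_fix (i : Fin m) (x : XX m) (h1 : x.1 [] ≤ 1/2) (h2 : x.1 [(hf, i)] = 0) :
    sgC i x.1 = x.1 := by
  funext e
  cases e with
  | nil => rw [sgC_nil, h2, min_eq_left h1]; ring
  | cons a w =>
    by_cases ha : a = (hf, i)
    · subst ha
      cases w with
      | nil => rw [sgC_one, h2]; exact max_eq_right (by linarith)
      | cons b w =>
        rw [sgC_two, zero_cons x _ _ h2]
        by_contra hne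
        have h3 : x.1 [] = upD b.1 := par_nil x hne
        have h4 : (1/2:ℝ) < upD b.1 := hf_lt_upD b.1
        linarith
    · by_cases h : hf < a.1
      · rw [sgC_up i x.1 a w h, zero_cons x _ _ h2]
        by_contra hne
        have h3 : x.1 [] = a.1 := par_nil x (Ne.symm hne)
        have h4 : (1/2:ℝ) < a.1 := h
        linarith
      · exact sgC_oth i x.1 a w h ha

theorem sgC_isPt (i : Fin m) (x : XX m) : IsPt (sgC i x.1) := by
  by_cases hB : x.1 [(hf, i)] = 0
  swap
  · have hx : x.1 [] = 1/2 := par_nil x hB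
    have e0 : sgC i x.1 [] = 1/2 + x.1 [(hf, i)] / 2 := by rw [sgC_nil, hx, min_self]
    have e1 : ∀ a w, ¬ hf < a.1 → sgC i x.1 (a :: w) = 0 := by
      intro a w h
      by_cases ha : a = (hf, i)
      · subst ha
        cases w with
        | nil => rw [sgC_one, hx]; norm_num
        | cons b w =>
          rw [sgC_two]
          by_contra hne
          have h3 : x.1 [] = upD b.1 := par_nil x hne
          have h4 : (1/2:ℝ) < upD b.1 := hf_lt_upD b.1
          linarith
      · rw [sgC_oth i x.1 a w h ha]
        by_contra hne
        exact ha (ex_nil x hne hB)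
    have e2 : ∀ a w (h : hf < a.1), sgC i x.1 (a :: w) = x.1 ((hf, i) :: (dnD a.1 h, a.2) :: w) :=
      fun a w h => sgC_up i x.1 a w h
    have hp := x.2.nn [(hf, i)]
    have hp' := x.2.le [(hf, i)]
    refine ⟨fun e => ?_, fun e => ?_, fun w a h => ?_, fun w a b h h' => ?_⟩
    · cases e with
      | nil => rw [e0]; linarith
      | cons a w =>
        by_cases ha : hf < a.1
        · rw [e2 a w ha]; exact x.2.nn _
        · rw [e1 a w ha]
    · cases e with
      | nil => rw [e0]; linarith
      | cons a w =>
        by_cases ha : hf < a.1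
        · rw [e2 a w ha]; exact x.2.le _
        · rw [e1 a w ha]; exact zero_le_one
    · cases w with
      | nil =>
        rw [List.nil_append] at h
        by_cases ha : hf < a.1
        · rw [e2 a [] ha] at h
          have := x.2.par [(hf, i)] _ h
          rw [e0, this]
          show 1/2 + (2 * (a.1 : ℝ) - 1) / 2 = a.1
          ring
        · exact absurd (e1 a [] ha) h
      | cons b w =>
        rw [List.cons_append] at h
        by_cases ha : hf < b.1
        · rw [e2 b _ ha] at h
          rw [e2 b _ ha]
          exact x.2.par ((hf, i) :: (dnD b.1 ha, b.2) :: w) a h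
        · exact absurd (e1 b _ ha) h
    · cases w with
      | nil =>
        rw [List.nil_append] at h h'
        by_cases ha : hf < a.1
        · by_cases hb : hf < b.1
          · rw [e2 a [] ha] at h
            rw [e2 b [] hb] at h'
            have := x.2.ex [(hf, i)] _ _ h h'
            have h3 : dnD a.1 ha = dnD b.1 hb := congrArg Prod.fst this
            have h4 : a.2 = b.2 := (Prod.ext_iff.1 this).2
            refine Prod.ext ?_ h4
            rw [← up_dn a.1 ha, h3, up_dn]
          · exact absurd (e1 b [] hb) h'
        · exact absurd (e1 a [] ha) h
      | cons c w =>
        rw [List.cons_append] at h h'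
        by_cases ha : hf < c.1
        · rw [e2 c _ ha] at h h'
          exact x.2.ex ((hf, i) :: (dnD c.1 ha, c.2) :: w) a b h h'
        · exact absurd (e1 c _ ha) h
  · by_cases hC : x.1 [] ≤ 1/2
    · rw [sgC_fix i x hC hB]; exact x.2
    · push Not at hC
      have e0 : sgC i x.1 [] = 1/2 := by rw [sgC_nil, hB, min_eq_right hC.le]; ring
      have e1 : sgC i x.1 [(hf, i)] = 2 * x.1 [] - 1 := by
        rw [sgC_one, max_eq_left]; linarith
      have e2 := sgC_two i x.1
      have e3 : ∀ a w, a ≠ (hf, i) → sgC i x.1 (a :: w) = 0 := by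
        intro a w ha
        by_cases h : hf < a.1
        · rw [sgC_up i x.1 a w h]; exact zero_cons x _ _ hB
        · rw [sgC_oth i x.1 a w h ha]
          by_contra hne
          have h1 : x.1 [] = a.1 := par_nil x hne
          apply h
          show (1/2:ℝ) < a.1
          linarith
      have hx1 := x.2.le []
      refine ⟨fun e => ?_, fun e => ?_, fun w a h => ?_, fun w a b h h' => ?_⟩
      · rcases e with _ | ⟨a, w⟩
        · rw [e0]; norm_num
        · by_cases ha : a = (hf, i)
          · subst ha
            rcases w with _ | ⟨b, w⟩
            · rw [e1]; linarith
            · rw [e2]; exact x.2.nn _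
          · rw [e3 a w ha]
      · rcases e with _ | ⟨a, w⟩
        · rw [e0]; norm_num
        · by_cases ha : a = (hf, i)
          · subst ha
            rcases w with _ | ⟨b, w⟩
            · rw [e1]; linarith
            · rw [e2]; exact x.2.le _
          · rw [e3 a w ha]; exact zero_le_one
      · rcases w with _ | ⟨c, w⟩
        · rw [List.nil_append] at h
          by_cases ha : a = (hf, i)
          · subst ha; exact e0
          · exact absurd (e3 a _ ha) h
        · rw [List.cons_append] at h
          by_cases hc : c = (hf, i)
          · subst hc
            rcases w with _ | ⟨b, w⟩
            · rw [List.nil_append, e2] at h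
              have h1 : x.1 [] = upD a.1 := par_nil x h
              rw [e1, h1]
              show 2 * ((1 + (a.1 : ℝ)) / 2) - 1 = a.1
              ring
            · rw [List.cons_append, e2] at h
              rw [e2]
              exact x.2.par ((upD b.1, b.2) :: w) a h
          · exact absurd (e3 c _ hc) h
      · rcases w with _ | ⟨c, w⟩
        · rw [List.nil_append] at h h'
          by_cases ha : a = (hf, i)
          · by_cases hb : b = (hf, i)
            · rw [ha, hb]
            · exact absurd (e3 b _ hb) h'
          · exact absurd (e3 a _ ha) h
        · rw [List.cons_append] at h h'
          by_cases hc : c = (hf, i)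
          · subst hc
            rcases w with _ | ⟨d, w⟩
            · rw [List.nil_append, e2] at h h'
              have := ex_nil x h h'
              have h3 : upD a.1 = upD b.1 := congrArg Prod.fst this
              have h4 : a.2 = b.2 := (Prod.ext_iff.1 this).2
              exact Prod.ext (upD_inj h3) h4
            · rw [List.cons_append, e2] at h h'
              exact x.2.ex ((upD d.1, d.2) :: w) a b h h'
          · exact absurd (e3 c _ hc) h

noncomputable def sgX (i : Fin m) (x : XX m) : XX m := ⟨sgC i x.1, sgC_isPt i x⟩

theorem sgX_continuous (i : Fin m) : Continuous (sgX i) := by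
  refine Continuous.subtype_mk (continuous_pi fun e => ?_) _
  rcases e with _ | ⟨a, w⟩
  · exact ((continuous_coord []).min continuous_const).add ((continuous_coord _).div_const 2)
  · by_cases ha : a = (hf, i)
    · subst ha
      rcases w with _ | ⟨b, w⟩
      · simp only [sgC_one]
        exact ((continuous_const.mul (continuous_coord [])).sub continuous_const).max continuous_const
      · simp only [sgC_two]
        exact continuous_coord _
    · by_cases h : hf < a.1
      · simp only [sgC_up i _ a w h]; exact continuous_coord _
      · simp only [sgC_oth i _ a w h ha]; exact continuous_coord _

theorem sgX_invol (i : Fin m) (x : XX m) : sgX i (sgX i x) = x := by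
  apply Subtype.ext; funext e
  show sgC i (sgC i x.1) e = x.1 e
  have hnn := x.2.nn [(hf, i)]
  have hpar : x.1 [(hf, i)] ≠ 0 → x.1 [] = 1/2 := fun h => par_nil x h
  rcases e with _ | ⟨a, w⟩
  · rw [sgC_nil, sgC_nil, sgC_one]
    by_cases hB : x.1 [(hf, i)] = 0
    · rw [hB]
      rcases le_total (x.1 []) (1/2) with h | h
      · rw [min_eq_left h, max_eq_right (by linarith), min_eq_left (by linarith)]; ring
      · rw [min_eq_right h, max_eq_left (by linarith), min_eq_left (by linarith)]; ring
    · rw [hpar hB, min_self, min_eq_right (by linarith)]; norm_num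
  · by_cases ha : a = (hf, i)
    · subst ha
      rcases w with _ | ⟨b, w⟩
      · rw [sgC_one, sgC_nil]
        by_cases hB : x.1 [(hf, i)] = 0
        · rw [hB]
          apply max_eq_right
          linarith [min_le_right (x.1 []) (1/2)]
        · rw [hpar hB, min_self, max_eq_left (by linarith)]; ring
      · rw [sgC_two, sgC_up i _ _ w (hf_lt_upD b.1)]
        simp only [dn_up]
    · by_cases h : hf < a.1
      · rw [sgC_up i _ a w h, sgC_two]; simp only [up_dn]
      · rw [sgC_oth i _ a w h ha, sgC_oth i _ a w h ha]

noncomputable def sg (i : Fin m) : XX m ≃ₜ XX m where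
  toFun := sgX i
  invFun := sgX i
  left_inv := sgX_invol i
  right_inv := sgX_invol i
  continuous_toFun := sgX_continuous i
  continuous_invFun := sgX_continuous i

theorem sg_val (i : Fin m) (x : XX m) (e) : (sg i x).1 e = sgC i x.1 e := rfl
theorem sg_invol (i : Fin m) (x : XX m) : sg i (sg i x) = x := sgX_invol i x
theorem sg_inv (i : Fin m) : (sg i)⁻¹ = sg i := rfl

theorem sg_fix (i : Fin m) (x : XX m) (h1 : x.1 [] ≤ 1/2) (h2 : x.1 [(hf, i)] = 0) :
    sg i x = x := Subtype.ext (sgC_fix i x h1 h2)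

theorem sg_br_two (i : Fin m) (b : DD × Fin m) (w : EE m) (r : DD) :
    sg i (br ((hf, i) :: b :: w) r) = br ((upD b.1, b.2) :: w) r := by
  have key : ∀ v, (sg i (br ((hf, i) :: b :: w) r)).1 ((upD b.1, b.2) :: v) =
      (br ((hf, i) :: b :: w) r).1 ((hf, i) :: b :: v) := by
    intro v
    rw [sg_val, sgC_up i _ _ v (hf_lt_upD b.1)]; simp only [dn_up]
  apply eq_br
  · rw [key, br_self]
  · intro j
    rw [List.cons_append, key]
    exact br_child ((hf, i) :: b :: w) r _

theorem sg_br_one (i : Fin m) (r : DD) : sg i (br [(hf, i)] r) = br [] (upD r) := by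
  apply eq_br
  · have h1 : (br [(hf, i)] r : XX m).1 [] = 1/2 := rfl
    rw [sg_val, sgC_nil, h1, br_self, min_self]
    show 1/2 + (r:ℝ)/2 = (1+r)/2
    ring
  · intro j
    rw [List.nil_append, sg_val, sgC_up i _ _ [] (hf_lt_upD r)]; simp only [dn_up]
    exact br_child [(hf, i)] r _

end Waz

open Topology
/-! ## Part 4 : generic facts on cells, the group `G` and transitivity -/

namespace Waz
variable {m : ℕ}

abbrev HX (m : ℕ) := XX m ≃ₜ XX m

theorem hmul (f g : HX m) (x : XX m) : (f * g) x = f (g x) := rfl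
theorem hone (x : XX m) : (1 : HX m) x = x := rfl
theorem hinvl (f : HX m) (x : XX m) : f⁻¹ (f x) = x := f.symm_apply_apply x
theorem hinvr (f : HX m) (x : XX m) : f (f⁻¹ x) = x := f.apply_symm_apply x

/-- component of the complement of a point -/
def comp (t x : XX m) : Set (XX m) := connectedComponentIn {t}ᶜ x

theorem comp_image (g : HX m) {t x : XX m} (h : x ≠ t) : g '' comp t x = comp (g t) (g x) := by
  unfold comp
  rw [g.image_connectedComponentIn (show x ∈ ({t}ᶜ : Set (XX m)) from h)]
  congr 1
  rw [Set.image_compl_eq g.bijective, Set.image_singleton]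

theorem mem_comp_self {t x : XX m} (h : x ≠ t) : x ∈ comp t x :=
  mem_connectedComponentIn (show x ∈ ({t}ᶜ : Set (XX m)) from h)

theorem mem_comp_image (g : HX m) {t x y : XX m} (h : x ≠ t) : g y ∈ comp (g t) (g x) ↔ y ∈ comp t x := by
  rw [← comp_image g h]
  exact g.injective.mem_set_image

theorem comp_br' (w : EE m) (r : DD) (c) {x : XX m} (hx : x ∈ cmp w r c) :
    comp (br w r) x = cmp w r c := comp_br w r c hx

theorem not_mem_comp (t x : XX m) : t ∉ comp t x := fun h =>
  (connectedComponentIn_subset _ _ h) rfl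

theorem comp_eq {t x y : XX m} (h : y ∈ comp t x) : comp t y = comp t x :=
  (connectedComponentIn_eq h).symm

theorem comp_preconn (t x : XX m) : IsPreconnected (comp t x) := isPreconnected_connectedComponentIn

theorem subset_comp {t x : XX m} {S : Set (XX m)} (hS : IsPreconnected S) (hx : x ∈ S) (ht : t ∉ S) :
    S ⊆ comp t x :=
  hS.subset_connectedComponentIn hx fun y hy => by
    intro h
    rw [Set.mem_singleton_iff] at h
    exact ht (h ▸ hy)

def isB (p : XX m) : Prop := ∃ w r, p = br w r

theorem isB_br (w : EE m) (r : DD) : isB (br w r) := ⟨w, r, rfl⟩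

theorem ptOrder_image (g : HX m) (p : XX m) : ptOrder (XX m) (g p) = ptOrder (XX m) p := by
  unfold ptOrder
  have : setComponents (XX m) {g p}ᶜ = (fun C : Set (XX m) => g '' C) '' setComponents (XX m) {p}ᶜ := by
    ext C
    constructor
    · rintro ⟨x, hx, rfl⟩
      have hx' : g⁻¹ x ≠ p := fun h => hx (by rw [← h]; exact (hinvr g x).symm)
      refine ⟨comp p (g⁻¹ x), ⟨g⁻¹ x, hx', rfl⟩, ?_⟩
      show g '' comp p (g⁻¹ x) = _
      rw [comp_image g hx', hinvr]; rfl
    · rintro ⟨D, ⟨x, hx, rfl⟩, rfl⟩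
      exact ⟨g x, fun h => hx (g.injective h), comp_image g hx⟩
  rw [this, Set.ncard_image_of_injective _ g.injective.image_injective]

theorem isB_image (hm : 1 ≤ m) (g : HX m) {p : XX m} (h : isB p) : isB (g p) := by
  obtain ⟨w, r, rfl⟩ := h
  exact (order_iff_br hm _).1 ((ptOrder_image g _).trans (order_br w r))

theorem isB_image_iff (hm : 1 ≤ m) (g : HX m) {p : XX m} : isB (g p) ↔ isB p :=
  ⟨fun h => by have := isB_image hm g⁻¹ h; rwa [hinvl] at this, isB_image hm g⟩

/-- `C` is a cell at `t`. -/
def Cell (t : XX m) (C : Set (XX m)) : Prop := isB t ∧ ∃ x, x ≠ t ∧ C = comp t x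

theorem cell_iff {w : EE m} {r : DD} {C : Set (XX m)} : Cell (br w r) C ↔ ∃ c, C = cmp w r c := by
  constructor
  · rintro ⟨_, x, hx, rfl⟩
    obtain ⟨c, hc⟩ := cmp_cover w r hx
    exact ⟨c, comp_br' w r c hc⟩
  · rintro ⟨c, rfl⟩
    obtain ⟨x, hx⟩ := cmp_nonempty w r c
    exact ⟨isB_br w r, x, (cmp_hS w r x).2 ⟨c, hx⟩, (comp_br' w r c hx).symm⟩

theorem cell_cmp (w : EE m) (r : DD) (c) : Cell (br w r) (cmp w r c) := cell_iff.2 ⟨c, rfl⟩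

theorem Cell.image (hm : 1 ≤ m) (g : HX m) {t : XX m} {C} (h : Cell t C) : Cell (g t) (g '' C) := by
  obtain ⟨hb, x, hx, rfl⟩ := h
  exact ⟨isB_image hm g hb, g x, fun h => hx (g.injective h), comp_image g hx⟩

theorem Cell.isOpen {t : XX m} {C} (h : Cell t C) : IsOpen C := by
  obtain ⟨⟨w, r, rfl⟩, _⟩ := id h
  obtain ⟨c, rfl⟩ := cell_iff.1 h
  exact cmp_open w r c

theorem Cell.not_mem {t : XX m} {C} (h : Cell t C) : t ∉ C := by
  obtain ⟨_, x, hx, rfl⟩ := h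
  exact not_mem_comp t x

theorem Cell.nonempty {t : XX m} {C} (h : Cell t C) : C.Nonempty := by
  obtain ⟨_, x, hx, rfl⟩ := h
  exact ⟨x, mem_comp_self hx⟩

theorem Cell.preconn {t : XX m} {C} (h : Cell t C) : IsPreconnected C := by
  obtain ⟨_, x, hx, rfl⟩ := h
  exact comp_preconn t x

theorem Cell.eq_comp {t x : XX m} {C} (h : Cell t C) (hx : x ∈ C) : C = comp t x := by
  obtain ⟨_, y, hy, rfl⟩ := h
  exact (comp_eq hx).symm

theorem Cell.eq_or_disj {t : XX m} {C D} (h : Cell t C) (h' : Cell t D) : C = D ∨ Disjoint C D := by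
  by_cases hd : Disjoint C D
  · exact Or.inr hd
  · rw [Set.not_disjoint_iff] at hd
    obtain ⟨x, hx, hx'⟩ := hd
    exact Or.inl ((h.eq_comp hx).trans (h'.eq_comp hx').symm)

theorem cell_comp {t x : XX m} (ht : isB t) (hx : x ≠ t) : Cell t (comp t x) := ⟨ht, x, hx, rfl⟩

theorem Cell.mem_closure {t : XX m} {C} (h : Cell t C) : t ∈ closure C := by
  by_contra hn
  have hcl : IsClosed C := by
    rw [← closure_subset_iff_isClosed]
    intro y hy
    by_contra hyC
    have hyt : y ≠ t := fun e => hn (e ▸ hy)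
    have hc := cell_comp h.1 hyt
    rcases h.eq_or_disj hc with e | e
    · exact hyC (e ▸ mem_comp_self hyt)
    · obtain ⟨z, hz, hz'⟩ := mem_closure_iff.1 hy _ hc.isOpen (mem_comp_self hyt)
      exact Set.disjoint_left.1 e hz' hz
  have := IsClopen.eq_univ ⟨hcl, h.isOpen⟩ h.nonempty
  exact h.not_mem (this ▸ Set.mem_univ t)

/-- A cell not containing `q` lies in one component of the complement of `q`. -/
theorem Cell.subset {p q : XX m} {U} (h : Cell p U) (hq : q ∉ U) (hpq : q ≠ p) : U ⊆ comp q p := by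
  have h1 : IsPreconnected (insert p U) :=
    h.preconn.subset_closure (Set.subset_insert _ _)
      (Set.insert_subset h.mem_closure subset_closure)
  have h2 := subset_comp h1 (Set.mem_insert p U) (t := q) (by
    rintro (h3 | h3)
    · exact hpq h3
    · exact hq h3)
  exact (Set.subset_insert _ _).trans h2

/-! ### stabilisers -/

/-- homeomorphisms fixing `t` and every component at `t` -/
def Fix (t : XX m) : Subgroup (HX m) where
  carrier := {k | k t = t ∧ ∀ x, x ≠ t → k x ∈ comp t x}
  one_mem' := ⟨rfl, fun x hx => mem_comp_self hx⟩
  mul_mem' := by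
    rintro f g ⟨hf, hf'⟩ ⟨hg, hg'⟩
    refine ⟨by rw [hmul, hg, hf], fun x hx => ?_⟩
    have h1 : g x ≠ t := fun h => hx (g.injective (h.trans hg.symm))
    have := hf' (g x) h1
    rw [comp_eq (hg' x hx)] at this
    exact this
  inv_mem' := by
    rintro f ⟨hf, hf'⟩
    have h0 : f⁻¹ t = t := by
      conv_lhs => rw [← hf]
      exact hinvl f t
    refine ⟨h0, fun x hx => ?_⟩
    have h1 : f⁻¹ x ≠ t := fun h => hx (by rw [← hinvr f x, h, hf])
    have := hf' _ h1
    rw [hinvr] at this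
    rw [comp_eq this]
    exact mem_comp_self h1

theorem mem_Fix {t : XX m} {k : HX m} : k ∈ Fix t ↔ k t = t ∧ ∀ x, x ≠ t → k x ∈ comp t x := Iff.rfl

theorem Fix_conj {t : XX m} {k : HX m} (g : HX m) (h : k ∈ Fix t) : g * k * g⁻¹ ∈ Fix (g t) := by
  obtain ⟨h1, h2⟩ := h
  refine ⟨by simp only [hmul, hinvl, h1], fun x hx => ?_⟩
  have hx' : g⁻¹ x ≠ t := fun h => hx (by rw [← h, hinvr])
  have := (mem_comp_image g hx').2 (h2 _ hx')
  rwa [hinvr] at this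

theorem Fix_br {w : EE m} {r : DD} {k : HX m} (h0 : k (br w r) = br w r)
    (h : ∀ c, ∀ x ∈ cmp w r c, k x ∈ cmp w r c) : k ∈ Fix (br w r) := by
  refine ⟨h0, fun x hx => ?_⟩
  obtain ⟨c, hc⟩ := cmp_cover w r hx
  rw [comp_br' w r c hc]
  exact h c x hc

/-- elements of `K` supported in `C` -/
def rist (K : Subgroup (HX m)) (C : Set (XX m)) : Subgroup (HX m) where
  carrier := {g | g ∈ K ∧ ∀ x, x ∉ C → g x = x}
  one_mem' := ⟨K.one_mem, fun _ _ => rfl⟩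
  mul_mem' := by
    rintro f g ⟨hf, hf'⟩ ⟨hg, hg'⟩
    exact ⟨K.mul_mem hf hg, fun x hx => by rw [hmul, hg' x hx, hf' x hx]⟩
  inv_mem' := by
    rintro f ⟨hf, hf'⟩
    refine ⟨K.inv_mem hf, fun x hx => ?_⟩
    conv_lhs => rw [← hf' x hx]
    exact hinvl f x

theorem mem_rist {K : Subgroup (HX m)} {C} {g : HX m} : g ∈ rist K C ↔ g ∈ K ∧ ∀ x, x ∉ C → g x = x := Iff.rfl

theorem rist_mono {K : Subgroup (HX m)} {C D : Set (XX m)} (h : C ⊆ D) : rist K C ≤ rist K D :=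
  fun _ hg => ⟨hg.1, fun x hx => hg.2 x fun h' => hx (h h')⟩

theorem rist_conj {K : Subgroup (HX m)} {C} {g h : HX m} (hg : g ∈ K) (hh : h ∈ rist K C) :
    g * h * g⁻¹ ∈ rist K (g '' C) := by
  refine ⟨K.mul_mem (K.mul_mem hg hh.1) (K.inv_mem hg), fun x hx => ?_⟩
  rw [hmul, hmul, hh.2, hinvr]
  intro h'
  exact hx ⟨_, h', hinvr g x⟩

theorem rist_mem {K : Subgroup (HX m)} {C} {h : HX m} (hh : h ∈ rist K C) {x : XX m} (hx : x ∈ C) :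
    h x ∈ C := by
  by_contra hn
  have := hh.2 _ hn
  have h2 := h.injective this
  rw [h2] at hn
  exact hn hx

theorem rist_Fix {K : Subgroup (HX m)} {C} {h : HX m} (hh : h ∈ rist K C) (hC : IsPreconnected C) {t : XX m}
    (ht : t ∉ C) : h ∈ Fix t := by
  refine ⟨hh.2 t ht, fun x hx => ?_⟩
  by_cases hxC : x ∈ C
  · exact subset_comp hC hxC ht (rist_mem hh hxC)
  · rw [hh.2 x hxC]; exact mem_comp_self hx

/-! ### the group -/

theorem Dyq : Dy (1/4) := Dy.one.quarter
theorem Dyt : Dy (3/4) := by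
  have h := (Dy.one.add Dy.one.half).half
  have e : (3/4:ℝ) = (1 + 1/2)/2 := by norm_num
  rwa [e]

theorem ok1 : OKp (1/4) (1/2) := ⟨by norm_num, by norm_num, by norm_num, Dyq, Dy.one.half⟩
theorem ok2 : OKp (1/2) (1/4) := ⟨by norm_num, by norm_num, by norm_num, Dy.one.half, Dyq⟩
theorem ok3 : OKp (1/2) (1/2) := ⟨by norm_num, by norm_num, by norm_num, Dy.one.half, Dy.one.half⟩
theorem ok4 : OKp (3/4) (1/4) := ⟨by norm_num, by norm_num, by norm_num, Dyt, Dyq⟩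

noncomputable def F1 : HX m := hat (plD ok1)
noncomputable def F2 : HX m := hat (plD ok2)
noncomputable def F3 : HX m := hat (plD ok3)
noncomputable def F4 : HX m := hat (plD ok4)
noncomputable def rho : HX m := hat flD

/-- the generators -/
def gens (m : ℕ) : Set (HX m) := {F1, F2, F3, F4, rho} ∪ Set.range sg

/-- the group -/
def GG (m : ℕ) : Subgroup (HX m) := Subgroup.closure (gens m)

theorem GG_fg : (GG m).FG := by
  have hfin : (gens m).Finite := Set.Finite.union (by simp) (Set.finite_range _)
  exact ⟨hfin.toFinset, by simp [GG]⟩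

theorem F1_mem : (F1 : HX m) ∈ GG m := Subgroup.subset_closure (by simp [gens])
theorem F2_mem : (F2 : HX m) ∈ GG m := Subgroup.subset_closure (by simp [gens])
theorem F3_mem : (F3 : HX m) ∈ GG m := Subgroup.subset_closure (by simp [gens])
theorem F4_mem : (F4 : HX m) ∈ GG m := Subgroup.subset_closure (by simp [gens])
theorem rho_mem : (rho : HX m) ∈ GG m := Subgroup.subset_closure (by simp [gens])
theorem sg_mem (i : Fin m) : sg i ∈ GG m := Subgroup.subset_closure (by simp [gens])

noncomputable def qt : DD := ⟨1/4, by norm_num, by norm_num, Dyq⟩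
noncomputable def tq : DD := ⟨3/4, by norm_num, by norm_num, Dyt⟩

def Z0 (m : ℕ) : Set (XX m) := cmp [] qt (some none)
theorem mem_Z0 {x : XX m} : x ∈ Z0 m ↔ 1/4 < x.1 [] := Iff.rfl
def I0 (m : ℕ) : Set (XX m) := {x | 1/4 < x.1 [] ∧ x.1 [] < 3/4}
theorem mem_I0 {x : XX m} : x ∈ I0 m ↔ 1/4 < x.1 [] ∧ x.1 [] < 3/4 := Iff.rfl
theorem I0_sub : I0 m ⊆ Z0 m := fun _ h => h.1

theorem pl_supp {a l : ℝ} (H : OKp a l) {x : XX m} (h : x.1 [] ≤ a ∨ a + l ≤ x.1 []) :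
    hat (plD H) x = x := by
  apply hat_fix
  rcases h with h | h
  · exact pl_out1 h
  · exact pl_out2 h

theorem F1_r : (F1 : HX m) ∈ rist (GG m) (I0 m) := ⟨F1_mem, fun x hx => pl_supp ok1 (by
  rw [mem_I0] at hx
  by_contra hcon
  push Not at hcon
  exact hx ⟨hcon.1, by linarith [hcon.2]⟩)⟩
theorem F2_r : (F2 : HX m) ∈ rist (GG m) (I0 m) := ⟨F2_mem, fun x hx => pl_supp ok2 (by
  rw [mem_I0] at hx
  by_contra hcon
  push Not at hcon
  exact hx ⟨by linarith [hcon.1], by linarith [hcon.2]⟩)⟩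
theorem F3_r : (F3 : HX m) ∈ rist (GG m) (Z0 m) := ⟨F3_mem, fun x hx => pl_supp ok3 (by
  rw [mem_Z0] at hx; left; linarith)⟩
theorem F4_r : (F4 : HX m) ∈ rist (GG m) (Z0 m) := ⟨F4_mem, fun x hx => pl_supp ok4 (by
  rw [mem_Z0] at hx; left; linarith)⟩
theorem sg_r (i : Fin m) : sg i ∈ rist (GG m) (Z0 m) := ⟨sg_mem i, fun x hx => by
  rw [mem_Z0] at hx
  refine sg_fix i x (by linarith) ?_
  by_contra hne
  have : x.1 [] = 1/2 := par_nil x hne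
  linarith⟩

/-! ### moving along the root spine -/

structure Mv (g : HX m) (r s : DD) : Prop where
  b : g (br [] r) = br [] s
  c : ∀ i w t, g (br ((r, i) :: w) t) = br ((s, i) :: w) t
  d : ∀ c, ∀ x ∈ cmp [] r c, g x ∈ cmp [] s c

theorem Mv.refl (r : DD) : Mv (1 : HX m) r r := ⟨rfl, fun _ _ _ => rfl, fun _ _ h => h⟩

theorem Mv.trans {g h : HX m} {r s t : DD} (H : Mv g r s) (H' : Mv h s t) : Mv (h * g) r t :=
  ⟨by rw [hmul, H.b, H'.b], fun i w u => by rw [hmul, H.c, H'.c], fun c x hx => H'.d c _ (H.d c x hx)⟩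

theorem Mv.symm {g : HX m} {r s : DD} (H : Mv g r s) : Mv g⁻¹ s r := by
  refine ⟨by rw [← H.b, hinvl], fun i w t => by rw [← H.c, hinvl], fun c x hx => ?_⟩
  have h1 : g⁻¹ x ≠ br [] r := by
    intro h
    have : x = br [] s := by rw [← H.b, ← h, hinvr]
    exact br_not_mem_cmp _ _ _ (this ▸ hx)
  obtain ⟨c', hc'⟩ := cmp_cover _ _ h1
  have h2 := H.d c' _ hc'
  rw [hinvr] at h2
  rw [cmp_disj _ _ hx h2]
  exact hc'

theorem Mv_hat (d : HD) (hd : Monotone d.h) (r : DD) : Mv (hat d : HX m) r (d.k r) := by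
  have hlt : ∀ s t : ℝ, 0 ≤ s → s ≤ 1 → 0 ≤ t → t ≤ 1 → s < t → d.h s < d.h t := by
    intro s t h1 h2 h3 h4 h
    refine lt_of_le_of_ne (hd h.le) fun he => h.ne ?_
    rw [← d.left s h1 h2, he, d.left t h3 h4]
  refine ⟨hat_br_nil d r, fun i w t => hat_br_cons d r i w t, fun c x hx => ?_⟩
  rcases c with _ | _ | i
  · show d.h (x.1 []) < d.k r
    rw [d.hk]
    exact hlt _ _ (x.2.nn _) (x.2.le _) r.2.1.le r.2.2.1.le hx
  · show (d.k r : ℝ) < d.h (x.1 [])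
    rw [d.hk]
    exact hlt _ _ r.2.1.le r.2.2.1.le (x.2.nn _) (x.2.le _) hx
  · show 0 < x.1 ((d.k' (d.k r), i) :: [])
    rw [d.k'k]
    exact hx

theorem dyadic_ind (P : ℝ → Prop) (h0 : P (1/2))
    (h1 : ∀ y, 0 < y → y ≤ 1/4 → P (2*y) → P y)
    (h2 : ∀ y, 1/4 ≤ y → y ≤ 1/2 → P (y+1/4) → P y)
    (h3 : ∀ y, 3/4 ≤ y → y < 1 → P (2*y-1) → P y)
    (h4 : ∀ y, 1/2 ≤ y → y ≤ 5/8 → P (2*y-1/2) → P y)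
    (h5 : ∀ y, 5/8 ≤ y → y ≤ 3/4 → P (y+1/8) → P y) :
    ∀ y, 0 < y → y < 1 → Dy y → P y := by
  have key : ∀ k : ℕ, ∀ y : ℝ, 0 < y → y < 1 → (∃ z : ℤ, y * 2 ^ k = z) → P y := by
    intro k
    induction k using Nat.strong_induction_on with
    | _ k ih =>
    match k, ih with
    | 0, _ =>
      rintro y hy hy1 ⟨z, hz⟩
      rw [pow_zero, mul_one] at hz
      rw [hz] at hy hy1
      norm_cast at hy hy1
      omega
    | 1, _ =>
      rintro y hy hy1 ⟨z, hz⟩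
      have e1 : (0:ℝ) < z := by rw [← hz]; positivity
      have e2 : (z:ℝ) < 2 := by rw [← hz]; linarith
      norm_cast at e1 e2
      have : z = 1 := by omega
      rw [this] at hz
      have : y = 1/2 := by push_cast at hz; linarith
      rw [this]; exact h0
    | 2, _ =>
      rintro y hy hy1 ⟨z, hz⟩
      have e1 : (0:ℝ) < z := by rw [← hz]; positivity
      have e2 : (z:ℝ) < 4 := by rw [← hz]; linarith
      norm_cast at e1 e2
      have : z = 1 ∨ z = 2 ∨ z = 3 := by omega
      rcases this with e | e | e
      · have : y = 1/4 := by rw [e] at hz; push_cast at hz; linarith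
        rw [this]
        exact h1 _ (by norm_num) le_rfl (by norm_num at h0 ⊢; exact h0)
      · have : y = 1/2 := by rw [e] at hz; push_cast at hz; linarith
        rw [this]; exact h0
      · have : y = 3/4 := by rw [e] at hz; push_cast at hz; linarith
        rw [this]
        exact h3 _ le_rfl (by norm_num) (by norm_num at h0 ⊢; exact h0)
    | k + 3, ih =>
      have IH := ih (k + 2) (by omega)
      have hmid : ∀ y : ℝ, 1/2 < y → y < 3/4 → (∃ z : ℤ, y * 2 ^ (k+3) = z) → P y := by
        rintro y hy hy1 ⟨z, hz⟩
        have hz' : 2 * y * 2 ^ (k+2) = z := by rw [← hz]; ring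
        rcases le_total y (5/8) with h | h
        · refine h4 y hy.le h (IH _ (by linarith) (by linarith) ⟨z - 2 ^ (k+1), ?_⟩)
          push_cast
          rw [← hz']; ring
        · refine h5 y h hy1.le (h3 _ (by linarith) (by linarith) (IH _ (by linarith) (by linarith)
            ⟨z - 3 * 2 ^ k, ?_⟩))
          push_cast
          rw [← hz']; ring
      rintro y hy hy1 ⟨z, hz⟩
      have hz' : 2 * y * 2 ^ (k+2) = z := by rw [← hz]; ring
      rcases le_total y (1/4) with h | h
      · exact h1 y hy h (IH _ (by linarith) (by linarith) ⟨z, hz'⟩)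
      rcases eq_or_lt_of_le h with h | h
      · rw [← h]; exact h1 _ (by norm_num) le_rfl (by norm_num at h0 ⊢; exact h0)
      rcases lt_trichotomy y (1/2) with h' | h' | h'
      · refine h2 y h.le h'.le (hmid _ (by linarith) (by linarith) ⟨z + 2 ^ (k+1), ?_⟩)
        push_cast
        rw [← hz]; ring
      · rw [h']; exact h0
      rcases lt_or_ge y (3/4) with h'' | h''
      · exact hmid y h' h'' ⟨z, hz⟩
      · refine h3 y h'' hy1 (IH _ (by linarith) (by linarith) ⟨z - 2 ^ (k+2), ?_⟩)
        push_cast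
        rw [← hz']; ring
  rintro y h h' ⟨k, z, hz⟩
  exact key k y h h' ⟨z, hz⟩

/-- Transitivity on dyadics of an interval of length one half. -/
theorem interval_trans {a : ℝ} (H : OKp a (1/2)) (H' : OKp (a + 1/4) (1/4)) (K : Subgroup (HX m))
    (hK : hat (plD H) ∈ K) (hK' : hat (plD H') ∈ K) (mid : DD) (hmid : (mid : ℝ) = a + 1/4) (r : DD)
    (h1 : a < r) (h2 : (r : ℝ) < a + 1/2) : ∃ g ∈ K, Mv g r mid := by
  let P : ℝ → Prop := fun y => ∀ r : DD, (r : ℝ) = a + y / 2 → ∃ g ∈ K, Mv g r mid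
  have step : ∀ (d : HD), Monotone d.h → hat d ∈ K → ∀ y y', P y' →
      d.h (a + y/2) = a + y'/2 → P y := by
    intro d hd hdK y y' hP he r hr
    obtain ⟨g, hg, hM⟩ := hP (d.k r) (by rw [d.hk, hr, he])
    exact ⟨g * hat d, K.mul_mem hg hdK, (Mv_hat d hd r).trans hM⟩
  have hKi : hat (plD H).symm ∈ K := by rw [← hat_inv]; exact K.inv_mem hK
  have key : ∀ y, 0 < y → y < 1 → Dy y → P y := by
    apply dyadic_ind
    · intro r hr
      have : r = mid := Subtype.ext (by rw [hr, hmid]; norm_num)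
      rw [this]
      exact ⟨1, K.one_mem, Mv.refl _⟩
    · intro y hy hy' hP
      refine step _ (pl_mono _ _) hK _ _ hP ?_
      show pl _ _ _ = _
      rw [pl_1 (by linarith) (by linarith)]; ring
    · intro y hy hy' hP
      refine step _ (pl_mono _ _) hK _ _ hP ?_
      show pl _ _ _ = _
      rw [pl_2 (by linarith) (by linarith) (by norm_num)]; ring
    · intro y hy hy' hP
      refine step _ (pl'_mono _ _) hKi _ _ hP ?_
      show pl' _ _ _ = _
      rw [pl'_3 (by linarith) (by linarith) (by norm_num)]; ring
    · intro y hy hy' hP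
      refine step _ (pl_mono _ _) hK' _ _ hP ?_
      show pl _ _ _ = _
      rw [pl_1 (by linarith) (by linarith)]; ring
    · intro y hy hy' hP
      refine step _ (pl_mono _ _) hK' _ _ hP ?_
      show pl _ _ _ = _
      rw [pl_2 (by linarith) (by linarith) (by norm_num)]; ring
  refine key (2 * (r - a)) (by linarith) (by linarith) (r.2.2.2.sub H.da).dbl r ?_
  ring

theorem mv_I0 (r : DD) (h1 : 1/4 < (r:ℝ)) (h2 : (r:ℝ) < 3/4) : ∃ g ∈ rist (GG m) (I0 m), Mv g r hf := by
  have e : (1/4 + 1/4 : ℝ) = 1/2 := by norm_num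
  refine interval_trans ok1 (by rw [e]; exact ok2) _ F1_r ?_ hf (by show (1/2:ℝ) = _; norm_num) r h1
    (by linarith)
  have := F2_r (m := m)
  unfold F2 at this
  convert this using 3

theorem mv_Z0 (r : DD) (h1 : 1/4 < (r:ℝ)) : ∃ g ∈ rist (GG m) (Z0 m), Mv g r hf := by
  rcases lt_or_ge (r:ℝ) (3/4) with h | h
  · obtain ⟨g, hg, hM⟩ := mv_I0 (m := m) r h1 h
    exact ⟨g, rist_mono I0_sub hg, hM⟩
  · have e : (1/2 + 1/4 : ℝ) = 3/4 := by norm_num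
    have h34 := interval_trans (m := m) ok3 (by rw [e]; exact ok4) (rist (GG m) (Z0 m)) F3_r (by
        have := F4_r (m := m)
        unfold F4 at this
        convert this using 3) tq (by show (3/4:ℝ) = _; norm_num)
    obtain ⟨g, hg, hM⟩ := h34 r (by linarith) (by linarith [r.2.2.1])
    let s : DD := ⟨5/8, by norm_num, by norm_num, by
      have h := (Dy.one.half.add Dyt).half
      have e : (5/8:ℝ) = (1/2 + 3/4)/2 := by norm_num
      rwa [e]⟩
    obtain ⟨g', hg', hM'⟩ := h34 s (by show (1/2:ℝ) < 5/8; norm_num) (by show (5/8:ℝ) < _; norm_num)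
    obtain ⟨g2, hg2, hM2⟩ := mv_I0 (m := m) s (by show (1/4:ℝ) < 5/8; norm_num) (by show (5/8:ℝ) < _; norm_num)
    exact ⟨g2 * (g'⁻¹ * g), mul_mem (rist_mono I0_sub hg2) (mul_mem (inv_mem hg') hg),
      (hM.trans hM'.symm).trans hM2⟩

end Waz

open Topology
/-! ## Part 5 : transitivity on cells and realisation of local permutations -/

namespace Waz
variable {m : ℕ}

/-- base point -/
noncomputable def bb (m : ℕ) : XX m := br [] hf
noncomputable def b0 (m : ℕ) : XX m := br [] qt
noncomputable def b1 (m : ℕ) : XX m := br [] tq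

theorem b0_nil : (b0 m).1 [] = 1/4 := rfl
theorem b1_nil : (b1 m).1 [] = 3/4 := rfl
theorem bb_nil : (bb m).1 [] = 1/2 := rfl

theorem b0_not_Z0 : b0 m ∉ Z0 m := by rw [mem_Z0, b0_nil]; exact lt_irrefl _

theorem b0_back : b0 m ∈ cmp [] hf none := by
  show (1/4:ℝ) < 1/2
  norm_num
theorem b1_fwd : b1 m ∈ cmp [] hf (some none) := by
  show (1/2:ℝ) < 3/4
  norm_num

/-- every branch point of `Z0` can be moved to the base point inside `Z0` -/
theorem to_bb : ∀ (n : ℕ) (w : EE m) (r : DD), w.length = n → br w r ∈ Z0 m →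
    ∃ h ∈ rist (GG m) (Z0 m), h (br w r) = bb m := by
  intro n
  induction n with
  | zero =>
    intro w r hw h
    obtain rfl : w = [] := List.length_eq_zero_iff.1 hw
    obtain ⟨g, hg, hM⟩ := mv_Z0 (m := m) r h
    exact ⟨g, hg, hM.b⟩
  | succ n ih =>
    intro w r hw h
    obtain ⟨⟨a, i⟩, w, rfl⟩ : ∃ a v, w = a :: v := by
      cases w with
      | nil => simp at hw
      | cons a v => exact ⟨a, v, rfl⟩
    have ha : 1/4 < (a:ℝ) := h
    obtain ⟨g, hg, hM⟩ := mv_Z0 (m := m) a ha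
    have key : ∃ w' r', w'.length = n ∧ br w' r' ∈ Z0 m ∧ sg i (br ((hf, i) :: w) r) = br w' r' := by
      cases w with
      | nil =>
        refine ⟨[], upD r, by simp at hw ⊢; omega, ?_, sg_br_one i r⟩
        show (1/4:ℝ) < (1+r)/2
        linarith [r.2.1]
      | cons b w =>
        refine ⟨(upD b.1, b.2) :: w, r, by simpa using hw, ?_, sg_br_two i b w r⟩
        show (1/4:ℝ) < (1+(b.1:ℝ))/2
        linarith [b.1.2.1]
    obtain ⟨w', r', h1, h2, h3⟩ := key
    obtain ⟨k, hk, hk'⟩ := ih w' r' h1 h2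
    exact ⟨k * (sg i * g), mul_mem hk (mul_mem (sg_r i) hg), by
      rw [hmul, hmul, hM.c, h3, hk']⟩

theorem to_bb' {q : XX m} (hq : isB q) (h : q ∈ Z0 m) : ∃ h ∈ rist (GG m) (Z0 m), h q = bb m := by
  obtain ⟨w, r, rfl⟩ := hq
  exact to_bb _ w r rfl h

theorem rho_nil (x : XX m) : (rho x).1 [] = 1 - x.1 [] := rfl

theorem to_bb_G {q : XX m} (hq : isB q) (hm : 1 ≤ m) : ∃ h ∈ GG m, h q = bb m := by
  by_cases h : q ∈ Z0 m
  · obtain ⟨g, hg, hg'⟩ := to_bb' hq h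
    exact ⟨g, hg.1, hg'⟩
  · obtain ⟨g, hg, hg'⟩ := to_bb' (isB_image hm rho hq) (by
      rw [mem_Z0] at h ⊢
      rw [rho_nil]; linarith)
    exact ⟨g * rho, mul_mem hg.1 rho_mem, hg'⟩

def Rz (K : Subgroup (HX m)) (π : Equiv.Perm (Option (Option (Fin m)))) : Prop :=
  ∃ h ∈ K, h (bb m) = bb m ∧ ∀ c, ∀ x ∈ cmp [] hf c, h x ∈ cmp [] hf (π c)

theorem Rz.one (K : Subgroup (HX m)) : Rz K 1 := ⟨1, K.one_mem, rfl, fun _ _ h => h⟩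
theorem Rz.mul {K : Subgroup (HX m)} {π τ} (h : Rz K π) (h' : Rz K τ) : Rz K (π * τ) := by
  obtain ⟨f, hf1, hf2, hf3⟩ := h
  obtain ⟨g, hg1, hg2, hg3⟩ := h'
  exact ⟨f * g, mul_mem hf1 hg1, by rw [hmul, hg2, hf2], fun c x hx => hf3 _ _ (hg3 _ _ hx)⟩

theorem Rz.mono {K K' : Subgroup (HX m)} {π} (hK : K ≤ K') (h : Rz K π) : Rz K' π := by
  obtain ⟨f, hf1, hf2, hf3⟩ := h
  exact ⟨f, hK hf1, hf2, hf3⟩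

/-- a homeomorphism fixing the base point permutes the components -/
theorem exists_perm (k : HX m) (h : k (bb m) = bb m) :
    ∃ π : Equiv.Perm (Option (Option (Fin m))), ∀ c, ∀ x ∈ cmp [] hf c, k x ∈ cmp [] hf (π c) := by
  have key : ∀ c, ∃ d, ∀ x ∈ cmp [] hf c, k x ∈ cmp (m := m) [] hf d := by
    intro c
    have h1 : Cell (bb m) (cmp [] hf c) := cell_cmp [] hf c
    obtain ⟨x, hx⟩ := h1.nonempty
    have hxb : x ≠ bb m := fun e => h1.not_mem (e ▸ hx)
    have hkx : k x ≠ bb m := fun e => hxb (k.injective (e.trans h.symm))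
    obtain ⟨d, hd⟩ := cmp_cover [] hf hkx
    refine ⟨d, fun y hy => ?_⟩
    rw [← comp_br' [] hf d hd]
    have := (mem_comp_image k hxb (y := y)).2 (by rw [← h1.eq_comp hx]; exact hy)
    rw [h] at this
    exact this
  choose π hπ using key
  have hinj : Function.Injective π := by
    intro c d hcd
    obtain ⟨x, hx⟩ := cmp_nonempty (m := m) [] hf c
    obtain ⟨y, hy⟩ := cmp_nonempty (m := m) [] hf d
    have hxb : x ≠ bb m := (cmp_hS [] hf x).2 ⟨c, hx⟩
    have h1 := hπ c x hx
    have h2 := hπ d y hy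
    rw [← hcd, ← comp_br' [] hf _ h1] at h2
    have h3 : k y ∈ comp (k (bb m)) (k x) := by rw [h]; exact h2
    rw [mem_comp_image k hxb] at h3
    have h4 : y ∈ cmp [] hf c := by
      have e := comp_br' [] hf c hx
      rw [← e]; exact h3
    exact cmp_disj _ _ h4 hy
  exact ⟨Equiv.ofBijective π (Finite.injective_iff_bijective.1 hinj), hπ⟩

theorem Rz_of_maps {K : Subgroup (HX m)} {k : HX m} (hk : k ∈ K) (h : k (bb m) = bb m)
    (ρ : Option (Option (Fin m)) → Option (Option (Fin m))) (π) (hρ : ∀ c, ∀ x ∈ cmp [] hf c, k x ∈ cmp [] hf (ρ c))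
    (he : ∀ c, ρ c = π c) : Rz K π := by
  refine ⟨k, hk, h, fun c x hx => ?_⟩
  rw [← he]; exact hρ c x hx

theorem sg_bb (i : Fin m) : sg i (bb m) = bb m := by
  apply sg_fix
  · rw [bb_nil]
  · exact br_child [] hf _

theorem sg_maps (i : Fin m) : ∀ c, ∀ x ∈ cmp [] hf c, sg i x ∈ cmp [] hf (Equiv.swap (some none) (some (some i)) c) := by
  intro c x hx
  rcases c with _ | _ | j
  · rw [Equiv.swap_apply_of_ne_of_ne (by simp) (by simp), sg_fix]
    · exact hx
    · have h : x.1 [] < 1/2 := hx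
      exact h.le
    · by_contra hne
      have h : x.1 [] < 1/2 := hx
      have h' : x.1 [] = 1/2 := par_nil x hne
      linarith
  · rw [Equiv.swap_apply_left]
    have h : 1/2 < x.1 [] := hx
    show 0 < (sg i x).1 [(hf, i)]
    rw [sg_val, sgC_one]
    exact lt_max_of_lt_left (by linarith)
  · have h : 0 < x.1 [(hf, j)] := hx
    by_cases hij : j = i
    · subst hij
      rw [Equiv.swap_apply_right]
      have h' : x.1 [] = 1/2 := par_nil x h.ne'
      show (1/2:ℝ) < (sg j x).1 []
      rw [sg_val, sgC_nil, h', min_self]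
      linarith
    · rw [Equiv.swap_apply_of_ne_of_ne (by simp) (by simp [hij]), sg_fix]
      · exact hx
      · exact (par_nil x h.ne').le
      · by_contra hne
        have := ex_nil x h.ne' hne
        exact hij (Prod.ext_iff.1 this).2

theorem Rz_sg (i : Fin m) : Rz (rist (GG m) (Z0 m)) (Equiv.swap (some none) (some (some i))) :=
  ⟨sg i, sg_r i, sg_bb i, sg_maps i⟩

theorem rho_bb : rho (bb m) = bb m := by
  apply hat_fix
  rw [bb_nil]
  show (1:ℝ) - 1/2 = 1/2
  norm_num

theorem rho_maps : ∀ c, ∀ x ∈ cmp (m := m) [] hf c, rho x ∈ cmp [] hf (Equiv.swap (some none) none c) := by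
  intro c x hx
  rcases c with _ | _ | j
  · rw [Equiv.swap_apply_right]
    have h : x.1 [] < 1/2 := hx
    show (1/2:ℝ) < 1 - x.1 []
    linarith
  · rw [Equiv.swap_apply_left]
    have h : 1/2 < x.1 [] := hx
    show 1 - x.1 [] < (1/2:ℝ)
    linarith
  · rw [Equiv.swap_apply_of_ne_of_ne (by simp) (by simp)]
    have h : 0 < x.1 [(hf, j)] := hx
    have : rho x = x := by
      apply hat_fix
      have h' : x.1 [] = 1/2 := par_nil x h.ne'
      rw [h']
      show (1:ℝ) - 1/2 = 1/2
      norm_num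
    rw [this]; exact hx

theorem Rz_rho : Rz (GG m) (Equiv.swap (some none) none) := ⟨rho, rho_mem, rho_bb, rho_maps⟩

/-- the union of the hanging components -/
def Hg (m : ℕ) : Set (XX m) := {x | x.1 [] = 1/2 ∧ x ≠ bb m}

theorem Hg_sub : Hg m ⊆ I0 m := by
  rintro x ⟨h, _⟩
  rw [mem_I0, h]
  norm_num

theorem Rz_hang {i j : Fin m} (hij : i ≠ j) :
    Rz (rist (GG m) (Hg m)) (Equiv.swap (some (some i)) (some (some j))) := by
  have e : Equiv.swap (some (some i)) (some (some j) : Option (Option (Fin m))) =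
      Equiv.swap (some none) (some (some j)) * (Equiv.swap (some none) (some (some i)) *
        Equiv.swap (some none) (some (some j))) := by
    have := Equiv.swap_mul_swap_mul_swap (x := (some (some i) : Option (Option (Fin m)))) (y := some none)
      (z := some (some j)) (by simp) (by simp [hij])
    rw [Equiv.swap_comm, ← this, mul_assoc, Equiv.swap_comm (some (some i)) (some none)]
  refine ⟨sg j * (sg i * sg j), ⟨mul_mem (sg_mem j) (mul_mem (sg_mem i) (sg_mem j)), fun x hx => ?_⟩, ?_, ?_⟩
  · rw [hmul, hmul]
    by_cases hb : x = bb m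
    · rw [hb, sg_bb, sg_bb, sg_bb]
    obtain ⟨c, hc⟩ := cmp_cover [] hf hb
    have key : sg i (sg j x) = sg j x → sg j (sg i (sg j x)) = x := fun h => by rw [h, sg_invol]
    apply key
    have h1 := sg_maps j c x hc
    have h2 := sg_maps i _ _ h1
    rcases c with _ | _ | k
    · rw [Equiv.swap_apply_of_ne_of_ne (by simp) (by simp)] at h1
      apply sg_fix
      · have h : (sg j x).1 [] < 1/2 := h1
        exact h.le
      · by_contra hne
        have h : (sg j x).1 [] < 1/2 := h1
        have h' : (sg j x).1 [] = 1/2 := par_nil _ hne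
        linarith
    · rw [Equiv.swap_apply_left] at h1
      have h : 0 < (sg j x).1 [(hf, j)] := h1
      apply sg_fix
      · exact (par_nil _ h.ne').le
      · by_contra hne
        have := ex_nil _ h.ne' hne
        exact hij (Prod.ext_iff.1 this).2.symm
    · exfalso
      have h : 0 < x.1 [(hf, k)] := hc
      exact hx ⟨par_nil x h.ne', hb⟩
  · rw [hmul, hmul, sg_bb, sg_bb, sg_bb]
  · intro c x hx
    rw [e]
    exact sg_maps j _ _ (sg_maps i _ _ (sg_maps j c x hx))

theorem perm_ind {α : Type*} [DecidableEq α] [Finite α] (S : Set α) (P : Equiv.Perm α → Prop) (h1 : P 1)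
    (hmul : ∀ π τ, P π → P τ → P (π * τ)) (hs : ∀ x ∈ S, ∀ y ∈ S, x ≠ y → P (Equiv.swap x y))
    (π : Equiv.Perm α) (hπ : ∀ x, x ∉ S → π x = x) : P π := by
  classical
  have key : ∀ σ : Equiv.Perm {x // x ∈ S}, P (Equiv.Perm.ofSubtype σ) := by
    intro σ
    induction σ using Equiv.Perm.swap_induction_on with
    | one => rw [map_one]; exact h1
    | swap_mul f x y hxy ih =>
      rw [map_mul]
      refine hmul _ _ ?_ ih
      rw [Equiv.Perm.ofSubtype_swap_eq]
      exact hs _ x.2 _ y.2 fun h => hxy (Subtype.ext h)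
  have hmem : ∀ x, π x ∈ S ↔ x ∈ S := by
    intro x
    constructor
    · intro h
      by_contra hn
      rw [hπ x hn] at h
      exact hn h
    · intro h
      by_contra hn
      have := π.injective (hπ _ hn)
      rw [this] at hn
      exact hn h
  have := key (π.subtypePerm hmem)
  rwa [Equiv.Perm.ofSubtype_subtypePerm] at this
  intro x hx
  by_contra hn
  exact hx (hπ x hn)

theorem Rz_star {K : Subgroup (HX m)} (S : Set (Option (Option (Fin m)))) (x0) 
    (h : ∀ y ∈ S, y ≠ x0 → Rz K (Equiv.swap x0 y)) (π) (hπ : ∀ x, x ∉ S → π x = x) : Rz K π := by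
  refine perm_ind S (Rz K) (Rz.one K) (fun _ _ => Rz.mul) ?_ π hπ
  intro x hx y hy hxy
  by_cases h1 : x = x0
  · subst h1; exact h y hy (Ne.symm hxy)
  by_cases h2 : y = x0
  · subst h2; rw [Equiv.swap_comm]; exact h x hx hxy
  have := Equiv.swap_mul_swap_mul_swap (x := x) (y := x0) (z := y) h1 hxy
  rw [Equiv.swap_comm x y, ← this]
  refine ((h y hy h2).mul ?_).mul (h y hy h2)
  rw [Equiv.swap_comm]; exact h x hx h1

theorem Rz_G (π) : Rz (GG m) π := by
  refine Rz_star Set.univ (some none) ?_ π (fun x hx => absurd (Set.mem_univ x) hx)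
  rintro (_ | _ | i) _ hy
  · exact Rz_rho
  · exact absurd rfl hy
  · exact (Rz_sg i).mono fun g (hg : g ∈ rist (GG m) (Z0 m)) => hg.1

theorem Rz_Z (π) (h : π none = none) : Rz (rist (GG m) (Z0 m)) π := by
  refine Rz_star {none}ᶜ (some none) ?_ π (fun x hx => ?_)
  · rintro (_ | _ | i) hy' hy
    · exact absurd rfl hy'
    · exact absurd rfl hy
    · exact Rz_sg i
  · rw [Set.notMem_compl_iff, Set.mem_singleton_iff] at hx
    rw [hx, h]

theorem Rz_I (π) (h : π none = none) (h' : π (some none) = some none) : Rz (rist (GG m) (Hg m)) π := by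
  refine perm_ind {none, some none}ᶜ (Rz _) (Rz.one _) (fun _ _ => Rz.mul) ?_ π ?_
  · rintro (_ | _ | i) hx (_ | _ | j) hy hxy
    · simp at hx
    · simp at hx
    · simp at hx
    · simp at hx
    · simp at hx
    · simp at hx
    · simp at hy
    · simp at hy
    · exact Rz_hang (by rintro rfl; exact hxy rfl)
  · intro x hx
    rw [Set.notMem_compl_iff] at hx
    rcases hx with rfl | hx
    · exact h
    · rw [Set.mem_singleton_iff] at hx
      rw [hx, h']

theorem match_Fix {K : Subgroup (HX m)} {f h1 h2 : HX m} {q : XX m} (hh1 : h1 ∈ K) (hh2 : h2 ∈ K)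
    (e1 : h1 q = bb m) (e2 : h2 (f q) = bb m)
    (hR : ∀ π, (∀ c, ∀ x ∈ cmp [] hf c, (h2 * f * h1⁻¹) x ∈ cmp [] hf (π c)) → Rz K π) :
    ∃ h ∈ K, h⁻¹ * f ∈ Fix q := by
  have hq : h1⁻¹ (bb m) = q := by rw [← e1, hinvl]
  have hk : (h2 * f * h1⁻¹) (bb m) = bb m := by rw [hmul, hq, hmul, e2]
  obtain ⟨π, hπ⟩ := exists_perm _ hk
  obtain ⟨h3, hh3, hb, hc⟩ := hR π hπ
  refine ⟨h2⁻¹ * h3 * h1, mul_mem (mul_mem (inv_mem hh2) hh3) hh1, ?_⟩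
  have hF : h3⁻¹ * (h2 * f * h1⁻¹) ∈ Fix (bb m) := by
    have hb' : h3⁻¹ (bb m) = bb m := by
      conv_lhs => rw [← hb]
      exact hinvl _ _
    apply Fix_br
    · rw [hmul]
      show h3⁻¹ ((h2 * f * h1⁻¹) (bb m)) = bb m
      rw [hk, hb']
    · intro c x hx
      have h4 := hπ c x hx
      rw [hmul]
      set y := (h2 * f * h1⁻¹) x
      have hy : h3⁻¹ y ≠ bb m := by
        intro h
        have h5 : y = bb m := by rw [← hb, ← h, hinvr]
        rw [h5] at h4
        exact br_not_mem_cmp _ _ _ h4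
      obtain ⟨d, hd⟩ := cmp_cover [] hf hy
      have h6 := hc d _ hd
      rw [hinvr] at h6
      have := π.injective (cmp_disj _ _ h4 h6)
      rw [this]; exact hd
  have := Fix_conj h1⁻¹ hF
  rw [hq] at this
  convert this using 1
  group

theorem fix_i (hm : 1 ≤ m) (f : HX m) {q : XX m} (hq : isB q) : ∃ h ∈ GG m, h⁻¹ * f ∈ Fix q := by
  obtain ⟨h1, hh1, e1⟩ := to_bb_G hq hm
  obtain ⟨h2, hh2, e2⟩ := to_bb_G (isB_image hm f hq) hm
  exact match_Fix hh1 hh2 e1 e2 fun π _ => Rz_G π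

theorem rist_b0 {h : HX m} (hh : h ∈ rist (GG m) (Z0 m)) : h (b0 m) = b0 m := hh.2 _ b0_not_Z0

theorem Z0_cell : Cell (b0 m) (Z0 m) := cell_cmp [] qt (some none)

theorem fix_L0 (hm : 1 ≤ m) {f : HX m} (hf0 : f ∈ Fix (b0 m)) {q : XX m} (hq : isB q) (hqZ : q ∈ Z0 m) :
    ∃ h ∈ rist (GG m) (Z0 m), h⁻¹ * f ∈ Fix q := by
  have hfq : f q ∈ Z0 m := by
    have := hf0.2 q (fun e => b0_not_Z0 (e ▸ hqZ))
    rwa [← Z0_cell.eq_comp hqZ] at this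
  obtain ⟨h1, hh1, e1⟩ := to_bb' hq hqZ
  obtain ⟨h2, hh2, e2⟩ := to_bb' (isB_image hm f hq) hfq
  refine match_Fix hh1 hh2 e1 e2 fun π hπ => Rz_Z π ?_
  have h3 := hπ none (b0 m) b0_back
  have h4 : (h2 * f * h1⁻¹) (b0 m) = b0 m := by
    rw [hmul, hmul, rist_b0 (inv_mem hh1), hf0.1, rist_b0 hh2]
  rw [h4] at h3
  exact cmp_disj _ _ h3 b0_back

/-- every cell is equivalent to a standard one -/
theorem cell_trans0 (hm : 1 ≤ m) {t : XX m} {C} (h : Cell t C) :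
    ∃ g ∈ GG m, g (bb m) = t ∧ g '' cmp [] hf (some none) = C := by
  obtain ⟨k, hk, e⟩ := to_bb_G h.1 hm
  have h1 := h.image hm k
  rw [e] at h1
  obtain ⟨c, hc⟩ := cell_iff.1 h1
  obtain ⟨f, hfG, hb, hf'⟩ := Rz_G (m := m) (Equiv.swap (some none) c)
  have h2 : f '' cmp [] hf (some none) = cmp [] hf c := by
    have h3 := (cell_cmp (m := m) [] hf (some none)).image hm f
    obtain ⟨x, hx⟩ := cmp_nonempty (m := m) [] hf (some none)
    have h4 := hf' _ x hx
    rw [Equiv.swap_apply_left] at h4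
    have hb2 : f (br [] hf) = br [] hf := hb
    rw [hb2] at h3
    rw [h3.eq_comp ⟨x, hx, rfl⟩, comp_br' _ _ _ h4]
  refine ⟨k⁻¹ * f, mul_mem (inv_mem hk) hfG, ?_, ?_⟩
  · rw [hmul, hb, ← e, hinvl]
  · have : (⇑(k⁻¹ * f) : XX m → XX m) = (⇑(k⁻¹)) ∘ f := rfl
    rw [this, Set.image_comp, h2, ← hc, ← Set.image_comp]
    have h5 : (⇑(k⁻¹) ∘ ⇑k : XX m → XX m) = id := funext fun x => hinvl k x
    rw [h5, Set.image_id]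

theorem img_mul (f g : HX m) (C : Set (XX m)) : (f * g) '' C = f '' (g '' C) := by
  rw [← Set.image_comp]; rfl
theorem img_one (C : Set (XX m)) : (1 : HX m) '' C = C := by
  have : (⇑(1 : HX m) : XX m → XX m) = id := rfl
  rw [this, Set.image_id]
theorem img_inv {f : HX m} {C D : Set (XX m)} (h : f '' C = D) : (f⁻¹ : HX m) '' D = C := by
  rw [← h, ← img_mul, inv_mul_cancel, img_one]

theorem cell_trans (hm : 1 ≤ m) {t t' : XX m} {C C'} (h : Cell t C) (h' : Cell t' C') :
    ∃ g ∈ GG m, g t = t' ∧ g '' C = C' := by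
  obtain ⟨g, hg, e1, e2⟩ := cell_trans0 hm h
  obtain ⟨g', hg', e1', e2'⟩ := cell_trans0 hm h'
  refine ⟨g' * g⁻¹, mul_mem hg' (inv_mem hg), ?_, ?_⟩
  · rw [hmul, ← e1, hinvl, e1']
  · rw [img_mul, img_inv e2, e2']

theorem subcell0 (hm : 1 ≤ m) {q : XX m} {V} (h : Cell q V) (hq : q ∈ Z0 m) (hV : b0 m ∉ V) :
    ∃ k ∈ rist (GG m) (Z0 m), k (bb m) = q ∧ k '' cmp [] hf (some none) = V := by
  obtain ⟨g, hg, e⟩ := to_bb' h.1 hq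
  have h1 := h.image hm g
  rw [e] at h1
  have hq' : g⁻¹ (bb m) = q := by rw [← e, hinvl]
  obtain ⟨c, hc⟩ := cell_iff.1 h1
  have hback : c ≠ none := by
    rintro rfl
    have h2 : b0 m ∈ g '' V := hc ▸ b0_back
    obtain ⟨y, hy, hy'⟩ := h2
    have h3 : y = b0 m := g.injective (hy'.trans (rist_b0 hg).symm)
    exact hV (h3 ▸ hy)
  rcases c with _ | _ | i
  · exact absurd rfl hback
  · exact ⟨g⁻¹, inv_mem hg, hq', img_inv hc⟩
  · refine ⟨g⁻¹ * sg i, mul_mem (inv_mem hg) (sg_r i), by rw [hmul, sg_bb, hq'], ?_⟩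
    have h2 : sg i '' cmp [] hf (some none) = cmp [] hf (some (some i)) := by
      have h3 := (cell_cmp (m := m) [] hf (some none)).image hm (sg i)
      obtain ⟨x, hx⟩ := cmp_nonempty (m := m) [] hf (some none)
      have h4 := sg_maps i _ x hx
      rw [Equiv.swap_apply_left] at h4
      have hb2 : sg i (br [] hf) = br [] hf := sg_bb i
      rw [hb2] at h3
      rw [h3.eq_comp ⟨x, hx, rfl⟩, comp_br' _ _ _ h4]
    rw [img_mul, h2]
    exact img_inv hc

/-- the subcell lemma -/
theorem subcell (hm : 1 ≤ m) {t q q2 : XX m} {Z V V2} (hZ : Cell t Z) (h : Cell q V) (h2 : Cell q2 V2)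
    (hq : q ∈ Z) (hq2 : q2 ∈ Z) (hV : t ∉ V) (hV2 : t ∉ V2) :
    ∃ k ∈ rist (GG m) Z, k q = q2 ∧ k '' V = V2 := by
  obtain ⟨g, hg, e1, e2⟩ := cell_trans hm Z0_cell hZ
  have aux : ∀ {q V}, Cell q V → q ∈ Z → t ∉ V → ∃ k ∈ rist (GG m) (Z0 m), k (bb m) = g⁻¹ q ∧
      k '' cmp [] hf (some none) = (g⁻¹ : HX m) '' V := by
    intro q V h hq hV
    refine subcell0 hm (h.image hm g⁻¹) ?_ ?_
    · rw [← img_inv e2]; exact ⟨q, hq, rfl⟩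
    · rintro ⟨y, hy, hy'⟩
      have : y = t := by rw [← e1, ← hy', hinvr]
      exact hV (this ▸ hy)
  obtain ⟨k1, hk1, a1, a2⟩ := aux h hq hV
  obtain ⟨k2, hk2, c1, c2⟩ := aux h2 hq2 hV2
  refine ⟨g * (k2 * k1⁻¹) * g⁻¹, e2 ▸ rist_conj hg (mul_mem hk2 (inv_mem hk1)), ?_, ?_⟩
  · rw [hmul, hmul, hmul, ← a1, hinvl, c1, hinvr]
  · rw [img_mul, img_mul, img_mul, img_inv a2, c2, ← img_mul, mul_inv_cancel, img_one]

theorem fix_L (hm : 1 ≤ m) {t : XX m} {C} (hC : Cell t C) {f : HX m} (hf0 : f ∈ Fix t) {q : XX m} (hq : isB q)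
    (hqC : q ∈ C) : ∃ h ∈ rist (GG m) C, h⁻¹ * f ∈ Fix q := by
  obtain ⟨g, hg, e1, e2⟩ := cell_trans hm Z0_cell hC
  have h1 : g⁻¹ t = b0 m := by rw [← e1, hinvl]
  have h2 := Fix_conj g⁻¹ hf0
  rw [h1, inv_inv] at h2
  obtain ⟨h, hh, hF⟩ := fix_L0 hm h2 (isB_image hm g⁻¹ hq) (by
    rw [← img_inv e2]; exact ⟨q, hqC, rfl⟩)
  refine ⟨g * h * g⁻¹, e2 ▸ rist_conj hg hh, ?_⟩
  have := Fix_conj g hF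
  rw [hinvr] at this
  convert this using 1
  group

/-- points separating `b0` and `b1` -/
theorem sep_b0_b1 {q : XX m} (hq : isB q) (h0 : q ≠ b0 m) (h1 : q ≠ b1 m) (h : b1 m ∉ comp q (b0 m)) :
    ∃ s : DD, q = br [] s ∧ 1/4 < (s:ℝ) ∧ (s:ℝ) < 3/4 := by
  obtain ⟨w, s, rfl⟩ := hq
  have key : ∀ c, b0 m ∈ cmp w s c → b1 m ∈ cmp w s c → False := by
    intro c hc hc'
    rw [comp_br' _ _ c hc] at h
    exact h hc'
  cases w with
  | cons a w =>
    exfalso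
    refine key none ?_ ?_
    · show (0:ℝ) < s
      exact s.2.1
    · show (0:ℝ) < s
      exact s.2.1
  | nil =>
    refine ⟨s, rfl, ?_, ?_⟩
    · rcases lt_trichotomy (1/4:ℝ) s with h' | h' | h'
      · exact h'
      · exact absurd (by rw [b0]; congr 1; exact Subtype.ext h'.symm) h0
      · refine (key (some none) h' ?_).elim
        show (s:ℝ) < 3/4
        linarith
    · rcases lt_trichotomy (s:ℝ) (3/4) with h' | h' | h'
      · exact h'
      · exact absurd (by rw [b1]; congr 1; exact Subtype.ext h') h1
      · refine (key none ?_ h').elim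
        show (1/4:ℝ) < s
        linarith

theorem fix_A0 (hm : 1 ≤ m) {f : HX m} (h0 : f (b0 m) = b0 m) (h1 : f (b1 m) = b1 m) {q : XX m} (hq : isB q)
    (hq0 : q ≠ b0 m) (hq1 : q ≠ b1 m) (hs : b1 m ∉ comp q (b0 m)) :
    ∃ h ∈ rist (GG m) (I0 m), h⁻¹ * f ∈ Fix q := by
  have hfs : b1 m ∉ comp (f q) (b0 m) := by
    intro h
    rw [← h0, ← h1, mem_comp_image f (Ne.symm hq0)] at h
    exact hs h
  obtain ⟨s', e', a1, a2⟩ := sep_b0_b1 (isB_image hm f hq) (fun e => hq0 (f.injective (e.trans h0.symm)))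
    (fun e => hq1 (f.injective (e.trans h1.symm))) hfs
  obtain ⟨s, rfl, a3, a4⟩ := sep_b0_b1 hq hq0 hq1 hs
  obtain ⟨h1', hh1, M1⟩ := mv_I0 (m := m) s a3 a4
  obtain ⟨h2', hh2, M2⟩ := mv_I0 (m := m) s' a1 a2
  have c0 : b0 m ∉ I0 m := by rw [mem_I0, b0_nil]; norm_num
  have c1 : b1 m ∉ I0 m := by rw [mem_I0, b1_nil]; norm_num
  refine match_Fix hh1 hh2 M1.b (by rw [e']; exact M2.b) fun π hπ => (Rz_I π ?_ ?_).mono (rist_mono Hg_sub)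
  · have h3 := hπ none (b0 m) b0_back
    have h4 : (h2' * f * h1'⁻¹) (b0 m) = b0 m := by
      rw [hmul, hmul, (inv_mem hh1).2 _ c0, h0, hh2.2 _ c0]
    rw [h4] at h3
    exact cmp_disj _ _ h3 b0_back
  · have h3 := hπ (some none) (b1 m) b1_fwd
    have h4 : (h2' * f * h1'⁻¹) (b1 m) = b1 m := by
      rw [hmul, hmul, (inv_mem hh1).2 _ c1, h1, hh2.2 _ c1]
    rw [h4] at h3
    exact cmp_disj _ _ h3 b1_fwd

theorem two_points (hm : 1 ≤ m) {t t' : XX m} (ht : isB t) (ht' : isB t') (h : t ≠ t') :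
    ∃ g ∈ GG m, g (b0 m) = t ∧ g (b1 m) = t' := by
  obtain ⟨g, hg, e1, e2⟩ := cell_trans hm Z0_cell (cell_comp ht (Ne.symm h))
  have hb1 : b1 m ∈ Z0 m := by rw [mem_Z0, b1_nil]; norm_num
  obtain ⟨h1, hh1, a1⟩ := to_bb' (isB_br [] tq) hb1
  obtain ⟨h2, hh2, a2⟩ := to_bb' (q := g⁻¹ t') (isB_image hm _ ht') (by
    rw [← img_inv e2]; exact ⟨t', mem_comp_self (Ne.symm h), rfl⟩)
  refine ⟨g * (h2⁻¹ * h1), mul_mem hg (mul_mem (inv_mem hh2.1) hh1.1), ?_, ?_⟩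
  · rw [hmul, hmul, rist_b0 hh1, rist_b0 (inv_mem hh2), e1]
  · have : h1 (b1 m) = bb m := a1
    rw [hmul, hmul, this, ← a2, hinvl, hinvr]

theorem I0_eq : I0 m = comp (b0 m) (b1 m) ∩ comp (b1 m) (b0 m) := by
  have h1 : comp (b0 m) (b1 m) = cmp [] qt (some none) := by
    apply comp_br'
    show (1/4:ℝ) < 3/4
    norm_num
  have h2 : comp (b1 m) (b0 m) = cmp [] tq none := by
    apply comp_br'
    show (1/4:ℝ) < 3/4
    norm_num
  rw [h1, h2]; rfl

theorem fix_A (hm : 1 ≤ m) {t t' q : XX m} (ht : isB t) (ht' : isB t') (hq : isB q) (htt : t ≠ t')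
    (hqt : q ≠ t) (hqt' : q ≠ t') (hs : t' ∉ comp q t) {f : HX m} (h1 : f t = t) (h2 : f t' = t') :
    ∃ h ∈ rist (GG m) (comp t t' ∩ comp t' t), h⁻¹ * f ∈ Fix q := by
  obtain ⟨g, hg, rfl, rfl⟩ := two_points hm ht ht' htt
  obtain ⟨h, hh, hF⟩ := fix_A0 hm (f := g⁻¹ * f * g) (q := g⁻¹ q) (by simp only [hmul, h1, hinvl])
    (by simp only [hmul, h2, hinvl]) (isB_image hm _ hq) (fun e => hqt (by rw [← e, hinvr]))
    (fun e => hqt' (by rw [← e, hinvr])) (by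
      intro hc
      have := (mem_comp_image g (fun e => hqt (by rw [e, hinvr]))).2 hc
      rw [hinvr] at this
      exact hs this)
  refine ⟨g * h * g⁻¹, ?_, ?_⟩
  · have := rist_conj hg hh
    have e01 : b0 m ≠ b1 m := fun e => htt (by rw [e])
    rw [I0_eq, Set.image_inter g.injective, comp_image g e01.symm, comp_image g e01] at this
    exact this
  · have := Fix_conj g hF
    rw [hinvr] at this
    convert this using 1
    group

end Waz

open Topology
/-! ## Part 6 : density -/

namespace Waz
variable {m : ℕ}

theorem br_nil_ne (w : EE m) (r : DD) : (br w r).1 [] ≠ 0 := by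
  cases w with
  | nil => exact r.2.1.ne'
  | cons a w => exact a.1.2.1.ne'

theorem br_snoc_parent (v : EE m) (a : DD × Fin m) (r : DD) : (br (v ++ [a]) r).1 v = a.1 :=
  (br (v ++ [a]) r).2.par v a (by rw [br_self]; exact r.2.1.ne')

theorem br_snoc (v : EE m) (a : DD × Fin m) (r : DD) (w : EE m) (h0 : (br (v ++ [a]) r).1 w ≠ 0)
    (hw : w ≠ v ++ [a]) : (br (v ++ [a]) r).1 w = (br v a.1).1 w := by
  refine det v _ _ ?_ ?_ w ?_
  · rw [br_snoc_parent, br_self]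
  · rw [br_snoc_parent]; exact a.1.2.1.ne'
  · rintro ⟨b, u, rfl⟩
    have h1 : (br (v ++ [a]) r).1 (v ++ [b]) ≠ 0 := by
      intro h
      apply h0
      have := zero_ext _ _ u h
      rwa [List.append_assoc] at this
    have h2 : (br (v ++ [a]) r).1 (v ++ [a]) ≠ 0 := by rw [br_self]; exact r.2.1.ne'
    obtain rfl := (br (v ++ [a]) r).2.ex _ _ _ h2 h1
    cases u with
    | nil => exact hw rfl
    | cons c u =>
      apply h0
      have := zero_ext _ _ u (br_child (v ++ [a]) r c)
      simpa using this

/-- parent-closed sets of branch points -/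
def PC (T : Set (EE m × DD)) : Prop := ∀ v a r, (v ++ [a], r) ∈ T → (v, a.1) ∈ T

theorem PC.val {T : Set (EE m × DD)} (hT : PC T) (w : EE m) : ∀ (w' : EE m) (r' : DD), (w', r') ∈ T →
    (br w' r').1 w ≠ 0 → ∃ s : DD, (br w' r').1 w = s ∧ (w, s) ∈ T := by
  intro w'
  induction w' using List.reverseRecOn with
  | nil =>
    intro r' h h0
    cases w with
    | nil => exact ⟨r', rfl, h⟩
    | cons a w => exact absurd rfl h0
  | append_singleton v a ih =>
    intro r' h h0
    by_cases hw : w = v ++ [a]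
    · subst hw
      exact ⟨r', br_self _ _, h⟩
    · have e := br_snoc v a r' w h0 hw
      rw [e] at h0 ⊢
      exact ih _ (hT _ _ _ h) h0

def Good (f : HX m) (T : Set (EE m × DD)) : Prop :=
  ∃ g ∈ GG m, ∀ t ∈ T, g⁻¹ * f ∈ Fix (br t.1 t.2)

theorem Cvx.inter {S S' : Set (XX m)} (h : Cvx S) (h' : Cvx S') : Cvx (S ∩ S') :=
  fun x hx y hy _ hz => ⟨h x hx.1 y hy.1 hz, h' x hx.2 y hy.2 hz⟩

theorem exists_upper {T : Set (EE m × DD)} (hfin : T.Finite) (w : EE m) (r : DD) :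
    (∃ s, (w, s) ∈ T ∧ (r:ℝ) < s ∧ ∀ s', (w, s') ∈ T → (r:ℝ) < s' → (s:ℝ) ≤ s') ∨
      ∀ s', (w, s') ∈ T → ¬ (r:ℝ) < s' := by
  by_cases h : ∃ s, (w, s) ∈ T ∧ (r:ℝ) < s
  · left
    obtain ⟨s, hs⟩ := h
    have hf' : {p : EE m × DD | p ∈ T ∧ p.1 = w ∧ (r:ℝ) < p.2}.Finite := hfin.subset fun p hp => hp.1
    obtain ⟨⟨w', s⟩, ⟨h1, h2, h3⟩, h4⟩ := Set.exists_min_image _ (fun p => (p.2 : ℝ)) hf' ⟨(w, s), hs.1, rfl, hs.2⟩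
    obtain rfl : w' = w := h2
    exact ⟨s, h1, h3, fun s' hs' hr => h4 (w', s') ⟨hs', rfl, hr⟩⟩
  · right
    intro s' hs' hr
    exact h ⟨s', hs', hr⟩

theorem exists_lower {T : Set (EE m × DD)} (hfin : T.Finite) (w : EE m) (r : DD) :
    (∃ s, (w, s) ∈ T ∧ (s:ℝ) < r ∧ ∀ s', (w, s') ∈ T → (s':ℝ) < r → (s':ℝ) ≤ s) ∨
      ∀ s', (w, s') ∈ T → ¬ (s':ℝ) < r := by
  by_cases h : ∃ s, (w, s) ∈ T ∧ (s:ℝ) < r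
  · left
    obtain ⟨s, hs⟩ := h
    have hf' : {p : EE m × DD | p ∈ T ∧ p.1 = w ∧ (p.2:ℝ) < r}.Finite := hfin.subset fun p hp => hp.1
    obtain ⟨⟨w', s⟩, ⟨h1, h2, h3⟩, h4⟩ := Set.exists_max_image _ (fun p => (p.2 : ℝ)) hf' ⟨(w, s), hs.1, rfl, hs.2⟩
    obtain rfl : w' = w := h2
    exact ⟨s, h1, h3, fun s' hs' hr => h4 (w', s') ⟨hs', rfl, hr⟩⟩
  · right
    intro s' hs' hr
    exact h ⟨s', hs', hr⟩

theorem cell_lower {T : Set (EE m × DD)} (hfin : T.Finite) (w : EE m) (r : DD)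
    (hp : w = [] ∨ ∃ v a, w = v ++ [a] ∧ (v, a.1) ∈ T) :
    (∃ t ∈ T, ∃ a : ℝ, (br t.1 t.2).1 w = a ∧ a < r ∧ Cell (br t.1 t.2) {x : XX m | a < x.1 w} ∧
      ∀ s', (w, s') ∈ T → (s':ℝ) < r → (s':ℝ) ≤ a) ∨
    (w = [] ∧ ∀ s', (w, s') ∈ T → ¬ (s':ℝ) < r) := by
  rcases exists_lower hfin w r with ⟨s, h1, h2, h3⟩ | h
  · exact Or.inl ⟨(w, s), h1, s, br_self _ _, h2, cell_cmp w s (some none), h3⟩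
  · rcases hp with hw | ⟨v, a, rfl, ha⟩
    · exact Or.inr ⟨hw, h⟩
    · left
      exact ⟨(v, a.1), ha, 0, br_child _ _ _, r.2.1, cell_cmp v a.1 (some (some a.2)),
        fun s' hs' hr => absurd hr (h s' hs')⟩

theorem insert_aux (hm : 1 ≤ m) {T : Set (EE m × DD)} (hfin : T.Finite) (hT : PC T) (w : EE m) (r : DD)
    (hr : (w, r) ∉ T) (hp : w = [] ∨ ∃ v a, w = v ++ [a] ∧ (v, a.1) ∈ T) (f : HX m)
    (hf' : ∀ t ∈ T, f ∈ Fix (br t.1 t.2)) :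
    ∃ h ∈ GG m, (∀ t ∈ T, h ∈ Fix (br t.1 t.2)) ∧ h⁻¹ * f ∈ Fix (br w r) := by
  have hne : ∀ s, (w, s) ∈ T → (s:ℝ) < r ∨ (r:ℝ) < s := by
    intro s hs
    rcases lt_trichotomy (s:ℝ) r with h | h | h
    · exact Or.inl h
    · exact absurd (Subtype.ext h ▸ hs) hr
    · exact Or.inr h
  have fin : ∀ C : Set (XX m), Cvx C → (∀ t ∈ T, br t.1 t.2 ∉ C) →
      (∃ h ∈ rist (GG m) C, h⁻¹ * f ∈ Fix (br w r)) →
      ∃ h ∈ GG m, (∀ t ∈ T, h ∈ Fix (br t.1 t.2)) ∧ h⁻¹ * f ∈ Fix (br w r) := by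
    rintro C hC hd ⟨h, hh, hF⟩
    exact ⟨h, hh.1, fun t ht => rist_Fix hh hC.isPreconnected (hd t ht), hF⟩
  rcases cell_lower hfin w r hp with ⟨t, ht, a, h1, h2, h3, h4⟩ | ⟨rfl, h4⟩
  · have a0 : 0 ≤ a := h1 ▸ (br t.1 t.2).2.nn w
    rcases exists_upper hfin w r with ⟨s, g1, g2, g3⟩ | g3
    · have e1 : comp (br t.1 t.2) (br w s) = {x : XX m | a < x.1 w} := by
        refine (h3.eq_comp ?_).symm
        show a < (br w s).1 w
        rw [br_self]; linarith
      have e2 : comp (br w s) (br t.1 t.2) = {x : XX m | x.1 w < s} := by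
        refine comp_br' w s none ?_
        show (br t.1 t.2).1 w < s
        rw [h1]; linarith
      have e3 : comp (br w r) (br t.1 t.2) = {x : XX m | x.1 w < r} := by
        refine comp_br' w r none ?_
        show (br t.1 t.2).1 w < r
        rw [h1]; linarith
      have n1 : br t.1 t.2 ≠ br w s := by
        intro e
        have := congrArg (fun x : XX m => x.1 w) e
        simp only [h1, br_self] at this
        linarith
      have n2 : br w r ≠ br t.1 t.2 := by
        intro e
        have := congrArg (fun x : XX m => x.1 w) e
        simp only [h1, br_self] at this
        linarith
      have n3 : br w r ≠ br w s := by
        intro e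
        have := congrArg (fun x : XX m => x.1 w) e
        simp only [br_self] at this
        linarith
      refine fin ({x : XX m | a < x.1 w} ∩ {x : XX m | x.1 w < s}) ((cvx_gt _ _).inter (cvx_lt _ _)) ?_ ?_
      · rintro ⟨w', r'⟩ ht' ⟨c1, c2⟩
        have c1 : a < (br w' r').1 w := c1
        have c2 : (br w' r').1 w < s := c2
        obtain ⟨s', c3, c4⟩ := hT.val w w' r' ht' (by linarith)
        rw [c3] at c1 c2
        rcases hne s' c4 with h | h
        · linarith [h4 s' c4 h]
        · linarith [g3 s' c4 h]
      · have := fix_A hm (isB_br t.1 t.2) (isB_br w s) (isB_br w r) n1 n2 n3 (by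
          rw [e3]
          intro hc
          have hc : (br w s).1 w < r := hc
          rw [br_self] at hc
          linarith) (hf' t ht).1 (hf' (w, s) g1).1
        rwa [e1, e2] at this
    · refine fin {x : XX m | a < x.1 w} (cvx_gt _ _) ?_ ?_
      · rintro ⟨w', r'⟩ ht' c1
        have c1 : a < (br w' r').1 w := c1
        obtain ⟨s', c3, c4⟩ := hT.val w w' r' ht' (by linarith)
        rw [c3] at c1
        rcases hne s' c4 with h | h
        · linarith [h4 s' c4 h]
        · exact g3 s' c4 h
      · refine fix_L hm h3 (hf' t ht) (isB_br w r) ?_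
        show a < (br w r).1 w
        rwa [br_self]
  · rcases exists_upper hfin [] r with ⟨s, g1, g2, g3⟩ | g3
    · refine fin {x : XX m | x.1 [] < s} (cvx_lt _ _) ?_ ?_
      · rintro ⟨w', r'⟩ ht' c1
        have c1 : (br w' r').1 [] < s := c1
        obtain ⟨s', c3, c4⟩ := hT.val [] w' r' ht' (br_nil_ne _ _)
        rw [c3] at c1
        rcases hne s' c4 with h | h
        · exact h4 s' c4 h
        · linarith [g3 s' c4 h]
      · refine fix_L hm (cell_cmp [] s none) (hf' _ g1) (isB_br [] r) ?_
        show (br [] r).1 [] < s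
        rwa [br_self]
    · have hemp : ∀ t, t ∉ T := by
        rintro ⟨w', r'⟩ ht'
        obtain ⟨s', c3, c4⟩ := hT.val [] w' r' ht' (br_nil_ne _ _)
        rcases hne s' c4 with h | h
        · exact h4 s' c4 h
        · exact g3 s' c4 h
      obtain ⟨h, hh, hF⟩ := fix_i hm f (isB_br [] r)
      exact ⟨h, hh, fun t ht => absurd ht (hemp t), hF⟩

theorem insert_good (hm : 1 ≤ m) (f : HX m) {T : Set (EE m × DD)} (hfin : T.Finite) (hT : PC T) (w : EE m) (r : DD)
    (hp : w = [] ∨ ∃ v a, w = v ++ [a] ∧ (v, a.1) ∈ T) (hg : Good f T) :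
    Good f (insert (w, r) T) := by
  by_cases hr : (w, r) ∈ T
  · rwa [Set.insert_eq_of_mem hr]
  obtain ⟨g, hg, hgT⟩ := hg
  obtain ⟨h, hh, h1, h2⟩ := insert_aux hm hfin hT w r hr hp (g⁻¹ * f) hgT
  refine ⟨g * h, mul_mem hg hh, ?_⟩
  have e : (g * h)⁻¹ * f = h⁻¹ * (g⁻¹ * f) := by group
  rw [e]
  intro t ht
  rcases ht with rfl | ht
  · exact h2
  · exact mul_mem (inv_mem (h1 t ht)) (hgT t ht)

theorem insert_PC {T : Set (EE m × DD)} (hT : PC T) (w : EE m) (r : DD)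
    (hp : w = [] ∨ ∃ v a, w = v ++ [a] ∧ (v, a.1) ∈ T) : PC (insert (w, r) T) := by
  rintro v a s (h | h)
  · have h1 : v ++ [a] = w := (Prod.ext_iff.1 h).1
    right
    rcases hp with rfl | ⟨v', a', e, h'⟩
    · simp at h1
    · rw [e] at h1
      obtain ⟨rfl, h2⟩ := List.append_inj' h1 rfl
      obtain rfl : a = a' := by simpa using h2
      exact h'
  · exact Or.inr (hT _ _ _ h)

theorem extend_one (hm : 1 ≤ m) (f : HX m) (w : EE m) : ∀ (r : DD) (T : Set (EE m × DD)), T.Finite → PC T → Good f T →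
    ∃ T' : Set (EE m × DD), T'.Finite ∧ PC T' ∧ Good f T' ∧ T ⊆ T' ∧ (w, r) ∈ T' := by
  induction w using List.reverseRecOn with
  | nil =>
    intro r T h1 h2 h3
    exact ⟨insert ([], r) T, h1.insert _, insert_PC h2 _ _ (Or.inl rfl), insert_good hm f h1 h2 _ _ (Or.inl rfl) h3,
      Set.subset_insert _ _, Set.mem_insert _ _⟩
  | append_singleton v a ih =>
    intro r T h1 h2 h3
    obtain ⟨T', c1, c2, c3, c4, c5⟩ := ih a.1 T h1 h2 h3
    have hp : v ++ [a] = [] ∨ ∃ v' a', v ++ [a] = v' ++ [a'] ∧ (v', a'.1) ∈ T' := Or.inr ⟨v, a, rfl, c5⟩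
    exact ⟨insert (v ++ [a], r) T', c1.insert _, insert_PC c2 _ _ hp, insert_good hm f c1 c2 _ _ hp c3,
      c4.trans (Set.subset_insert _ _), Set.mem_insert _ _⟩

theorem all_good (hm : 1 ≤ m) (f : HX m) (T0 : Set (EE m × DD)) (h0 : T0.Finite) : Good f T0 := by
  have key : ∃ T' : Set (EE m × DD), T'.Finite ∧ PC T' ∧ Good f T' ∧ T0 ⊆ T' := by
    induction T0, h0 using Set.Finite.induction_on with
    | empty =>
      exact ⟨∅, Set.finite_empty, fun _ _ _ h => h.elim, ⟨1, one_mem _, fun _ h => h.elim⟩, le_rfl⟩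
    | insert _ _ ih =>
      rename_i a s _ _
      obtain ⟨T', c1, c2, c3, c4⟩ := ih
      obtain ⟨T2, d1, d2, d3, d4, d5⟩ := extend_one hm f a.1 a.2 T' c1 c2 c3
      exact ⟨T2, d1, d2, d3, Set.insert_subset d5 (c4.trans d4)⟩
  obtain ⟨T', _, _, ⟨g, hg, h⟩, hs⟩ := key
  exact ⟨g, hg, fun t ht => h t (hs ht)⟩

theorem finite_grid (N : ℕ) : {s : DD | ∃ j : ℕ, (s:ℝ) * 2 ^ N = j}.Finite := by
  have : (Set.Iic (2 ^ N) : Set ℕ).Finite := Set.finite_Iic _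
  refine Set.Finite.of_finite_image ((this.image (fun j : ℕ => (j:ℝ) / 2 ^ N)).subset ?_)
    (Set.injOn_of_injective Subtype.val_injective)
  rintro _ ⟨s, ⟨j, hj⟩, rfl⟩
  refine ⟨j, ?_, ?_⟩
  · have h1 : (j:ℝ) ≤ 2 ^ N := by
      rw [← hj]
      have : (0:ℝ) < 2 ^ N := by positivity
      nlinarith [s.2.2.1]
    show j ≤ 2 ^ N
    exact_mod_cast h1
  · show (j:ℝ) / 2 ^ N = s
    rw [← hj]; field_simp

theorem grid_between (N : ℕ) {a b : ℝ} (ha : 0 ≤ a) (hb : b ≤ 1) (h : a + 1 / 2 ^ N < b) :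
    ∃ s : DD, (∃ j : ℕ, (s:ℝ) * 2 ^ N = j) ∧ a < s ∧ (s:ℝ) < b := by
  have p : (0:ℝ) < 2 ^ N := by positivity
  have h1 := Nat.lt_floor_add_one (a * 2 ^ N)
  have h2 := Nat.floor_le (mul_nonneg ha p.le)
  set k := ⌊a * 2 ^ N⌋₊
  have e : ((k:ℝ) + 1) / 2 ^ N * 2 ^ N = ((k + 1 : ℕ) : ℝ) := by push_cast; field_simp
  have c1 : a < ((k:ℝ) + 1) / 2 ^ N := by rwa [lt_div_iff₀ p]
  have c2 : ((k:ℝ) + 1) / 2 ^ N < b := by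
    refine lt_of_le_of_lt ?_ h
    rw [add_div]
    gcongr
    rwa [div_le_iff₀ p]
  exact ⟨⟨((k:ℝ) + 1) / 2 ^ N, by positivity, by linarith, N, k + 1, by rw [e]; push_cast; rfl⟩, ⟨k + 1, e⟩, c1, c2⟩

theorem approx (hm : 1 ≤ m) (f : HX m) (F : Finset (EE m)) (N : ℕ) :
    ∃ g ∈ GG m, ∀ x, ∀ e ∈ F, |(g x).1 e - (f x).1 e| ≤ 1 / 2 ^ N := by
  obtain ⟨k, hk, hF⟩ := all_good hm f⁻¹ ((F : Set (EE m)) ×ˢ {s : DD | ∃ j : ℕ, (s:ℝ) * 2 ^ N = j})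
    (F.finite_toSet.prod (finite_grid N))
  refine ⟨k⁻¹, inv_mem hk, fun x e he => ?_⟩
  set y := f x
  have hx : k⁻¹ x = (k⁻¹ * f⁻¹) y := by rw [hmul, hinvl]
  rw [hx]
  set c := k⁻¹ * f⁻¹
  have key : ∀ s : DD, (∃ j : ℕ, (s:ℝ) * 2 ^ N = j) → ∀ d, y ∈ cmp e s d → c y ∈ cmp e s d := by
    intro s hs d hy
    have h := hF (e, s) ⟨he, hs⟩
    have := h.2 y ((cmp_hS e s y).2 ⟨d, hy⟩)
    rwa [comp_br' e s d hy] at this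
  rw [abs_le]
  constructor
  · by_contra hcon
    push Not at hcon
    obtain ⟨s, hs, c1, c2⟩ := grid_between N ((c y).2.nn e) (y.2.le e) (by linarith)
    have : (s:ℝ) < (c y).1 e := key s hs (some none) c2
    linarith
  · by_contra hcon
    push Not at hcon
    obtain ⟨s, hs, c1, c2⟩ := grid_between N (y.2.nn e) ((c y).2.le e) (by linarith)
    have : (c y).1 e < s := key s hs none c1
    linarith

theorem GG_dense (hm : 1 ≤ m) : Dense (GG m : Set (HX m)) := by
  intro f
  choose g hg happ using fun p : Finset (EE m) × ℕ => approx hm f p.1 p.2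
  refine mem_closure_of_tendsto (f := g) (b := Filter.atTop) ?_ (Filter.Eventually.of_forall hg)
  rw [nhds_induced, Filter.tendsto_comap_iff, ContinuousMap.tendsto_iff_tendstoUniformly,
    tendstoUniformly_iff_tendsto, uniformity_subtype, Filter.tendsto_comap_iff, Pi.uniformity,
    Filter.tendsto_iInf]
  intro e
  rw [Filter.tendsto_comap_iff, Metric.uniformity_basis_dist.tendsto_right_iff]
  intro ε hε
  obtain ⟨N, hN⟩ := exists_pow_lt_of_lt_one hε (show (1/2:ℝ) < 1 by norm_num)
  have : ∀ᶠ p : Finset (EE m) × ℕ in Filter.atTop, ({e}, N) ≤ p := Filter.eventually_ge_atTop _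
  have h2 := this.prod_inl (⊤ : Filter (XX m))
  filter_upwards [h2] with p hp
  have h3 := happ p.1 p.2 e (hp.1 (by simp))
  show dist ((f p.2).1 e) ((g p.1 p.2).1 e) < ε
  rw [dist_comm, Real.dist_eq]
  refine h3.trans_lt (lt_of_le_of_lt ?_ hN)
  rw [← one_div_pow]
  exact pow_le_pow_of_le_one (by norm_num) (by norm_num) hp.2

end Waz

open Topology
/-! ## Part 7 : an abstract simplicity criterion -/

namespace Waz

section Abstract
open scoped Pointwise commutatorElement

variable {Γ X : Type*} [Group Γ] [MulAction Γ X]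

/-- rigid stabiliser -/
def RS (Γ : Type*) {X : Type*} [Group Γ] [MulAction Γ X] (U : Set X) : Subgroup Γ where
  carrier := {g | ∀ x, x ∉ U → g • x = x}
  one_mem' := fun x _ => one_smul _ x
  mul_mem' := by
    intro f g hf hg x hx
    rw [mul_smul, hg x hx, hf x hx]
  inv_mem' := by
    intro f hf x hx
    rw [inv_smul_eq_iff, hf x hx]

theorem RS_mono {U V : Set X} (h : U ⊆ V) : RS Γ U ≤ RS Γ V := fun _ hg x hx => hg x fun h' => hx (h h')

theorem RS_conj {U : Set X} {g : Γ} (c : Γ) (hg : g ∈ RS Γ U) : c * g * c⁻¹ ∈ RS Γ (c • U) := by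
  intro x hx
  rw [Set.mem_smul_set_iff_inv_smul_mem] at hx
  rw [mul_smul, mul_smul, hg _ hx, smul_inv_smul]

theorem RS_conj' {U : Set X} {g : Γ} (c : Γ) (hg : g ∈ RS Γ (c • U)) : c⁻¹ * g * c ∈ RS Γ U := by
  have := RS_conj c⁻¹ hg
  rwa [inv_smul_smul, inv_inv] at this

theorem RS_mem {U : Set X} {g : Γ} (hg : g ∈ RS Γ U) {x : X} (hx : x ∈ U) : g • x ∈ U := by
  by_contra hn
  have h1 := hg _ hn
  have h2 := smul_left_cancel g h1
  rw [h2] at hn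
  exact hn hx

theorem RS_comm [FaithfulSMul Γ X] {U V : Set X} (h : Disjoint U V) {a b : Γ} (ha : a ∈ RS Γ U) (hb : b ∈ RS Γ V) :
    Commute a b := by
  apply eq_of_smul_eq_smul (α := X)
  intro x
  rw [mul_smul, mul_smul]
  by_cases hx : x ∈ U
  · have h1 : x ∉ V := Set.disjoint_left.1 h hx
    have h2 : a • x ∉ V := Set.disjoint_left.1 h (RS_mem ha hx)
    rw [hb x h1, hb _ h2]
  · by_cases hx' : x ∈ V
    · have h2 : b • x ∉ U := Set.disjoint_right.1 h (RS_mem hb hx')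
      rw [ha x hx, ha _ h2]
    · rw [ha x hx, hb x hx', ha x hx]

theorem comm_L1 {z p b : Γ} (h : Commute z (p * b * p⁻¹)) : ⁅z * p, b⁆ = ⁅p, b⁆ := by
  have h1 : z * (p * b * p⁻¹) * z⁻¹ = p * b * p⁻¹ := by rw [h.eq]; group
  calc ⁅z * p, b⁆ = z * (p * b * p⁻¹) * z⁻¹ * b⁻¹ := by rw [commutatorElement_def]; group
    _ = ⁅p, b⁆ := by rw [h1, commutatorElement_def]

theorem comm_L2 {B a b : Γ} (h : Commute B a) : ⁅a, b * B⁆ = ⁅a, b⁆ := by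
  have h1 : B * a⁻¹ * B⁻¹ = a⁻¹ := by rw [h.inv_right.eq]; group
  calc ⁅a, b * B⁆ = a * b * (B * a⁻¹ * B⁻¹) * b⁻¹ := by rw [commutatorElement_def]; group
    _ = ⁅a, b⁆ := by rw [h1, commutatorElement_def]

/-- hypotheses of the simplicity criterion -/
structure CellSys (Γ : Type*) {X : Type*} [Group Γ] [MulAction Γ X] (C : Set (Set X)) : Prop where
  ne : C.Nonempty
  ne' : ∀ U ∈ C, U.Nonempty
  h1 : ∀ g : Γ, g ≠ 1 → ∃ W ∈ C, Disjoint (g • W) W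
  h2 : ∀ U ∈ C, ∀ V ∈ C, ∃ c : Γ, c • U = V
  h2' : ∀ U ∈ C, ∀ c : Γ, c • U ∈ C
  h3 : ∀ W ∈ C, ∃ U1 ∈ C, ∃ U2 ∈ C, ∃ U3 ∈ C, U1 ⊆ W ∧ U2 ⊆ W ∧ U3 ⊆ W ∧
    Disjoint U1 U2 ∧ Disjoint U1 U3 ∧ Disjoint U2 U3
  h4 : Subgroup.closure {g : Γ | ∃ U ∈ C, g ∈ RS Γ U} = ⊤
  h5 : ∀ U ∈ C, ∀ V ∈ C, Disjoint U V ∨ (∃ W ∈ C, U ⊆ W ∧ V ⊆ W) ∨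
    ∃ Z ∈ C, V ⊆ Z ∧ ∃ k ∈ RS Γ Z, Disjoint U (k • V)
  h6 : ∀ U ∈ C, ∃ V ∈ C, Disjoint U V

namespace CellSys
variable {C : Set (Set X)}

theorem mem_comm (a b : Γ) : ⁅a, b⁆ ∈ commutator Γ := by
  rw [commutator_def]
  exact Subgroup.commutator_mem_commutator (Subgroup.mem_top _) (Subgroup.mem_top _)

theorem trans0 (H : CellSys Γ C) (g : Γ) : ∀ U ∈ C, ∃ h ∈ commutator Γ, h • U = g • U := by
  have hg : g ∈ Subgroup.closure {g : Γ | ∃ U ∈ C, g ∈ RS Γ U} := by rw [H.h4]; exact Subgroup.mem_top _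
  induction hg using Subgroup.closure_induction with
  | mem g hg =>
    intro U hU
    obtain ⟨W, hW, hgW⟩ := hg
    obtain ⟨V, hV, hd⟩ := H.h6 U hU
    obtain ⟨c, hc⟩ := H.h2 W hW V hV
    refine ⟨⁅g, c⁆, mem_comm _ _, ?_⟩
    have h1 : c * g⁻¹ * c⁻¹ ∈ RS Γ V := hc ▸ RS_conj c (inv_mem hgW)
    have h2 : (c * g⁻¹ * c⁻¹) • U = U := by
      have : ∀ x ∈ U, (c * g⁻¹ * c⁻¹) • x = x := fun x hx => h1 x (Set.disjoint_left.1 hd hx)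
      ext y
      constructor
      · rintro ⟨x, hx, rfl⟩
        show (c * g⁻¹ * c⁻¹) • x ∈ U
        rwa [this x hx]
      · intro hy
        exact ⟨y, hy, this y hy⟩
    have h3 : ⁅g, c⁆ = g * (c * g⁻¹ * c⁻¹) := by rw [commutatorElement_def]; group
    rw [h3, mul_smul, h2]
  | one => exact fun U _ => ⟨1, one_mem _, rfl⟩
  | mul x y _ _ hx hy =>
    intro U hU
    obtain ⟨h, hh, e⟩ := hy U hU
    obtain ⟨h', hh', e'⟩ := hx (y • U) (H.h2' U hU y)
    exact ⟨h' * h, mul_mem hh' hh, by rw [mul_smul, e, e', mul_smul]⟩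
  | inv x _ hx =>
    intro U hU
    obtain ⟨h, hh, e⟩ := hx (x⁻¹ • U) (H.h2' U hU _)
    refine ⟨h⁻¹, inv_mem hh, ?_⟩
    rw [smul_inv_smul] at e
    rw [inv_smul_eq_iff, e]

theorem trans (H : CellSys Γ C) {U V : Set X} (hU : U ∈ C) (hV : V ∈ C) : ∃ h ∈ commutator Γ, h • U = V := by
  obtain ⟨c, hc⟩ := H.h2 U hU V hV
  obtain ⟨h, hh, e⟩ := H.trans0 c U hU
  exact ⟨h, hh, e.trans hc⟩

/-- all local commutators -/
def LC (Γ : Type*) {X : Type*} [Group Γ] [MulAction Γ X] (C : Set (Set X)) : Set Γ :=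
  {x | ∃ U ∈ C, ∃ a ∈ RS Γ U, ∃ b ∈ RS Γ U, ⁅a, b⁆ = x}

theorem comm_le [FaithfulSMul Γ X] (H : CellSys Γ C) : commutator Γ ≤ Subgroup.normalClosure (LC Γ C) := by
  set M := Subgroup.normalClosure (LC Γ C)
  have hLC : LC Γ C ⊆ M := Subgroup.subset_normalClosure
  let π := QuotientGroup.mk' M
  have hπ : ∀ U ∈ C, ∀ a ∈ RS Γ U, ∀ b ∈ RS Γ U, Commute (π a) (π b) := by
    intro U hU a ha b hb
    rw [← commutatorElement_eq_one_iff_commute, ← map_commutatorElement]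
    exact (QuotientGroup.eq_one_iff _).2 (hLC ⟨U, hU, a, ha, b, hb, rfl⟩)
  have hgen : ∀ a b : Γ, (∃ U ∈ C, a ∈ RS Γ U) → (∃ V ∈ C, b ∈ RS Γ V) → Commute (π a) (π b) := by
    rintro a b ⟨U, hU, ha⟩ ⟨V, hV, hb⟩
    rcases H.h5 U hU V hV with h | ⟨W, hW, h1, h2⟩ | ⟨Z, hZ, hVZ, k, hk, hd⟩
    · exact (RS_comm h ha hb).map π
    · exact hπ W hW a (RS_mono h1 ha) b (RS_mono h2 hb)
    · have h1 : Commute (π a) (π (k * b * k⁻¹)) := (RS_comm hd ha (RS_conj k hb)).map π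
      have h2 : π (k * b * k⁻¹) = π b := by
        have := hπ Z hZ k hk b (RS_mono hVZ hb)
        rw [map_mul, map_mul, this.eq, map_inv, mul_inv_cancel_right]
      rwa [h2] at h1
  have hall : ∀ a b : Γ, Commute (π a) (π b) := by
    intro a b
    have ha : a ∈ Subgroup.closure {g : Γ | ∃ U ∈ C, g ∈ RS Γ U} := by rw [H.h4]; exact Subgroup.mem_top _
    have hb : b ∈ Subgroup.closure {g : Γ | ∃ U ∈ C, g ∈ RS Γ U} := by rw [H.h4]; exact Subgroup.mem_top _
    induction ha using Subgroup.closure_induction with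
    | mem a ha =>
      induction hb using Subgroup.closure_induction with
      | mem b hb => exact hgen a b ha hb
      | one => rw [map_one]; exact Commute.one_right _
      | mul x y _ _ hx hy => rw [map_mul]; exact hx.mul_right hy
      | inv x _ hx => rw [map_inv]; exact hx.inv_right
    | one => rw [map_one]; exact Commute.one_left _
    | mul x y _ _ hx hy => rw [map_mul]; exact hx.mul_left hy
    | inv x _ hx => rw [map_inv]; exact hx.inv_left
  rw [commutator_def, Subgroup.commutator_le]
  intro a _ b _
  have := hall a b
  rw [← commutatorElement_eq_one_iff_commute, ← map_commutatorElement] at this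
  exact (QuotientGroup.eq_one_iff _).1 this

theorem key [FaithfulSMul Γ X] (H : CellSys Γ C) (N : Subgroup Γ) (hnorm : ∀ h ∈ commutator Γ, ∀ n ∈ N, h * n * h⁻¹ ∈ N)
    {g : Γ} (hg : g ∈ N) (hg1 : g ≠ 1) : commutator Γ ≤ N := by
  obtain ⟨W, hW, hgW⟩ := H.h1 g hg1
  obtain ⟨U1, hU1, U2, hU2, U3, hU3, s1, s2, s3, d12, d13, d23⟩ := H.h3 W hW
  obtain ⟨c, hc⟩ := H.h2 U1 hU1 U2 hU2
  obtain ⟨d, hd⟩ := H.h2 U1 hU1 U3 hU3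
  have hN : ∀ x ∈ N, ∀ h ∈ commutator Γ, ⁅x, h⁆ ∈ N := by
    intro x hx h hh
    have e : ⁅x, h⁆ = x * (h * x⁻¹ * h⁻¹) := by rw [commutatorElement_def]; group
    rw [e]
    exact mul_mem hx (hnorm h hh _ (inv_mem hx))
  have base : ∀ a ∈ RS Γ U1, ∀ b ∈ RS Γ U1, ⁅a, b⁆ ∈ N := by
    intro a ha b hb
    -- work with the inverse of `a`
    have hA : c * a⁻¹ * c⁻¹ ∈ RS Γ U2 := hc ▸ RS_conj c (inv_mem ha)
    have hB : d * b⁻¹ * d⁻¹ ∈ RS Γ U3 := hd ▸ RS_conj d (inv_mem hb)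
    have e1 : ⁅a⁻¹, c⁆⁻¹ = c * a⁻¹ * c⁻¹ * a := by rw [commutatorElement_def]; group
    have e2 : ⁅b, d⁆ = b * (d * b⁻¹ * d⁻¹) := by rw [commutatorElement_def]; group
    have w1 : ⁅a⁻¹, c⁆⁻¹ ∈ RS Γ W := by
      rw [e1]; exact mul_mem (RS_mono s2 hA) (RS_mono s1 ha)
    have w2 : ⁅b, d⁆ ∈ RS Γ W := by
      rw [e2]; exact mul_mem (RS_mono s1 hb) (RS_mono s3 hB)
    have f1 : ⁅⁅g, ⁅a⁻¹, c⁆⁆, ⁅b, d⁆⁆ ∈ N := hN _ (hN g hg _ (mem_comm _ _)) _ (mem_comm _ _)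
    have f2 : ⁅g, ⁅a⁻¹, c⁆⁆ = (g * ⁅a⁻¹, c⁆ * g⁻¹) * ⁅a⁻¹, c⁆⁻¹ := commutatorElement_def _ _
    have w3 : g * ⁅a⁻¹, c⁆ * g⁻¹ ∈ RS Γ (g • W) := RS_conj g (by
      have := inv_mem w1
      rwa [inv_inv] at this)
    rw [f2, comm_L1 (RS_comm hgW w3 (mul_mem (mul_mem w1 w2) (inv_mem w1))), e1, e2] at f1
    have k1 : Commute (c * a⁻¹ * c⁻¹) (a * (b * (d * b⁻¹ * d⁻¹)) * a⁻¹) := by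
      have c1 : Commute (c * a⁻¹ * c⁻¹) a := RS_comm d12.symm hA ha
      have c2 : Commute (c * a⁻¹ * c⁻¹) b := RS_comm d12.symm hA hb
      have c3 : Commute (c * a⁻¹ * c⁻¹) (d * b⁻¹ * d⁻¹) := RS_comm d23 hA hB
      exact (c1.mul_right (c2.mul_right c3)).mul_right c1.inv_right
    rw [comm_L1 k1, comm_L2 (RS_comm d13.symm hB ha)] at f1
    exact f1
  have hall : LC Γ C ⊆ N := by
    rintro _ ⟨U, hU, a, ha, b, hb, rfl⟩
    obtain ⟨h, hh, rfl⟩ := H.trans hU1 hU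
    have h1 := hnorm h hh _ (base _ (RS_conj' h ha) _ (RS_conj' h hb))
    have e : h * ⁅h⁻¹ * a * h, h⁻¹ * b * h⁆ * h⁻¹ = ⁅a, b⁆ := by
      rw [commutatorElement_def, commutatorElement_def]; group
    rwa [e] at h1
  refine H.comm_le.trans ?_
  unfold Subgroup.normalClosure
  rw [Subgroup.closure_le]
  intro x hx
  rw [Group.mem_conjugatesOfSet_iff] at hx
  obtain ⟨y, ⟨U, hU, a, ha, b, hb, rfl⟩, hy⟩ := hx
  obtain ⟨h, rfl⟩ := isConj_iff.1 hy
  refine hall ⟨h • U, H.h2' U hU h, _, RS_conj h ha, _, RS_conj h hb, ?_⟩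
  rw [commutatorElement_def, commutatorElement_def]; group

theorem simple [FaithfulSMul Γ X] (H : CellSys Γ C) : IsSimpleGroup (commutator Γ) := by
  have hnt : Nontrivial (commutator Γ) := by
    obtain ⟨U, hU⟩ := H.ne
    obtain ⟨V, hV, hd⟩ := H.h6 U hU
    obtain ⟨h, hh, e⟩ := H.trans hU hV
    refine ⟨⟨⟨h, hh⟩, 1, fun e' => ?_⟩⟩
    have : h = 1 := congrArg Subtype.val e'
    rw [this, one_smul] at e
    rw [← e] at hd
    exact (H.ne' U hU).ne_empty (disjoint_self.1 hd)
  refine { exists_pair_ne := hnt.exists_pair_ne, eq_bot_or_eq_top_of_normal := fun N hN => ?_ }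
  by_cases hbot : N = ⊥
  · exact Or.inl hbot
  right
  obtain ⟨g, hg⟩ := Subgroup.ne_bot_iff_exists_ne_one.1 hbot
  have := H.key (N.map (commutator Γ).subtype) (by
    rintro h hh _ ⟨n, hn, rfl⟩
    exact ⟨⟨h, hh⟩ * n * ⟨h, hh⟩⁻¹, hN.conj_mem n hn _, rfl⟩) (g := g.1.1) ⟨g.1, g.2, rfl⟩
    (fun e => hg (Subtype.ext (Subtype.ext e)))
  rw [eq_top_iff]
  intro x _
  obtain ⟨y, hy, e⟩ := this x.2
  rwa [← Subtype.ext e]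

end CellSys
end Abstract
end Waz

open Topology
/-! ## Part 8 : simplicity of the commutator subgroup -/

namespace Waz
variable {m : ℕ}
open scoped Pointwise

instance actX : MulAction (HX m) (XX m) where
  smul f x := f x
  one_smul _ := rfl
  mul_smul _ _ _ := rfl

instance faithX : FaithfulSMul (GG m) (XX m) :=
  ⟨fun h => Subtype.ext (Homeomorph.ext h)⟩

def Cells (m : ℕ) : Set (Set (XX m)) := {C | ∃ t, Cell t C}

theorem smul_eq_image (g : GG m) (U : Set (XX m)) : g • U = (g : HX m) '' U := rfl

theorem rist_RS {C : Set (XX m)} {g : HX m} (h : g ∈ rist (GG m) C) : (⟨g, h.1⟩ : GG m) ∈ RS (GG m) C :=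
  fun x hx => h.2 x hx

theorem other_cell {p : XX m} {U} (h : Cell p U) : ∃ V, Cell p V ∧ Disjoint U V := by
  obtain ⟨⟨w, r, rfl⟩, _⟩ := id h
  obtain ⟨c, rfl⟩ := cell_iff.1 h
  obtain ⟨c', hc'⟩ : ∃ c', c' ≠ c := by
    cases c with
    | none => exact ⟨some none, by simp⟩
    | some c => exact ⟨none, by simp⟩
  refine ⟨cmp w r c', cell_cmp w r c', Set.disjoint_left.2 fun x h1 h2 => hc' (cmp_disj w r h2 h1)⟩

theorem Cell.exists_isB (hm : 1 ≤ m) {p : XX m} {U} (h : Cell p U) : ∃ q ∈ U, isB q := by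
  obtain ⟨g, hg, e1, e2⟩ := cell_trans hm Z0_cell h
  refine ⟨g (br [] hf), e2 ▸ ⟨br [] hf, ?_, rfl⟩, isB_image hm g (isB_br _ _)⟩
  show (1/4:ℝ) < 1/2
  norm_num

theorem cells_h5 (hm : 1 ≤ m) {p q : XX m} {U V} (hU : Cell p U) (hV : Cell q V) :
    Disjoint U V ∨ (∃ W ∈ Cells m, U ⊆ W ∧ V ⊆ W) ∨
    ∃ Z ∈ Cells m, V ⊆ Z ∧ ∃ k ∈ RS (GG m) Z, Disjoint U (k • V) := by
  by_cases hpq : p = q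
  · subst hpq
    rcases hU.eq_or_disj hV with h | h
    · exact Or.inr (Or.inl ⟨V, ⟨p, hV⟩, h.le, le_rfl⟩)
    · exact Or.inl h
  by_cases hq : q ∈ U
  swap
  · have h1 := hU.subset hq (Ne.symm hpq)
    rcases hV.eq_or_disj (cell_comp hV.1 hpq) with h | h
    · exact Or.inr (Or.inl ⟨V, ⟨q, hV⟩, h ▸ h1, le_rfl⟩)
    · exact Or.inl (h.symm.mono_left h1)
  by_cases hp : p ∈ V
  swap
  · have h1 := hV.subset hp hpq
    rcases hU.eq_or_disj (cell_comp hU.1 (Ne.symm hpq)) with h | h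
    · exact Or.inr (Or.inl ⟨U, ⟨p, hU⟩, le_rfl, h ▸ h1⟩)
    · exact Or.inl (h.mono_right h1)
  right; right
  obtain ⟨D, hD, hDV⟩ := other_cell hV
  obtain ⟨q', hq', hB⟩ := hD.exists_isB hm
  obtain ⟨V2, hV2, hdV2⟩ := other_cell hU
  have hDU : D ⊆ U := by
    rw [hU.eq_comp hq]
    exact hD.subset (Set.disjoint_left.1 hDV hp) hpq
  have n1 : q' ≠ q := fun e => hD.not_mem (e ▸ hq')
  have n2 : q' ∉ V := Set.disjoint_right.1 hDV hq'
  have hVZ := hV.subset n2 n1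
  obtain ⟨k, hk, _, e⟩ := subcell hm (cell_comp hB (Ne.symm n1)) hV hV2 (mem_comp_self (Ne.symm n1)) (hVZ hp) n2
    (Set.disjoint_left.1 hdV2 (hDU hq'))
  refine ⟨comp q' q, ⟨q', cell_comp hB (Ne.symm n1)⟩, hVZ, ⟨k, hk.1⟩, rist_RS hk, ?_⟩
  rw [smul_eq_image]
  show Disjoint U (k '' V)
  rwa [e]

theorem not_isolated (x : XX m) {S : Set (XX m)} (hS : IsOpen S) (hx : x ∈ S) : ∃ y ∈ S, y ≠ x := by
  by_contra hcon
  push Not at hcon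
  have e : S = {x} := Set.eq_singleton_iff_unique_mem.2 ⟨hx, hcon⟩
  have hu : S = Set.univ := IsClopen.eq_univ ⟨e ▸ isClosed_singleton, hS⟩ ⟨x, hx⟩
  have h1 : br [] hf = x := hcon _ (hu ▸ Set.mem_univ _)
  have h2 : zeroPt m = x := hcon _ (hu ▸ Set.mem_univ _)
  have h3 := congrArg (fun x : XX m => x.1 []) (h1.trans h2.symm)
  have h4 : (1/2:ℝ) = 0 := h3
  norm_num at h4

theorem good_r (F : Finset (EE m)) (e : EE m) (i : Fin m) {a b : ℝ} (h : a < b) (ha : a < 1) (hb : 0 < b) :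
    ∃ r : DD, a < r ∧ (r:ℝ) < b ∧ ∀ u, e ++ (r, i) :: u ∉ F := by
  let B : Set DD := {r | (a < r ∧ (r:ℝ) < b) ∧ ∃ u, e ++ (r, i) :: u ∈ F}
  have hB : B.Finite := by
    have h1 : ((fun f : EE m => ((f.drop e.length).head?).map Prod.fst) '' (F : Set (EE m))).Finite :=
      F.finite_toSet.image _
    refine Set.Finite.of_finite_image (h1.subset ?_) (Set.injOn_of_injective (Option.some_injective DD))
    rintro _ ⟨r, ⟨_, u, hu⟩, rfl⟩
    exact ⟨_, hu, by simp⟩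
  by_cases hne : B.Nonempty
  · obtain ⟨r0, h0, hmin⟩ := Set.exists_min_image B (fun r => (r:ℝ)) hB hne
    obtain ⟨r, h1, h2⟩ := exists_DD h0.1.1 ha r0.2.1
    have h3 := h0.1.2
    refine ⟨r, h1, h2.trans h3, fun u hu => ?_⟩
    have := hmin r ⟨⟨h1, h2.trans h3⟩, u, hu⟩
    linarith
  · obtain ⟨r, h1, h2⟩ := exists_DD h ha hb
    exact ⟨r, h1, h2, fun u hu => hne ⟨r, ⟨h1, h2⟩, u, hu⟩⟩

theorem cell_in_open (hm : 1 ≤ m) {O : Set (XX m)} (hO : IsOpen O) (hne : O.Nonempty) : ∃ W ∈ Cells m, W ⊆ O := by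
  obtain ⟨x, hx⟩ := hne
  obtain ⟨F, ε, hε, hb⟩ := exists_boxN (hO.mem_nhds hx)
  obtain ⟨y, hy, hyx⟩ := not_isolated x (isOpen_boxN x F ε) (mem_boxN x F hε)
  obtain ⟨e, a, b, h1, h2, h3, h4⟩ := exists_br_mem (cvx_boxN x F ε).isPreconnected (mem_boxN x F hε) hy hyx.symm
  let i : Fin m := ⟨0, hm⟩
  obtain ⟨r, c1, c2, c3⟩ := good_r F e i h1 h2 h3
  refine ⟨cmp e r (some (some i)), ⟨br e r, cell_cmp e r _⟩, fun z hz => hb fun f hF => ?_⟩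
  have hz : 0 < z.1 (e ++ [(r, i)]) := hz
  have heq : z.1 f = (br e r).1 f := by
    by_cases hf' : ∃ c u, f = e ++ c :: u
    · obtain ⟨c, u, rfl⟩ := hf'
      have d1 : (br e r).1 (e ++ c :: u) = 0 := by
        have := zero_ext _ _ u (br_child e r c)
        simpa using this
      rw [d1]
      have d2 : z.1 (e ++ [c]) = 0 := by
        by_contra hc
        obtain rfl := z.2.ex e _ _ hz.ne' hc
        exact c3 u hF
      have := zero_ext _ _ u d2
      simpa using this
    · refine det e _ _ ?_ ?_ f hf'
      · rw [hang_val hz, br_self]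
      · rw [hang_val hz]; exact r.2.1.ne'
  rw [heq]
  exact h4 r c1 c2 f hF

theorem cells_h1 (hm : 1 ≤ m) (g : HX m) (hg : g ≠ 1) : ∃ W ∈ Cells m, Disjoint (g '' W) W := by
  have : ∃ x, g x ≠ x := by
    by_contra hcon
    push Not at hcon
    exact hg (Homeomorph.ext hcon)
  obtain ⟨x, hx⟩ := this
  obtain ⟨U, V, hU, hV, h1, h2, hd⟩ := t2_separation hx
  obtain ⟨W, hW, hs⟩ := cell_in_open hm ((hU.preimage g.continuous).inter hV) ⟨x, h1, h2⟩
  refine ⟨W, hW, hd.mono ?_ fun y hy => (hs hy).2⟩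
  rintro _ ⟨y, hy, rfl⟩
  exact (hs hy).1

theorem rho_r (i : Fin m) : (rho : HX m) ∈ rist (GG m) (cmp [(hf, i)] hf none) := by
  refine ⟨rho_mem, fun x hx => hat_fix _ ?_⟩
  have h1 : ¬ (x.1 [(hf, i)] < (1/2:ℝ)) := hx
  have h2 : x.1 [] = 1/2 := par_nil x (a := (hf, i)) (v := []) (by
    intro h
    rw [h] at h1
    norm_num at h1)
  show 1 - x.1 [] = x.1 []
  rw [h2]; norm_num

theorem cells_h4 (hm : 1 ≤ m) : Subgroup.closure {g : GG m | ∃ U ∈ Cells m, g ∈ RS (GG m) U} = ⊤ := by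
  rw [eq_top_iff]
  rintro ⟨g, hg⟩ _
  have aux : ∀ {C} (g : HX m) (hg : g ∈ GG m), C ∈ Cells m → g ∈ rist (GG m) C →
      (⟨g, hg⟩ : GG m) ∈ Subgroup.closure {g : GG m | ∃ U ∈ Cells m, g ∈ RS (GG m) U} :=
    fun g hg hC h => Subgroup.subset_closure ⟨_, hC, rist_RS h⟩
  have hZ : Z0 m ∈ Cells m := ⟨_, Z0_cell⟩
  induction hg using Subgroup.closure_induction with
  | mem g hg' =>
    have hgG : g ∈ GG m := Subgroup.subset_closure hg'
    rcases hg' with (rfl | rfl | rfl | rfl | rfl) | ⟨i, rfl⟩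
    · exact aux _ hgG hZ (rist_mono I0_sub F1_r)
    · exact aux _ hgG hZ (rist_mono I0_sub F2_r)
    · exact aux _ hgG hZ F3_r
    · exact aux _ hgG hZ F4_r
    · exact aux _ hgG ⟨_, cell_cmp _ _ _⟩ (rho_r ⟨0, hm⟩)
    · exact aux _ hgG hZ (sg_r i)
  | one => exact one_mem _
  | mul x y hx hy h1 h2 => exact mul_mem (h1 trivial) (h2 trivial)
  | inv x hx h => exact inv_mem (h trivial)

theorem disj_image {g : HX m} {A B : Set (XX m)} (h : Disjoint A B) : Disjoint (g '' A) (g '' B) :=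
  (Set.disjoint_image_iff g.injective).2 h

theorem cellSys (hm : 2 ≤ m) : CellSys (GG m) (Cells m) where
  ne := ⟨_, _, Z0_cell⟩
  ne' := by
    rintro U ⟨t, h⟩
    exact h.nonempty
  h1 := fun g hg => cells_h1 (by omega) g.1 fun e => hg (Subtype.ext e)
  h2 := by
    rintro U ⟨t, h⟩ V ⟨t', h'⟩
    obtain ⟨g, hg, _, e⟩ := cell_trans (by omega) h h'
    exact ⟨⟨g, hg⟩, e⟩
  h2' := by
    rintro U ⟨t, h⟩ c
    exact ⟨_, h.image (by omega) c.1⟩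
  h3 := by
    rintro W ⟨t, h⟩
    obtain ⟨g, hg, _, rfl⟩ := cell_trans (by omega) Z0_cell h
    have hh : ∀ c : Option (Fin m), cmp [] hf (some c) ⊆ Z0 m := by
      rintro (_ | i) x hx
      · have hx : (1/2:ℝ) < x.1 [] := hx
        rw [mem_Z0]; linarith
      · have hx : 0 < x.1 ([] ++ [(hf, i)]) := hx
        have := hang_val hx
        have h2 : x.1 [] = 1/2 := this
        rw [mem_Z0, h2]; norm_num
    have hd : ∀ c d : Option (Option (Fin m)), c ≠ d → Disjoint (cmp [] hf c) (cmp (m := m) [] hf d) :=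
      fun c d hcd => Set.disjoint_left.2 fun x h1 h2 => hcd (cmp_disj _ _ h1 h2)
    let i0 : Fin m := ⟨0, by omega⟩
    let i1 : Fin m := ⟨1, by omega⟩
    refine ⟨_, ⟨_, (cell_cmp [] hf (some none)).image (by omega) g⟩,
      _, ⟨_, (cell_cmp [] hf (some (some i0))).image (by omega) g⟩,
      _, ⟨_, (cell_cmp [] hf (some (some i1))).image (by omega) g⟩,
      Set.image_mono (hh _), Set.image_mono (hh _), Set.image_mono (hh _),
      disj_image (hd _ _ (by simp)), disj_image (hd _ _ (by simp)), disj_image (hd _ _ (by simp [i0, i1]))⟩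
  h4 := cells_h4 (by omega)
  h5 := by
    rintro U ⟨p, hU⟩ V ⟨q, hV⟩
    exact cells_h5 (by omega) hU hV
  h6 := by
    rintro U ⟨t, h⟩
    obtain ⟨V, hV, hd⟩ := other_cell h
    exact ⟨V, ⟨t, hV⟩, hd⟩

theorem GG_simple (hm : 2 ≤ m) : IsSimpleGroup (commutator (GG m)) := (cellSys hm).simple

end Waz

open Topology
namespace Waz
variable {m : ℕ}

/-! ### infinite index -/

theorem bco_init (w : EE m) (r : ℝ) (v : EE m) (h : bco w r v ≠ 0) : v <+: w := by
  induction w generalizing v with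
  | nil =>
    cases v with
    | nil => exact List.prefix_rfl
    | cons b v => exact absurd rfl h
  | cons a w ih =>
    cases v with
    | nil => exact List.nil_prefix
    | cons b v =>
      unfold bco at h
      by_cases hb : b = a
      · rw [if_pos hb] at h
        rw [hb]
        exact List.prefix_cons_inj a |>.2 (ih v h)
      · rw [if_neg hb] at h; exact absurd rfl h

theorem br_inj {w w' : EE m} {r r' : DD} (h : br w r = br w' r') : w = w' ∧ r = r' := by
  have h1 : w' <+: w := bco_init w r w' (by
    have : (br w r).1 w' = r' := by rw [h]; exact br_self _ _
    have h2 : bco w r w' = r' := this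
    rw [h2]; exact r'.2.1.ne')
  have h2 : w <+: w' := bco_init w' r' w (by
    have : (br w' r').1 w = r := by rw [← h]; exact br_self _ _
    have h2 : bco w' r' w = r := this
    rw [h2]; exact r.2.1.ne')
  have e : w = w' := h2.eq_of_length (le_antisymm h2.length_le h1.length_le)
  subst e
  refine ⟨rfl, Subtype.ext ?_⟩
  rw [← br_self w r, h, br_self]

def Qd (r : ℝ) : Prop := ∃ k : ℕ, r = 1 - (1/2:ℝ) ^ (k+1)

theorem Qd.ge {r : ℝ} (h : Qd r) : 1/2 ≤ r := by
  obtain ⟨k, rfl⟩ := h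
  have : (1/2:ℝ)^k ≤ 1 := pow_le_one₀ (by norm_num) (by norm_num)
  rw [pow_succ]; linarith

theorem Qd.up {r : ℝ} (h : Qd r) : Qd ((1 + r)/2) := by
  obtain ⟨k, rfl⟩ := h
  exact ⟨k+1, by rw [pow_succ _ (k+1)]; ring⟩

theorem Qd.down {r : ℝ} (h : Qd ((1 + r)/2)) (hr : 0 < r) : Qd r := by
  obtain ⟨k, hk⟩ := h
  cases k with
  | zero => norm_num at hk; linarith
  | succ k => exact ⟨k, by rw [pow_succ _ (k+1)] at hk; linarith⟩

theorem Qd.cases {r : ℝ} (h : Qd r) : r = 1/2 ∨ r = 3/4 ∨ r = 7/8 ∨ r = 15/16 ∨ 15/16 < r := by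
  obtain ⟨k, rfl⟩ := h
  rcases k with _ | _ | _ | _ | k
  · norm_num
  · norm_num
  · norm_num
  · norm_num
  · right; right; right; right
    have : (1/2:ℝ)^k ≤ 1 := pow_le_one₀ (by norm_num) (by norm_num)
    have e : (1/2:ℝ)^(k+1+1+1+1+1) = (1/2)^k * (1/32) := by ring
    rw [e]; linarith

def Pd (r : ℝ) : Prop := Qd r ∨ Qd (1 - r)

theorem Pd.cases {r : ℝ} (h : Pd r) : r = 1/2 ∨ r = 3/4 ∨ r = 7/8 ∨ r = 15/16 ∨ r = 1/4 ∨ r < 1/4 ∨ 15/16 < r := by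
  rcases h with h | h
  · rcases h.cases with h | h | h | h | h <;> simp [h]
  · rcases h.cases with h | h | h | h | h
    · left; linarith
    · right; right; right; right; left; linarith
    all_goals right; right; right; right; right; left; linarith

theorem Pd_iff {r : ℝ} (h : 1/2 < r) : Pd r ↔ Qd r :=
  ⟨fun h' => h'.elim id fun h2 => by have := h2.ge; linarith, Or.inl⟩

theorem Pd_up {r : ℝ} (h : 1/2 < r) : Pd r ↔ Pd ((1 + r)/2) := by
  rw [Pd_iff h, Pd_iff (by linarith)]
  exact ⟨Qd.up, fun h' => h'.down (by linarith)⟩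

def AA (m : ℕ) : Set (XX m) := {x | ∃ w r, x = br w r ∧ (Qd (r:ℝ) ∨ w = [] ∧ Qd (1 - r))}

theorem mem_AA_nil (r : DD) : (br [] r : XX m) ∈ AA m ↔ Pd r := by
  constructor
  · rintro ⟨w, s, h, h'⟩
    obtain ⟨rfl, rfl⟩ := br_inj h
    exact h'.imp id (·.2)
  · intro h
    exact ⟨[], r, rfl, h.imp id (⟨rfl, ·⟩)⟩

theorem mem_AA_cons (a : DD × Fin m) (w : EE m) (r : DD) : (br (a :: w) r : XX m) ∈ AA m ↔ Qd r := by
  constructor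
  · rintro ⟨w, s, h, h'⟩
    obtain ⟨rfl, rfl⟩ := br_inj h
    exact h'.elim id (fun h => absurd h.1 (by simp))
  · intro h
    exact ⟨_, r, rfl, Or.inl h⟩

theorem mem_AA_isB {x : XX m} (h : x ∈ AA m) : isB x := by
  obtain ⟨w, r, h, _⟩ := h
  exact ⟨w, r, h⟩

theorem sg_AA' (i : Fin m) {x : XX m} (hx : x ∈ AA m) : sg i x ∈ AA m := by
  obtain ⟨w, r, rfl⟩ := mem_AA_isB hx
  rcases w with _ | ⟨⟨a, j⟩, w⟩
  · rw [mem_AA_nil] at hx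
    by_cases hr : hf < r
    · have h1 : sg i (br [] r) = br [(hf, i)] (dnD r hr) := by
        have := sg_br_one i (dnD r hr)
        rw [up_dn] at this
        rw [← this, sg_invol]
      rw [h1, mem_AA_cons]
      have h2 : (1/2:ℝ) < r := hr
      rw [Pd_iff h2] at hx
      have h3 : ((upD (dnD r hr) : DD) : ℝ) = r := by rw [up_dn]
      have h4 : (1 + ((dnD r hr : DD) : ℝ))/2 = r := h3
      rw [← h4] at hx
      exact hx.down (dnD r hr).2.1
    · have h2 : (r:ℝ) ≤ 1/2 := not_lt.1 hr
      rw [sg_fix i _ h2 (br_child [] r _), mem_AA_nil]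
      exact hx
  · rw [mem_AA_cons] at hx
    by_cases ha : hf < a
    · have h1 : sg i (br ((a, j) :: w) r) = br ((hf, i) :: (dnD a ha, j) :: w) r := by
        have := sg_br_two i (dnD a ha, j) w r
        simp only [up_dn] at this
        rw [← this, sg_invol]
      rw [h1, mem_AA_cons]; exact hx
    · by_cases he : (a, j) = (hf, i)
      · rw [he]
        rcases w with _ | ⟨b, w⟩
        · rw [sg_br_one, mem_AA_nil]
          exact Or.inl hx.up
        · rw [sg_br_two, mem_AA_cons]; exact hx
      · have h2 : (a:ℝ) ≤ 1/2 := not_lt.1 ha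
        rw [sg_fix i _ h2, mem_AA_cons]
        · exact hx
        · by_contra hne
          have := bco_init ((a, j) :: w) r [(hf, i)] hne
          rw [List.cons_prefix_cons] at this
          exact he this.1.symm

theorem sg_AA (i : Fin m) (x : XX m) : sg i x ∈ AA m ↔ x ∈ AA m :=
  ⟨fun h => by have := sg_AA' i h; rwa [sg_invol] at this, sg_AA' i⟩

theorem hat_AA (d : HD) (x : XX m) (h : ¬ (hat d x ∈ AA m ↔ x ∈ AA m)) :
    ∃ r : DD, x = br [] r ∧ ¬ (Pd (d.h r) ↔ Pd r) := by
  by_cases hB : isB x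
  · obtain ⟨w, r, rfl⟩ := hB
    rcases w with _ | ⟨⟨a, j⟩, w⟩
    · refine ⟨r, rfl, ?_⟩
      rw [hat_br_nil, mem_AA_nil, mem_AA_nil, d.hk] at h
      exact h
    · rw [hat_br_cons, mem_AA_cons, mem_AA_cons] at h
      exact absurd Iff.rfl h
  · exfalso
    apply h
    refine ⟨fun h => ?_, fun h => absurd (mem_AA_isB h) hB⟩
    exfalso
    apply hB
    obtain ⟨w, r, hw⟩ := mem_AA_isB h
    have e : x = hat d.symm (br w r) := by
      rw [← hw, ← hat_inv, hinvl]
    rw [e]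
    rcases w with _ | ⟨⟨a, j⟩, w⟩
    · rw [hat_br_nil]; exact isB_br _ _
    · rw [hat_br_cons]; exact isB_br _ _

theorem rho_AA (x : XX m) : rho x ∈ AA m ↔ x ∈ AA m := by
  by_contra h
  obtain ⟨r, _, h⟩ := hat_AA flD x h
  apply h
  show Pd (1 - (r:ℝ)) ↔ Pd r
  unfold Pd
  rw [sub_sub_cancel]
  exact or_comm

def TT (m : ℕ) : Set (XX m) := {x | ∃ r : DD, x = br [] r ∧ (r:ℝ) ∈ ({1/2, 3/4, 7/8, 15/16, 1/4} : Set ℝ)}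

theorem TT_fin : (TT m).Finite := by
  have h : ({r : DD | (r:ℝ) ∈ ({1/2, 3/4, 7/8, 15/16, 1/4} : Set ℝ)}).Finite :=
    Set.Finite.preimage Subtype.val_injective.injOn (Set.toFinite ({1/2, 3/4, 7/8, 15/16, 1/4} : Set ℝ))
  refine (h.image (fun r : DD => (br [] r : XX m))).subset ?_
  rintro x ⟨r, rfl, hr⟩
  exact ⟨r, hr, rfl⟩

/-- the elements changing finitely many points -/
def FS (g : HX m) : Prop := {x | ¬ (g x ∈ AA m ↔ x ∈ AA m)}.Finite

theorem FS_hat (d : HD) (h : ∀ r : ℝ, 0 < r → r < 1 → ¬ (Pd (d.h r) ↔ Pd r) →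
    (1/4 ≤ r ∧ r ≤ 15/16 ∧ 1/4 ≤ d.h r ∧ d.h r ≤ 15/16)) : FS (hat d : HX m) := by
  refine (TT_fin.union (TT_fin.preimage ((hat d : HX m).injective.injOn))).subset ?_
  intro x hx
  obtain ⟨r, rfl, hr⟩ := hat_AA d x hx
  obtain ⟨h1, h2, h3, h4⟩ := h r r.2.1 r.2.2.1 hr
  by_cases hP : Pd r
  · left
    refine ⟨r, rfl, ?_⟩
    rcases hP.cases with h | h | h | h | h | h | h
    iterate 5 simp [h]
    all_goals exfalso; linarith
  · right
    have hP' : Pd (d.h r) := by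
      by_contra hc
      exact hr ⟨fun h => absurd h hc, fun h => absurd h hP⟩
    refine ⟨d.k r, hat_br_nil d r, ?_⟩
    rw [d.hk]
    rcases hP'.cases with h | h | h | h | h | h | h
    iterate 5 simp [h]
    all_goals exfalso; linarith

theorem pl_ge {a l x : ℝ} : x ≤ pl a l x := le_max_left _ _

theorem FS_1 : FS (F1 : HX m) := by
  refine FS_hat _ fun r h0 h1 h => ?_
  change ¬ (Pd (pl _ _ r) ↔ Pd r) at h
  change _ ∧ _ ∧ _ ≤ pl _ _ r ∧ pl _ _ r ≤ _
  have ha : 1/4 ≤ r := by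
    by_contra hc
    rw [pl_out1 (by linarith)] at h; exact h Iff.rfl
  have hb : r ≤ 3/4 := by
    by_contra hc
    rw [pl_out2 (by linarith)] at h; exact h Iff.rfl
  have h3 : pl (1/4) (1/2) r ≤ pl (1/4) (1/2) (3/4) := pl_mono _ _ hb
  rw [pl_out2 (x := 3/4) (by norm_num)] at h3
  exact ⟨ha, by linarith, ha.trans pl_ge, by linarith⟩

theorem FS_2 : FS (F2 : HX m) := by
  refine FS_hat _ fun r h0 h1 h => ?_
  change ¬ (Pd (pl _ _ r) ↔ Pd r) at h
  change _ ∧ _ ∧ _ ≤ pl _ _ r ∧ pl _ _ r ≤ _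
  have ha : 1/2 ≤ r := by
    by_contra hc
    rw [pl_out1 (by linarith)] at h; exact h Iff.rfl
  have hb : r ≤ 3/4 := by
    by_contra hc
    rw [pl_out2 (by linarith)] at h; exact h Iff.rfl
  have h3 : pl (1/2) (1/4) r ≤ pl (1/2) (1/4) (3/4) := pl_mono _ _ hb
  rw [pl_out2 (x := 3/4) (by norm_num)] at h3
  exact ⟨by linarith, by linarith, le_trans (by linarith) pl_ge, by linarith⟩

theorem F3_aux {r : ℝ} (h : ¬ (Pd (pl (1/2) (1/2) r) ↔ Pd r)) : 1/2 < r ∧ r < 3/4 := by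
  constructor
  · by_contra hc
    rw [pl_out1 (by linarith)] at h; exact h Iff.rfl
  · by_contra hc
    have e : pl (1/2) (1/2) r = (1 + r)/2 := by
      by_cases h1 : r ≤ 1
      · rw [pl_3 (by linarith) (by linarith) (by norm_num)]; ring
      · exfalso
        rw [pl_out2 (by linarith)] at h; exact h Iff.rfl
    rw [e] at h
    exact h (Pd_up (by linarith)).symm

theorem FS_3 : FS (F3 : HX m) := by
  refine FS_hat _ fun r h0 h1 h => ?_
  change ¬ (Pd (pl _ _ r) ↔ Pd r) at h
  change _ ∧ _ ∧ _ ≤ pl _ _ r ∧ pl _ _ r ≤ _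
  obtain ⟨ha, hb⟩ := F3_aux h
  have h3 : pl (1/2) (1/2) r ≤ pl (1/2) (1/2) (3/4) := pl_mono _ _ hb.le
  rw [pl_3 (x := 3/4) (by norm_num) (by norm_num) (by norm_num)] at h3
  exact ⟨by linarith, by linarith, le_trans (by linarith) pl_ge, by linarith⟩

theorem FS_4 : FS (F4 : HX m) := by
  refine FS_hat _ fun r h0 h1 h => ?_
  change ¬ (Pd (pl _ _ r) ↔ Pd r) at h
  change _ ∧ _ ∧ _ ≤ pl _ _ r ∧ pl _ _ r ≤ _
  have ha : 3/4 < r := by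
    by_contra hc
    rw [pl_out1 (by linarith)] at h; exact h Iff.rfl
  have hb : r ≤ 7/8 := by
    by_contra hc
    rw [pl_3 (by linarith) (by linarith) (by norm_num)] at h
    have e : (r + 3/4 + 1/4)/2 = (1 + r)/2 := by ring
    rw [e] at h
    exact h (Pd_up (by linarith)).symm
  have h3 : pl (3/4) (1/4) r ≤ pl (3/4) (1/4) (7/8) := pl_mono _ _ hb
  rw [pl_3 (x := 7/8) (by norm_num) (by norm_num) (by norm_num)] at h3
  exact ⟨by linarith, by linarith, le_trans (by linarith) pl_ge, by linarith⟩

theorem FS_one : FS (1 : HX m) := by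
  refine Set.finite_empty.subset fun x hx => hx Iff.rfl

theorem FS_mul {g h : HX m} (hg : FS g) (hh : FS h) : FS (g * h) := by
  refine (hh.union (hg.preimage h.injective.injOn)).subset fun x hx => ?_
  by_contra hc
  rw [Set.mem_union, not_or] at hc
  have h1 : h x ∈ AA m ↔ x ∈ AA m := not_not.1 hc.1
  have h2 : g (h x) ∈ AA m ↔ h x ∈ AA m := not_not.1 hc.2
  exact hx (h2.trans h1)

theorem FS_inv {g : HX m} (hg : FS g) : FS g⁻¹ := by
  refine (hg.preimage (g⁻¹ : HX m).injective.injOn).subset fun x hx => ?_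
  intro hc
  rw [hinvr] at hc
  exact hx hc.symm

theorem FS_GG {g : HX m} (hg : g ∈ GG m) : FS g := by
  refine Subgroup.closure_induction (p := fun g _ => FS g) ?_ FS_one (fun _ _ _ _ => FS_mul)
    (fun _ _ => FS_inv) hg
  rintro g (hg | ⟨i, rfl⟩)
  · rcases hg with rfl | rfl | rfl | rfl | rfl
    · exact FS_1
    · exact FS_2
    · exact FS_3
    · exact FS_4
    · exact Set.finite_empty.subset fun x hx => hx (rho_AA x)
  · exact Set.finite_empty.subset fun x hx => hx (sg_AA i x)

open Classical in
noncomputable def chi (x : XX m) : ℤ := if x ∈ AA m then 1 else 0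

theorem chi_congr {x y : XX m} (h : y ∈ AA m ↔ x ∈ AA m) : chi y - chi x = 0 := by
  unfold chi
  by_cases hx : x ∈ AA m
  · rw [if_pos hx, if_pos (h.2 hx)]; rfl
  · rw [if_neg hx, if_neg (fun h' => hx (h.1 h'))]; rfl

theorem chi_supp {g : HX m} (hg : FS g) : (Function.support fun x => chi (g x) - chi x).Finite := by
  refine hg.subset fun x hx => ?_
  intro hc
  exact hx (chi_congr hc)

noncomputable def phi (g : HX m) : ℤ := ∑ᶠ x, (chi (g x) - chi x)

theorem phi_mul {g h : HX m} (hg : FS g) (hh : FS h) : phi (g * h) = phi g + phi h := by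
  have e : phi g = ∑ᶠ x, (chi (g (h x)) - chi (h x)) :=
    (finsum_comp_equiv h.toEquiv (f := fun x => chi (g x) - chi x)).symm
  rw [e]
  unfold phi
  rw [← finsum_add_distrib]
  · refine finsum_congr fun x => ?_
    rw [hmul]; ring
  · exact (chi_supp hg).preimage h.injective.injOn
  · exact chi_supp hh

noncomputable def Phi (m : ℕ) : GG m →* Multiplicative ℤ :=
  MonoidHom.mk' (fun g => Multiplicative.ofAdd (phi g.1)) fun g h => by
    rw [← ofAdd_add, ← phi_mul (FS_GG g.2) (FS_GG h.2)]; rfl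

noncomputable def f8 : DD := ⟨5/8, by norm_num, by norm_num, 3, 5, by norm_num⟩

theorem phi_F3 : phi (F3 : HX m) = 1 := by
  have key : ∀ x : XX m, x ≠ br [] f8 → chi (F3 x) - chi x = 0 := by
    intro x hx
    by_contra hne
    have h0 : ¬ ((F3 : HX m) x ∈ AA m ↔ x ∈ AA m) := by
      intro hc
      exact hne (chi_congr hc)
    obtain ⟨r, hxr, h⟩ := hat_AA _ x h0
    subst hxr
    change ¬ (Pd (pl _ _ r) ↔ Pd r) at h
    obtain ⟨ha, hb⟩ := F3_aux h
    have hP : ¬ Pd r := by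
      intro hP
      rcases hP.cases with h | h | h | h | h | h | h <;> linarith
    have hP' : Pd (pl (1/2) (1/2) r) := by
      by_contra hc
      exact h ⟨fun h => absurd h hc, fun h => absurd h hP⟩
    have h3 : pl (1/2) (1/2) r < 7/8 := by
      by_cases h5 : (r:ℝ) ≤ 5/8
      · rw [pl_1 (by linarith) (by linarith)]; linarith
      · rw [pl_2 (by linarith) (by linarith) (by norm_num)]; linarith
    have h4 : pl (1/2) (1/2) r = 3/4 := by
      have h6 : (r:ℝ) ≤ pl (1/2) (1/2) r := pl_ge
      rcases hP'.cases with h | h | h | h | h | h | h <;> linarith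
    apply hx
    have : r = f8 := by
      apply Subtype.ext
      show (r:ℝ) = 5/8
      by_cases h5 : (r:ℝ) ≤ 5/8
      · rw [pl_1 (by linarith) (by linarith)] at h4; linarith
      · rw [pl_2 (by linarith) (by linarith) (by norm_num)] at h4; linarith
    rw [this]
  unfold phi
  rw [finsum_eq_single _ (br [] f8) key]
  have h1 : (F3 : HX m) (br [] f8) ∈ AA m := by
    unfold F3
    rw [hat_br_nil, mem_AA_nil, HD.hk]
    show Pd (pl (1/2) (1/2) (5/8))
    rw [pl_1 (by norm_num) (by norm_num)]
    exact Or.inl ⟨1, by norm_num⟩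
  have h2 : (br [] f8 : XX m) ∉ AA m := by
    rw [mem_AA_nil]
    intro hP
    have hP : Pd (5/8) := hP
    rcases hP.cases with h | h | h | h | h | h | h <;> norm_num at h
  unfold chi
  rw [if_pos h1, if_neg h2]; norm_num

theorem GG_index : (commutator (GG m)).index = 0 := by
  have h1 : commutator (GG m) ≤ (Phi m).ker := Abelianization.commutator_subset_ker _
  have h2 : (Phi m).ker.index = 0 := by
    rw [Subgroup.index_ker]
    have hs : Function.Surjective (Phi m) := by
      intro z
      refine ⟨(⟨F3, F3_mem⟩ : GG m) ^ (Multiplicative.toAdd z), ?_⟩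
      rw [map_zpow]
      have : Phi m ⟨F3, F3_mem⟩ = Multiplicative.ofAdd 1 := by
        show Multiplicative.ofAdd (phi _) = _
        rw [phi_F3]
      rw [this, ← ofAdd_zsmul]; simp
    have : Infinite (Phi m).range := by
      rw [MonoidHom.range_eq_top.2 hs]
      exact Infinite.of_injective (fun z : Multiplicative ℤ => (⟨z, trivial⟩ : (⊤ : Subgroup (Multiplicative ℤ))))
        fun a b h => congrArg Subtype.val h
    exact Nat.card_eq_zero_of_infinite
  have := Subgroup.index_dvd_of_le h1
  rw [h2] at this
  exact Nat.eq_zero_of_zero_dvd this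

end Waz

theorem statement4 (n : ℕ) (hn : 4 ≤ n) :
    ∃ (X : Type) (_ : TopologicalSpace X) (_ : IsWazewskiDendrite n X)
      (G : Subgroup (X ≃ₜ X)),
      G.FG ∧ Dense (G : Set (X ≃ₜ X)) ∧
      IsSimpleGroup ↥(commutator G) ∧ (commutator G).index = 0 := by
  obtain ⟨m, rfl⟩ : ∃ m, n = m + 2 := ⟨n - 2, by omega⟩
  exact ⟨Waz.XX m, inferInstance, Waz.isWazewski_X, Waz.GG m, Waz.GG_fg, Waz.GG_dense (by omega),
    Waz.GG_simple (by omega), Waz.GG_index⟩
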